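/- For every even integer q ≥ 2 there exists β* > 0 such that for every real β with 0 < |β| ≤ β*, the limit of f_{n,q}(β)/n as n → ∞ along even n exists and equals (ℱ(t*) − 1 − log t*)/β, where t* ∈ (1/2, 3/2) is the unique solution of t*·Φ'(t*) = 1. -/

import Mathlib

open MeasureTheory Filter

noncomputable section

namespace SYK

attribute [local instance] Classical.propDecidable

/-- The chord crossing sign `K(x,y)`. -/
def K (x y : ℝ × ℝ) : ℝ :=
  if (x.1 < y.1 ∧ y.1 < x.2 ∧ x.2 < y.2) ∨ (y.1 < x.1 ∧ x.1 < y.2 ∧ y.2 < x.2) then -1 else 1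

lemma K_symm (x y : ℝ × ℝ) : K x y = K y x := if_congr or_comm rfl rfl

/-- The law of `(min U₁ U₂, max U₁ U₂)` for `U₁, U₂` i.i.d. uniform on `[0,1]`. -/
def nu : Measure (ℝ × ℝ) :=
  Measure.map (fun p : ℝ × ℝ => (min p.1 p.2, max p.1 p.2))
    (volume.restrict (Set.Icc (0 : ℝ) 1 ×ˢ Set.Icc (0 : ℝ) 1))

/-- `Ω = [0,1]²`. -/
def Omega : Set (ℝ × ℝ) := Set.Icc (0 : ℝ) 1 ×ˢ Set.Icc (0 : ℝ) 1

/-- The closed disk `{z : |z| ≤ e⁻²}`. -/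
def De : Set ℂ := Metric.closedBall 0 (Real.exp (-2))

/-- Membership in `ℱ_{e,Ω}`: continuous on the domain and bounded by `1` there. -/
def memF (G : ℂ → ℝ × ℝ → ℂ) : Prop :=
  ContinuousOn (fun p : ℂ × (ℝ × ℝ) => G p.1 p.2) (De ×ˢ Omega) ∧
    ∀ z ∈ De, ∀ x ∈ Omega, ‖G z x‖ ≤ 1

/-- `∏_{1 ≤ i < j ≤ d} K(y_i, y_j)`. -/
def pairProd (d : ℕ) (y : Fin d → ℝ × ℝ) : ℝ :=
  ∏ p ∈ Finset.univ.filter (fun p : Fin d × Fin d => p.1 < p.2), K (y p.1) (y p.2)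

/-- The `d`-th term of the series defining the operator `𝒯`. -/
def Tterm (q : ℕ) (G : ℂ → ℝ × ℝ → ℂ) (z : ℂ) (x : ℝ × ℝ) (d : ℕ) : ℂ :=
  ((d.factorial : ℂ))⁻¹ *
    ∫ y : Fin d → ℝ × ℝ,
      (∏ i, ((K x (y i) : ℂ) * (G z (y i)) ^ (q - 1) / ((q - 1).factorial : ℂ))) *
        (pairProd d y : ℂ) ∂(Measure.pi fun _ => nu)

/-- The operator `𝒯` (Chord-Cavity operator). -/
def Tcal (q : ℕ) (G : ℂ → ℝ × ℝ → ℂ) (z : ℂ) (x : ℝ × ℝ) : ℂ :=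
  z + z * ∑' d : ℕ, Tterm q G z x (d + 1)

/-- `H` is a Chord-Cavity-Generator: it lies in `ℱ_{e,Ω}` and satisfies the
fixed point equation on the domain. -/
def IsCCG (q : ℕ) (H : ℂ → ℝ × ℝ → ℂ) : Prop :=
  memF H ∧ ∀ z ∈ De, ∀ x ∈ Omega, H z x = Tcal q H z x

/-- Two vertices are related if some hyperedge of `E` contains both. -/
def edgeRel {N : ℕ} (E : Finset (Finset (Fin N))) (a b : Fin N) : Prop :=
  ∃ e ∈ E, a ∈ e ∧ b ∈ e

/-- A hypergraph on the full vertex set `Fin N` is connected. -/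
def HGConnected {N : ℕ} (E : Finset (Finset (Fin N))) : Prop :=
  ∀ a b : Fin N, Relation.ReflTransGen (edgeRel E) a b

/-- `E` is a `q`-uniform hypertree on the vertex set `Fin N`. -/
def IsHypertree (q N : ℕ) (E : Finset (Finset (Fin N))) : Prop :=
  (∀ e ∈ E, e.card = q) ∧ HGConnected E ∧ (q - 1) * E.card = N - 1

/-- The set `𝒯_N` of `q`-uniform hypertrees on `{1,…,N}`. -/
def trees (q N : ℕ) : Finset (Finset (Finset (Fin N))) :=
  Finset.univ.filter (IsHypertree q N)

/-- Sign contributed by an unordered pair of hyperedges with chords given by `X`. -/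
def pairSign {N : ℕ} (X : Finset (Fin N) → ℝ × ℝ) : Sym2 (Finset (Fin N)) → ℝ :=
  Sym2.lift ⟨fun e₁ e₂ => if Odd (e₁ ∩ e₂).card then K (X e₁) (X e₂) else 1,
    fun e₁ e₂ => if_congr (by rw [Finset.inter_comm]) (K_symm _ _) rfl⟩

/-- `B_H(X)`: the product of `K(X(e₁),X(e₂))` over unordered pairs of distinct
hyperedges sharing an odd number of vertices. -/
def BE {N : ℕ} (E : Finset (Finset (Fin N))) (X : Finset (Fin N) → ℝ × ℝ) : ℝ :=
  ∏ p ∈ E.sym2.filter (fun p => ¬ p.IsDiag), pairSign X p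

/-- `b_H`: the expectation of `B_H(X)` over i.i.d. chords with law `ν`. -/
def bT {N : ℕ} (E : Finset (Finset (Fin N))) : ℝ :=
  ∫ X : Finset (Fin N) → ℝ × ℝ, BE E X ∂(Measure.pi fun _ => nu)

/-- `ρ = ((q−1)! β² / 2^{q+1})^{1/(q−1)}`. -/
def rho (q : ℕ) (β : ℝ) : ℝ :=
  (((q - 1).factorial * β ^ 2 / 2 ^ (q + 1) : ℝ)) ^ ((q : ℝ) - 1)⁻¹

/-- `μ_v = (ρ^{v−1}/v!) Σ_{T ∈ 𝒯_v} b_T`. -/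
def mu (q : ℕ) (β : ℝ) (v : ℕ) : ℝ :=
  rho q β ^ (v - 1) / v.factorial * ∑ E ∈ trees q v, bT E

/-- The power series `Φ(z) = Σ_{v ≥ 1} μ_v z^v` (complex version). -/
def PhiC (q : ℕ) (β : ℝ) (z : ℂ) : ℂ :=
  ∑' v : ℕ, (mu q β (v + 1) : ℂ) * z ^ (v + 1)

/-- The power series `Φ(t) = Σ_{v ≥ 1} μ_v t^v` (real version). -/
def PhiR (q : ℕ) (β : ℝ) (t : ℝ) : ℝ :=
  ∑' v : ℕ, mu q β (v + 1) * t ^ (v + 1)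

/-- The `d`-th term of the series defining `ℛ`. -/
def Rterm (q : ℕ) (H : ℂ → ℝ × ℝ → ℂ) (z : ℂ) (d : ℕ) : ℂ :=
  ((d.factorial : ℂ))⁻¹ *
    ∫ y : Fin d → ℝ × ℝ,
      (∏ i, ((H z (y i)) ^ (q - 1) / ((q - 1).factorial : ℂ))) *
        (pairProd d y : ℂ) ∂(Measure.pi fun _ => nu)

/-- `ℛ(z)`, defined from a CCG `H`. -/
def Rcal (q : ℕ) (H : ℂ → ℝ × ℝ → ℂ) (z : ℂ) : ℂ :=
  z + z * ∑' d : ℕ, Rterm q H z (d + 1)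

/-- `ℰ(z) = (1/q!) ∫ H(z,x)^q dν(x)`. -/
def Ecal (q : ℕ) (H : ℂ → ℝ × ℝ → ℂ) (z : ℂ) : ℂ :=
  ((q.factorial : ℂ))⁻¹ * ∫ x, (H z x) ^ q ∂nu

/-- `ℱ(z) = ρ⁻¹ [ℛ(ρz) − (q−1) ℰ(ρz)]`. -/
def Fcal (q : ℕ) (β : ℝ) (H : ℂ → ℝ × ℝ → ℂ) (z : ℂ) : ℂ :=
  ((rho q β : ℝ) : ℂ)⁻¹ *
    (Rcal q H ((rho q β : ℝ) * z) - ((q : ℂ) - 1) * Ecal q H ((rho q β : ℝ) * z))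

/-- `σ = ((q−1)!/n^{q−1})^{1/2}`. -/
def sigma (q n : ℕ) : ℝ := Real.sqrt ((q - 1).factorial / (n : ℝ) ^ (q - 1))

def pX : Matrix (Fin 2) (Fin 2) ℂ := !![0, 1; 1, 0]
def pY : Matrix (Fin 2) (Fin 2) ℂ := !![0, -Complex.I; Complex.I, 0]
def pZ : Matrix (Fin 2) (Fin 2) ℂ := !![1, 0; 0, -1]

/-- The Majorana matrices `ψ_1, …, ψ_{2m}` (zero-based index `i : Fin (2m)`, so that
`ψ_{2j+1}` of the paper is `psiM m ⟨2j⟩` and `ψ_{2j+2}` is `psiM m ⟨2j+1⟩`), realized as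
the iterated Kronecker products `2^{-1/2} Z^{⊗j} ⊗ X ⊗ I₂^{⊗(m−j−1)}` resp.
`2^{-1/2} Z^{⊗j} ⊗ Y ⊗ I₂^{⊗(m−j−1)}`, written entrywise with rows and columns
indexed by `Fin m → Fin 2 ≃ Fin 2^m`. -/
def psiM (m : ℕ) (i : Fin (2 * m)) : Matrix (Fin m → Fin 2) (Fin m → Fin 2) ℂ :=
  fun a b => ((Real.sqrt 2 : ℝ) : ℂ)⁻¹ * ∏ k : Fin m,
    if (k : ℕ) < (i : ℕ) / 2 then pZ (a k) (b k)
    else if (k : ℕ) = (i : ℕ) / 2 then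
      (if (i : ℕ) % 2 = 0 then pX (a k) (b k) else pY (a k) (b k))
    else (if a k = b k then 1 else 0)

/-- `ψ_I = i^{q/2} ψ_{i₁} ⋯ ψ_{i_q}` for `I = {i₁ < ⋯ < i_q}` (matrix version). -/
def psiMSet (m q : ℕ) (I : Finset (Fin (2 * m))) :
    Matrix (Fin m → Fin 2) (Fin m → Fin 2) ℂ :=
  (Complex.I) ^ (q / 2) • ((I.sort (· ≤ ·)).map (psiM m)).prod

/-- The SYK Hamiltonian with Rademacher couplings given by the signs `s`. -/
def Hsyk (m q : ℕ) (s : {I : Finset (Fin (2 * m)) // I.card = q} → Bool) :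
    Matrix (Fin m → Fin 2) (Fin m → Fin 2) ℂ :=
  ∑ I : {I : Finset (Fin (2 * m)) // I.card = q},
    (((if s I then 1 else -1) * sigma q (2 * m) : ℝ) : ℂ) • psiMSet m q I.val

/-- Matrix exponential `e^A = Σ_k A^k/k!`. -/
def expM {m : ℕ} (A : Matrix (Fin m → Fin 2) (Fin m → Fin 2) ℂ) :
    Matrix (Fin m → Fin 2) (Fin m → Fin 2) ℂ :=
  ∑' k : ℕ, ((k.factorial : ℂ))⁻¹ • A ^ k

/-- `E[Z_{n,q}(β)]` for `n = 2m`: the uniform average over all sign choices of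
`2^{-n/2} Tr(exp(β H_SYK))`. -/
def EZ (m q : ℕ) (β : ℝ) : ℂ :=
  (∑ s : ({I : Finset (Fin (2 * m)) // I.card = q} → Bool),
      ((2 : ℂ) ^ m)⁻¹ * Matrix.trace (expM ((β : ℂ) • Hsyk m q s))) /
    (2 : ℂ) ^ (Fintype.card {I : Finset (Fin (2 * m)) // I.card = q})

/-- `f_{n,q}(β) = β⁻¹ log E[Z_{n,q}(β)]` for `n = 2m`. -/
def fEnergy (m q : ℕ) (β : ℝ) : ℝ := β⁻¹ * Real.log (EZ m q β).re

/-- The exponential generating polynomial of `c` without constant term. -/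
def genPoly (c : ℕ → ℝ) (n : ℕ) (z : ℂ) : ℂ :=
  ∑ i ∈ Finset.range n, ((c (i + 1) : ℂ) / ((i + 1).factorial : ℂ)) * z ^ (i + 1)

lemma genPoly_differentiable (c : ℕ → ℝ) (n : ℕ) : Differentiable ℂ (genPoly c n) := by
  unfold genPoly; fun_prop

lemma deriv_genPoly (c : ℕ → ℝ) (n : ℕ) :
    deriv (genPoly c n) = fun z => ∑ i ∈ Finset.range n, ((c (i + 1) : ℂ) / (i.factorial : ℂ)) * z ^ i := by
  funext z
  have : HasDerivAt (genPoly c n) (∑ i ∈ Finset.range n, ((c (i + 1) : ℂ) / (i.factorial : ℂ)) * z ^ i) z := by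
    unfold genPoly
    refine HasDerivAt.fun_sum fun i _ => ?_
    have h := (hasDerivAt_pow (i + 1) z).const_mul ((c (i + 1) : ℂ) / ((i + 1).factorial : ℂ))
    refine h.congr_deriv ?_
    rw [Nat.factorial_succ]
    have : ((i : ℂ) + 1) ≠ 0 := by exact_mod_cast Nat.succ_ne_zero i
    have h2 : (i.factorial : ℂ) ≠ 0 := by exact_mod_cast Nat.factorial_ne_zero i
    push_cast
    field_simp
  exact this.deriv

lemma iteratedDeriv_deriv_genPoly (c : ℕ → ℝ) (n j : ℕ) (hj : j < n) :
    iteratedDeriv j (deriv (genPoly c n)) 0 = c (j + 1) := by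
  rw [deriv_genPoly, iteratedDeriv_fun_sum (fun i _ => by fun_prop)]
  rw [Finset.sum_eq_single j]
  · rw [iteratedDeriv_const_mul_field, iteratedDeriv_fun_pow_zero]
    have h2 : (j.factorial : ℂ) ≠ 0 := by exact_mod_cast Nat.factorial_ne_zero j
    simp; field_simp
  · intro i _ hi
    rw [iteratedDeriv_const_mul_field, iteratedDeriv_fun_pow_zero]
    simp [hi.symm]
  · simp [hj]

lemma iteratedDeriv_exp_genPoly (c a : ℕ → ℝ) (n : ℕ) (h0 : a 0 = 1)
    (hrec : ∀ k < n, a (k + 1) = ∑ i ∈ Finset.range (k + 1), (k.choose i : ℝ) * c (i + 1) * a (k - i)) :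
    ∀ k ≤ n, iteratedDeriv k (fun z => Complex.exp (genPoly c n z)) 0 = a k := by
  intro k
  induction k using Nat.strong_induction_on with
  | _ k ih =>
    intro hk
    rcases k with _ | k
    · simp [genPoly, h0]
    · rw [iteratedDeriv_succ']
      have hd : deriv (fun z => Complex.exp (genPoly c n z))
          = deriv (genPoly c n) * (fun z => Complex.exp (genPoly c n z)) := by
        funext z
        have := ((genPoly_differentiable c n z).hasDerivAt).cexp
        rw [this.deriv]; simp [mul_comm]
      rw [hd, iteratedDeriv_mul, hrec k (by omega)]
      · push_cast
        refine Finset.sum_congr rfl fun i hi => ?_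
        have hi' : i < k + 1 := Finset.mem_range.1 hi
        rw [iteratedDeriv_deriv_genPoly c n i (by omega), ih (k - i) (by omega) (by omega)]
      · rw [deriv_genPoly]; fun_prop
      · exact ((genPoly_differentiable c n).cexp).contDiff.contDiffAt

lemma coeff_eq_integral (c a : ℕ → ℝ) (n : ℕ) (h0 : a 0 = 1)
    (hrec : ∀ k < n, a (k + 1) = ∑ i ∈ Finset.range (k + 1), (k.choose i : ℝ) * c (i + 1) * a (k - i))
    (r : ℝ) (hr : 0 < r) :
    (a n : ℂ) = n.factorial / (2 * Real.pi) / (r : ℂ) ^ n *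
      ∫ θ in (0 : ℝ)..2 * Real.pi, Complex.exp (genPoly c n (r * Complex.exp (θ * Complex.I)) -
        n * (θ * Complex.I)) := by
  have h1 := DiffContOnCl.circleIntegral_one_div_sub_center_pow_smul (E := ℂ)
    (f := fun z => Complex.exp (genPoly c n z)) (c := 0) hr n
    ((genPoly_differentiable c n).cexp).diffContOnCl
  rw [iteratedDeriv_exp_genPoly c a n h0 hrec n le_rfl] at h1
  have h2 : (∮ z in C(0, r), (1 / (z - 0) ^ (n + 1)) • Complex.exp (genPoly c n z)) =
      (Complex.I / (r : ℂ) ^ n) * ∫ θ in (0 : ℝ)..2 * Real.pi,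
        Complex.exp (genPoly c n (r * Complex.exp (θ * Complex.I)) - n * (θ * Complex.I)) := by
    rw [circleIntegral, ← intervalIntegral.integral_const_mul]
    refine intervalIntegral.integral_congr fun θ _ => ?_
    have hrc : (r : ℂ) ≠ 0 := by exact_mod_cast hr.ne'
    have he := Complex.exp_ne_zero (θ * Complex.I)
    simp only [deriv_circleMap, circleMap, zero_add, sub_zero, smul_eq_mul, Complex.exp_sub]
    rw [Complex.exp_nat_mul]
    field_simp
    ring
  rw [h2] at h1
  have hf : (n.factorial : ℂ) ≠ 0 := by exact_mod_cast Nat.factorial_ne_zero n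
  have hpi : (Real.pi : ℂ) ≠ 0 := by exact_mod_cast Real.pi_ne_zero
  have hrc : (r : ℂ) ^ n ≠ 0 := pow_ne_zero _ (by exact_mod_cast hr.ne')
  have hI := Complex.I_ne_zero
  generalize (∫ θ in (0 : ℝ)..2 * Real.pi,
        Complex.exp (genPoly c n (r * Complex.exp (θ * Complex.I)) - n * (θ * Complex.I))) = J at h1 ⊢
  simp only [smul_eq_mul] at h1
  field_simp at h1 ⊢
  linear_combination -h1

lemma genPoly_re (c : ℕ → ℝ) (n : ℕ) (r θ : ℝ) :
    (genPoly c n (r * Complex.exp (θ * Complex.I))).re =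
      ∑ i ∈ Finset.range n, c (i + 1) / (i + 1).factorial * r ^ (i + 1) * Real.cos ((i + 1 : ℕ) * θ) ∧
    (genPoly c n (r * Complex.exp (θ * Complex.I))).im =
      ∑ i ∈ Finset.range n, c (i + 1) / (i + 1).factorial * r ^ (i + 1) * Real.sin ((i + 1 : ℕ) * θ) := by
  have key : ∀ i : ℕ, ((c (i + 1) : ℂ) / ((i + 1).factorial : ℂ)) * (r * Complex.exp (θ * Complex.I)) ^ (i + 1)
      = ((c (i + 1) / (i + 1).factorial * r ^ (i + 1) : ℝ) : ℂ) *
        Complex.exp ((((i + 1 : ℕ) * θ : ℝ) : ℂ) * Complex.I) := by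
    intro i
    rw [mul_pow, ← Complex.exp_nat_mul]
    push_cast
    ring_nf
  unfold genPoly
  simp only [key, Complex.re_sum, Complex.im_sum, Complex.re_ofReal_mul, Complex.im_ofReal_mul,
    Complex.exp_ofReal_mul_I_re, Complex.exp_ofReal_mul_I_im, and_self]

lemma coeff_eq_real_integral (c a : ℕ → ℝ) (n : ℕ) (h0 : a 0 = 1)
    (hrec : ∀ k < n, a (k + 1) = ∑ i ∈ Finset.range (k + 1), (k.choose i : ℝ) * c (i + 1) * a (k - i))
    (r : ℝ) (hr : 0 < r) :
    a n = n.factorial / (2 * Real.pi) / r ^ n *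
      ∫ θ in (0 : ℝ)..2 * Real.pi,
        Real.exp (∑ i ∈ Finset.range n, c (i + 1) / (i + 1).factorial * r ^ (i + 1) * Real.cos ((i + 1 : ℕ) * θ)) *
        Real.cos ((∑ i ∈ Finset.range n, c (i + 1) / (i + 1).factorial * r ^ (i + 1) * Real.sin ((i + 1 : ℕ) * θ))
          - n * θ) := by
  have h := coeff_eq_integral c a n h0 hrec r hr
  set F : ℝ → ℂ := fun θ => Complex.exp (genPoly c n (r * Complex.exp (θ * Complex.I)) -
        n * (θ * Complex.I)) with hF
  have hFc : Continuous F := by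
    have := (genPoly_differentiable c n).continuous
    rw [hF]; fun_prop
  have hre : (∫ θ in (0 : ℝ)..2 * Real.pi, F θ).re = ∫ θ in (0 : ℝ)..2 * Real.pi, (F θ).re := by
    have := (Complex.reCLM).intervalIntegral_comp_comm (hFc.intervalIntegrable (μ := volume) 0 (2 * Real.pi))
    simpa using this.symm
  have h' : (a n : ℂ) = ((n.factorial / (2 * Real.pi) / r ^ n : ℝ) : ℂ) * ∫ θ in (0 : ℝ)..2 * Real.pi, F θ := by
    rw [h]; push_cast; rfl
  have h'' := congrArg Complex.re h'
  rw [Complex.re_ofReal_mul, hre, Complex.ofReal_re] at h''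
  rw [h'']
  congr 1
  refine intervalIntegral.integral_congr fun θ _ => ?_
  obtain ⟨e1, e2⟩ := genPoly_re c n r θ
  simp only [hF, Complex.exp_re, Complex.sub_re, Complex.sub_im, e1, e2]
  simp

lemma abs_sin_nat_mul_le (v : ℕ) (x : ℝ) : |Real.sin (v * x)| ≤ v * |Real.sin x| := by
  induction v with
  | zero => simp
  | succ v ih =>
    push_cast
    rw [add_mul, one_mul, Real.sin_add]
    calc |Real.sin (v * x) * Real.cos x + Real.cos (v * x) * Real.sin x|
        ≤ |Real.sin (v * x)| * |Real.cos x| + |Real.cos (v * x)| * |Real.sin x| := by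
          rw [← abs_mul, ← abs_mul]; exact abs_add_le _ _
      _ ≤ |Real.sin (v * x)| * 1 + 1 * |Real.sin x| := by
          gcongr <;> exact Real.abs_cos_le_one _
      _ ≤ _ := by linarith

lemma one_sub_cos_nat_mul_le (v : ℕ) (x : ℝ) :
    1 - Real.cos (v * x) ≤ v ^ 2 * (1 - Real.cos x) := by
  have h : ∀ y : ℝ, 1 - Real.cos y = 2 * Real.sin (y / 2) ^ 2 := by
    intro y
    have h1 := Real.cos_two_mul (y / 2)
    have h2 := Real.sin_sq_add_cos_sq (y / 2)
    rw [show 2 * (y / 2) = y by ring] at h1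
    linarith
  rw [h, h, show (v : ℝ) * x / 2 = v * (x / 2) by ring]
  have h3 := abs_sin_nat_mul_le v (x / 2)
  have h4 : Real.sin (v * (x / 2)) ^ 2 ≤ (v * |Real.sin (x / 2)|) ^ 2 := by
    rw [← sq_abs]; gcongr
  rw [mul_pow, sq_abs] at h4
  linarith

lemma abs_sin_sub_le (x : ℝ) : |Real.sin x - x| ≤ |x| ^ 3 / 6 := by
  have key : ∀ y : ℝ, 0 ≤ y → |Real.sin y - y| ≤ |y| ^ 3 / 6 := by
    intro y hy
    rw [abs_of_nonneg hy, abs_le]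
    have h1 := Real.sin_ge_sub_cube hy
    have h2 := Real.sin_le hy
    have : 0 ≤ y ^ 3 / 6 := by positivity
    constructor <;> linarith
  rcases le_total 0 x with h | h
  · exact key x h
  · have := key (-x) (by linarith)
    rw [Real.sin_neg, abs_neg] at this
    rwa [show -Real.sin x - -x = -(Real.sin x - x) by ring, abs_neg] at this

section Saddle
variable (κ : ℕ → ℝ) (n : ℕ)

/-- Logarithm of the modulus of the saddle point integrand, normalized to vanish at `0`. -/
def alphaS (θ : ℝ) : ℝ := ∑ i ∈ Finset.range n, κ i * (Real.cos ((i + 1 : ℕ) * θ) - 1)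

/-- Phase of the saddle point integrand. -/
def phaseS (θ : ℝ) : ℝ := (∑ i ∈ Finset.range n, κ i * Real.sin ((i + 1 : ℕ) * θ)) - θ

/-- The coefficients of a small perturbation of the identity with saddle point `1`. -/
structure IsSaddle : Prop where
  pos : 1 ≤ n
  lo : 1 / 2 ≤ κ 0
  hi : κ 0 ≤ 3 / 2
  sum : ∑ i ∈ Finset.range n, (i + 1 : ℝ) * κ i = 1
  tail : ∑ i ∈ Finset.Ico 1 n, |κ i| * (i + 1 : ℝ) ^ 3 ≤ 1 / 8

variable {κ n}

lemma IsSaddle.alpha_tail (h : IsSaddle κ n) (θ : ℝ) :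
    |alphaS κ n θ - κ 0 * (Real.cos θ - 1)| ≤ 1 / 8 * (1 - Real.cos θ) := by
  have h0 : 0 ≤ 1 - Real.cos θ := by linarith [Real.cos_le_one θ]
  have e : alphaS κ n θ - κ 0 * (Real.cos θ - 1) =
      ∑ i ∈ Finset.Ico 1 n, κ i * (Real.cos ((i + 1 : ℕ) * θ) - 1) := by
    unfold alphaS
    rw [Finset.range_eq_Ico, Finset.sum_eq_sum_Ico_succ_bot h.pos]
    simp
  rw [e]
  calc _ ≤ ∑ i ∈ Finset.Ico 1 n, |κ i * (Real.cos ((i + 1 : ℕ) * θ) - 1)| := Finset.abs_sum_le_sum_abs _ _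
    _ ≤ ∑ i ∈ Finset.Ico 1 n, |κ i| * (i + 1 : ℝ) ^ 3 * (1 - Real.cos θ) := by
        refine Finset.sum_le_sum fun i _ => ?_
        rw [abs_mul, mul_assoc]
        refine mul_le_mul_of_nonneg_left ?_ (abs_nonneg _)
        rw [abs_sub_comm, abs_of_nonneg (by linarith [Real.cos_le_one ((i + 1 : ℕ) * θ)])]
        refine (one_sub_cos_nat_mul_le (i + 1) θ).trans ?_
        refine mul_le_mul_of_nonneg_right ?_ h0
        push_cast
        have : (1 : ℝ) ≤ i + 1 := by linarith [Nat.cast_nonneg (α := ℝ) i]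
        exact pow_le_pow_right₀ this (by norm_num)
    _ ≤ _ := by
        rw [← Finset.sum_mul]
        exact mul_le_mul_of_nonneg_right h.tail h0

lemma IsSaddle.phase_le (h : IsSaddle κ n) (θ : ℝ) : |phaseS κ n θ| ≤ |θ| ^ 3 := by
  have e : phaseS κ n θ = ∑ i ∈ Finset.range n, κ i * (Real.sin ((i + 1 : ℕ) * θ) - (i + 1 : ℕ) * θ) := by
    unfold phaseS
    simp only [mul_sub, Finset.sum_sub_distrib]
    congr 1
    calc θ = (∑ i ∈ Finset.range n, (i + 1 : ℝ) * κ i) * θ := by rw [h.sum, one_mul]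
      _ = _ := by
        rw [Finset.sum_mul]; refine Finset.sum_congr rfl fun i _ => ?_
        push_cast; ring
  have hb : ∀ i : ℕ, |κ i * (Real.sin ((i + 1 : ℕ) * θ) - (i + 1 : ℕ) * θ)| ≤ |κ i| * (i + 1 : ℝ) ^ 3 * (|θ| ^ 3 / 6) := by
    intro i
    rw [abs_mul, mul_assoc]
    refine mul_le_mul_of_nonneg_left ?_ (abs_nonneg _)
    refine (abs_sin_sub_le _).trans ?_
    rw [abs_mul, mul_pow, Nat.abs_cast]; push_cast; apply le_of_eq; ring
  have h3 : 0 ≤ |θ| ^ 3 := by positivity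
  rw [e]
  calc _ ≤ ∑ i ∈ Finset.range n, |κ i| * (i + 1 : ℝ) ^ 3 * (|θ| ^ 3 / 6) :=
        (Finset.abs_sum_le_sum_abs _ _).trans (Finset.sum_le_sum fun i _ => hb i)
    _ = (|κ 0| + ∑ i ∈ Finset.Ico 1 n, |κ i| * (i + 1 : ℝ) ^ 3) * (|θ| ^ 3 / 6) := by
        rw [← Finset.sum_mul, Finset.range_eq_Ico, Finset.sum_eq_sum_Ico_succ_bot h.pos]; simp
    _ ≤ (3 / 2 + 1 / 8) * (|θ| ^ 3 / 6) := by
        have := h.tail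
        have h1 : |κ 0| ≤ 3 / 2 := by rw [abs_of_nonneg (by linarith [h.lo])]; exact h.hi
        gcongr
    _ ≤ _ := by linarith

lemma IsSaddle.alpha_le (h : IsSaddle κ n) (θ : ℝ) : alphaS κ n θ ≤ -(1 / 4) * (1 - Real.cos θ) := by
  have h0 : 0 ≤ 1 - Real.cos θ := by linarith [Real.cos_le_one θ]
  have h1 := (abs_le.1 (h.alpha_tail θ)).2
  have h2 := h.lo
  nlinarith

lemma IsSaddle.alpha_ge (h : IsSaddle κ n) (θ : ℝ) : -θ ^ 2 ≤ alphaS κ n θ := by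
  have h0 : 0 ≤ 1 - Real.cos θ := by linarith [Real.cos_le_one θ]
  have h1 := (abs_le.1 (h.alpha_tail θ)).1
  have h2 := h.hi
  have h3 := Real.one_sub_sq_div_two_le_cos (x := θ)
  nlinarith

lemma alphaS_continuous : Continuous (alphaS κ n) := by unfold alphaS; fun_prop
lemma phaseS_continuous : Continuous (phaseS κ n) := by unfold phaseS; fun_prop

lemma saddle_periodic :
    Function.Periodic (fun θ => Real.exp (n * alphaS κ n θ) * Real.cos (n * phaseS κ n θ)) (2 * Real.pi) := by
  intro θ
  have h1 : alphaS κ n (θ + 2 * Real.pi) = alphaS κ n θ := by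
    unfold alphaS
    refine Finset.sum_congr rfl fun i _ => ?_
    rw [mul_add, Real.cos_add_nat_mul_two_pi]
  have h2 : phaseS κ n (θ + 2 * Real.pi) = phaseS κ n θ - 2 * Real.pi := by
    unfold phaseS
    have : ∀ i : ℕ, Real.sin ((i + 1 : ℕ) * (θ + 2 * Real.pi)) = Real.sin ((i + 1 : ℕ) * θ) := by
      intro i; rw [mul_add, Real.sin_add_nat_mul_two_pi]
    simp only [this]; ring
  simp only [h1, h2, mul_sub]
  rw [Real.cos_sub_nat_mul_two_pi]

/-- The saddle point integral. -/
def saddleInt (κ : ℕ → ℝ) (n : ℕ) : ℝ :=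
  ∫ θ in (0 : ℝ)..2 * Real.pi, Real.exp (n * alphaS κ n θ) * Real.cos (n * phaseS κ n θ)

lemma saddleInt_eq : saddleInt κ n =
    ∫ θ in (-Real.pi)..Real.pi, Real.exp (n * alphaS κ n θ) * Real.cos (n * phaseS κ n θ) := by
  have := (saddle_periodic (κ := κ) (n := n)).intervalIntegral_add_eq 0 (-Real.pi)
  rw [zero_add, show -Real.pi + 2 * Real.pi = Real.pi by ring] at this
  exact this

lemma IsSaddle.int_le (h : IsSaddle κ n) : saddleInt κ n ≤ 2 * Real.pi := by
  unfold saddleInt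
  have hc := alphaS_continuous (κ := κ) (n := n)
  have hp := phaseS_continuous (κ := κ) (n := n)
  have h2 : (0 : ℝ) ≤ 2 * Real.pi := by positivity
  calc _ ≤ ∫ θ in (0 : ℝ)..2 * Real.pi, (1 : ℝ) := by
        refine intervalIntegral.integral_mono_on h2 (Continuous.intervalIntegrable (by fun_prop) _ _)
          (by simp) fun θ _ => ?_
        have h0 : 0 ≤ 1 - Real.cos θ := by linarith [Real.cos_le_one θ]
        have h1 : Real.exp (n * alphaS κ n θ) ≤ 1 := by
          rw [Real.exp_le_one_iff]
          have := h.alpha_le θ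
          have hn : (0 : ℝ) ≤ n := by positivity
          exact mul_nonpos_of_nonneg_of_nonpos hn (by linarith)
        calc _ ≤ Real.exp (n * alphaS κ n θ) * 1 := by
              gcongr; exact Real.cos_le_one _
          _ ≤ 1 := by simpa using h1
    _ = _ := by simp

lemma IsSaddle.integrand_ge (h : IsSaddle κ n) (hn : 8 ≤ n) (θ : ℝ) (hθ : |θ| ≤ Real.pi) :
    (Set.indicator (Set.Icc (-(1 / n : ℝ)) (1 / n)) (fun _ => (1 / 8 : ℝ)) θ)
      - Real.exp (-(1 / 100) * (n : ℝ) ^ (1 / 3 : ℝ)) ≤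
      Real.exp (n * alphaS κ n θ) * Real.cos (n * phaseS κ n θ) := by
  have hn0 : (8 : ℝ) ≤ n := by exact_mod_cast hn
  set s : ℝ := (n : ℝ) ^ (1 / 3 : ℝ) with hs
  have hs3 : s ^ 3 = n := by
    rw [hs, ← Real.rpow_natCast, ← Real.rpow_mul (by positivity)]; norm_num
  have hspos : 0 < s := by positivity
  have hs2 : 2 ≤ s := by
    by_contra hlt; push Not at hlt
    have : s ^ 3 < 2 ^ 3 := by gcongr
    rw [hs3] at this; linarith
  have hepos := Real.exp_pos (-(1 / 100) * s)
  by_cases hc : |θ| ≤ 1 / s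
  · have hph : |n * phaseS κ n θ| ≤ 1 := by
      rw [abs_mul, Nat.abs_cast]
      calc (n : ℝ) * |phaseS κ n θ| ≤ n * (1 / s) ^ 3 := by
            gcongr
            exact (h.phase_le θ).trans (by gcongr)
        _ = 1 := by rw [one_div, inv_pow, hs3]; field_simp
    have hcos : 1 / 2 ≤ Real.cos (n * phaseS κ n θ) := by
      have := Real.one_sub_sq_div_two_le_cos (x := n * phaseS κ n θ)
      have h2 : (n * phaseS κ n θ) ^ 2 ≤ 1 := by rw [← sq_abs]; exact pow_le_one₀ (abs_nonneg _) hph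
      linarith
    by_cases hin : θ ∈ Set.Icc (-(1 / n : ℝ)) (1 / n)
    · rw [Set.indicator_of_mem hin]
      have hle : |θ| ≤ 1 / n := abs_le.2 hin
      have : Real.exp (-1) ≤ Real.exp (n * alphaS κ n θ) := by
        apply Real.exp_le_exp.2
        have h1 := h.alpha_ge θ
        have h2 : θ ^ 2 ≤ (1 / n) ^ 2 := by rw [← sq_abs]; gcongr
        have h3 : (n : ℝ) * (1 / n) ^ 2 ≤ 1 := by
          have : (n : ℝ) * (1 / n) ^ 2 = 1 / n := by field_simp
          rw [this, div_le_one (by linarith)]; linarith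
        nlinarith
      have he : (1 / 4 : ℝ) ≤ Real.exp (-1) := by
        rw [Real.exp_neg, one_div]
        apply inv_anti₀ (Real.exp_pos _)
        linarith [Real.exp_one_lt_d9]
      nlinarith
    · rw [Set.indicator_of_notMem hin]
      have := Real.exp_pos (n * alphaS κ n θ)
      nlinarith
  · push Not at hc
    have hin : θ ∉ Set.Icc (-(1 / n : ℝ)) (1 / n) := by
      intro hin
      have hle : |θ| ≤ 1 / n := abs_le.2 hin
      have : (1 : ℝ) / n ≤ 1 / s := by
        apply one_div_le_one_div_of_le hspos
        rw [← hs3]; nlinarith [sq_nonneg s, sq_nonneg (s - 1)]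
      linarith
    rw [Set.indicator_of_notMem hin]
    have hcb := Real.cos_le_one_sub_mul_cos_sq hθ
    have hal : n * alphaS κ n θ ≤ -(1 / 100) * s := by
      have h1 := h.alpha_le θ
      have hpi : (1 / 20 : ℝ) ≤ 1 / 4 * (2 / Real.pi ^ 2) := by
        have := Real.pi_lt_d2
        have hpp := Real.pi_pos
        rw [show (1 / 4 : ℝ) * (2 / Real.pi ^ 2) = 1 / (2 * Real.pi ^ 2) by field_simp; norm_num]
        apply one_div_le_one_div_of_le (by positivity)
        nlinarith
      have h2 : (1 / s) ^ 2 ≤ θ ^ 2 := by rw [← sq_abs θ]; gcongr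
      have h3 : alphaS κ n θ ≤ -(1 / 20) * (1 / s) ^ 2 := by
        have : 1 / 20 * θ ^ 2 ≤ 1 / 4 * (2 / Real.pi ^ 2) * θ ^ 2 := by gcongr
        nlinarith
      calc n * alphaS κ n θ ≤ n * (-(1 / 20) * (1 / s) ^ 2) := by gcongr
        _ = -(1 / 20) * s := by rw [← hs3]; field_simp
        _ ≤ _ := by linarith
    have h5 : Real.exp (n * alphaS κ n θ) ≤ Real.exp (-(1 / 100) * s) := Real.exp_le_exp.2 hal
    have h6 := Real.neg_one_le_cos (n * phaseS κ n θ)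
    have h7 := Real.exp_pos (n * alphaS κ n θ)
    nlinarith

lemma IsSaddle.int_ge (h : IsSaddle κ n) (hn : 8 ≤ n) :
    1 / (4 * n : ℝ) - 2 * Real.pi * Real.exp (-(1 / 100) * (n : ℝ) ^ (1 / 3 : ℝ)) ≤ saddleInt κ n := by
  have hn0 : (8 : ℝ) ≤ n := by exact_mod_cast hn
  have hpi := Real.pi_gt_three
  have hle : (1 : ℝ) / n ≤ 1 := by rw [div_le_one (by linarith)]; linarith
  have hpos : (0 : ℝ) < 1 / n := by positivity
  rw [saddleInt_eq]
  have hc := alphaS_continuous (κ := κ) (n := n)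
  have hp := phaseS_continuous (κ := κ) (n := n)
  set E := Real.exp (-(1 / 100) * (n : ℝ) ^ (1 / 3 : ℝ))
  have hind : Integrable (Set.indicator (Set.Icc (-(1 / n : ℝ)) (1 / n)) (fun _ => (1 / 8 : ℝ))) volume :=
    (integrable_indicator_iff measurableSet_Icc).2 (by simp)
  have hval : ∫ θ in (-Real.pi)..Real.pi, Set.indicator (Set.Icc (-(1 / n : ℝ)) (1 / n)) (fun _ => (1 / 8 : ℝ)) θ
      = 1 / (4 * n : ℝ) := by
    rw [intervalIntegral.integral_of_le (by linarith), setIntegral_indicator measurableSet_Icc,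
      Set.inter_eq_right.2 (show Set.Icc (-(1 / n : ℝ)) (1 / n) ⊆ Set.Ioc (-Real.pi) Real.pi from
        fun x hx => ⟨by linarith [hx.1], by linarith [hx.2]⟩)]
    simp
    ring
  calc _ = ∫ θ in (-Real.pi)..Real.pi,
        ((Set.indicator (Set.Icc (-(1 / n : ℝ)) (1 / n)) (fun _ => (1 / 8 : ℝ)) θ) - E) := by
        rw [intervalIntegral.integral_sub hind.intervalIntegrable (by simp), hval]
        rw [intervalIntegral.integral_const, smul_eq_mul]; ring
    _ ≤ _ := by
        refine intervalIntegral.integral_mono_on (by linarith) (hind.intervalIntegrable.sub (by simp))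
          (Continuous.intervalIntegrable (by fun_prop) _ _) fun θ hθ => ?_
        exact h.integrand_ge hn θ (abs_le.2 hθ)

end Saddle

lemma eventually_saddleInt_ge : ∀ᶠ n : ℕ in atTop, ∀ κ : ℕ → ℝ, IsSaddle κ n →
    1 / (8 * n : ℝ) ≤ saddleInt κ n := by
  have h1 : Tendsto (fun n : ℕ => (n : ℝ) ^ (1 / 3 : ℝ)) atTop atTop :=
    (tendsto_rpow_atTop (by norm_num)).comp tendsto_natCast_atTop_atTop
  have h2 : Tendsto (fun x : ℝ => x ^ 3 * Real.exp (-(1 / 100) * x)) atTop (nhds 0) := by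
    refine (tendsto_rpow_mul_exp_neg_mul_atTop_nhds_zero 3 (1 / 100) (by norm_num)).congr fun x => ?_
    norm_cast
  have h3 := (h2.comp h1).const_mul (2 * Real.pi)
  rw [mul_zero] at h3
  filter_upwards [h3.eventually (gt_mem_nhds (show (0 : ℝ) < 1 / 8 by norm_num)), eventually_ge_atTop 8] with n hn h8 κ hκ
  have h := hκ.int_ge h8
  have hn0 : (0 : ℝ) < n := by have : 0 < n := by omega
                               exact_mod_cast this
  have hs3 : ((n : ℝ) ^ (1 / 3 : ℝ)) ^ 3 = n := by
    rw [← Real.rpow_natCast, ← Real.rpow_mul (by positivity)]; norm_num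
  simp only [Function.comp, hs3] at hn
  have : 2 * Real.pi * Real.exp (-(1 / 100) * (n : ℝ) ^ (1 / 3 : ℝ)) ≤ 1 / (8 * n) := by
    rw [le_div_iff₀ (by positivity)]; nlinarith
  have e : (1 : ℝ) / (4 * n) = 1 / (8 * n) + 1 / (8 * n) := by field_simp; norm_num
  linarith

/-- Coefficients of a small analytic perturbation of the identity. -/
structure GoodSeq (μ : ℕ → ℝ) : Prop where
  zero : μ 0 = 0
  one : μ 1 = 1
  small : ∀ v, 2 ≤ v → |μ v| * (v : ℝ) ^ 3 * 2 ^ v ≤ (1 / 4) ^ v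

/-- The power series with coefficients `μ`. -/
def PhiS (μ : ℕ → ℝ) (t : ℝ) : ℝ := ∑' v, μ v * t ^ v

/-- The Euler derivative `t Φ'(t)` of the power series with coefficients `μ`. -/
def gS (μ : ℕ → ℝ) (t : ℝ) : ℝ := ∑' v, v * μ v * t ^ v

lemma summable_quarter (C : ℝ) : Summable (fun v : ℕ => C * (1 / 4 : ℝ) ^ v) :=
  (summable_geometric_of_lt_one (by norm_num) (by norm_num)).mul_left C

lemma abs_tsum_tail_le {f : ℕ → ℝ} {C : ℝ} (hf : ∀ v, 2 ≤ v → |f v| ≤ C * (1 / 4) ^ v) :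
    Summable f ∧ |∑' v, f v - (f 0 + f 1)| ≤ C / 12 := by
  have h1 : ∀ v, ‖f (v + 2)‖ ≤ C / 16 * (1 / 4) ^ v := by
    intro v
    refine (hf (v + 2) (by omega)).trans (le_of_eq ?_)
    rw [pow_add]; ring
  have hs : Summable (fun v => f (v + 2)) := Summable.of_norm_bounded (summable_quarter _) h1
  have hs' : Summable f := (summable_nat_add_iff 2).1 hs
  refine ⟨hs', ?_⟩
  rw [← hs'.sum_add_tsum_nat_add 2]
  simp only [Finset.sum_range_succ, Finset.sum_range_zero, zero_add, add_sub_cancel_left]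
  refine (tsum_of_norm_bounded (g := fun v : ℕ => C / 16 * (1 / 4 : ℝ) ^ v)
    ((hasSum_geometric_of_lt_one (by norm_num) (by norm_num)).mul_left (C / 16)) h1).trans (le_of_eq ?_)
  norm_num; ring

lemma GoodSeq.small' {μ : ℕ → ℝ} (h : GoodSeq μ) (v : ℕ) : |μ v| * (v : ℝ) ^ 3 * 2 ^ v ≤ 8 * (1 / 4) ^ v := by
  rcases v with _ | _ | v
  · simp
  · simp [h.one]; norm_num
  · refine (h.small _ (by omega)).trans ?_
    have : (0 : ℝ) ≤ (1 / 4) ^ (v + 1 + 1) := by positivity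
    linarith

lemma GoodSeq.weight {μ : ℕ → ℝ} (h : GoodSeq μ) (v k : ℕ) (hk : k ≤ 3) :
    |μ v| * (v : ℝ) ^ k * 2 ^ v ≤ 8 * (1 / 4) ^ v := by
  rcases Nat.eq_zero_or_pos v with rfl | hv
  · simp [h.zero]
  · refine le_trans ?_ (h.small' v)
    have : (1 : ℝ) ≤ v := by exact_mod_cast hv
    gcongr

lemma GoodSeq.g_bound {μ : ℕ → ℝ} (h : GoodSeq μ) {t : ℝ} (ht : |t| ≤ 2) (v : ℕ) :
    |(v : ℝ) * μ v * t ^ v| ≤ 8 * (1 / 4) ^ v := by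
  refine le_trans ?_ (h.weight v 1 (by norm_num))
  rw [abs_mul, abs_mul, abs_pow, Nat.abs_cast, pow_one, mul_comm (v : ℝ)]
  gcongr

lemma GoodSeq.phi_bound {μ : ℕ → ℝ} (h : GoodSeq μ) {t : ℝ} (ht : |t| ≤ 2) (v : ℕ) :
    |μ v * t ^ v| ≤ 8 * (1 / 4) ^ v := by
  refine le_trans ?_ (h.weight v 0 (by norm_num))
  rw [abs_mul, abs_pow, pow_zero, mul_one]
  gcongr

lemma GoodSeq.g_summable {μ : ℕ → ℝ} (h : GoodSeq μ) {t : ℝ} (ht : |t| ≤ 2) :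
    Summable fun v : ℕ => (v : ℝ) * μ v * t ^ v :=
  Summable.of_norm_bounded (summable_quarter 8) (h.g_bound ht)

lemma abs_pow_sub_pow_le_of_le_two {s t : ℝ} (hs : |s| ≤ 2) (ht : |t| ≤ 2) (v : ℕ) :
    |t ^ v - s ^ v| ≤ v * 2 ^ v * |t - s| := by
  refine (abs_pow_sub_pow_le t s v).trans ?_
  rw [mul_assoc, mul_comm]
  refine mul_le_mul_of_nonneg_right ?_ (abs_nonneg _)
  gcongr
  calc _ ≤ (2 : ℝ) ^ (v - 1) := by gcongr; exact max_le ht hs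
    _ ≤ 2 ^ v := pow_le_pow_right₀ (by norm_num) (by omega)

lemma GoodSeq.g_lip {μ : ℕ → ℝ} (h : GoodSeq μ) {s t : ℝ} (hs : |s| ≤ 2) (ht : |t| ≤ 2) :
    |gS μ t - gS μ s - (t - s)| ≤ |t - s| / 12 := by
  have := abs_tsum_tail_le (f := fun v : ℕ => (v : ℝ) * μ v * t ^ v - v * μ v * s ^ v) (C := |t - s|) (by
    intro v hv
    rw [← mul_sub, abs_mul, abs_mul, Nat.abs_cast]
    calc (v : ℝ) * |μ v| * |t ^ v - s ^ v| ≤ v * |μ v| * (v * 2 ^ v * |t - s|) := by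
          gcongr; exact abs_pow_sub_pow_le_of_le_two hs ht v
      _ = |t - s| * (|μ v| * (v : ℝ) ^ 2 * 2 ^ v) := by ring
      _ ≤ |t - s| * (|μ v| * (v : ℝ) ^ 3 * 2 ^ v) := by
          have : (1 : ℝ) ≤ v := by exact_mod_cast (by omega : 1 ≤ v)
          gcongr; norm_num
      _ ≤ _ := by gcongr; exact h.small v hv)
  rw [(h.g_summable ht).tsum_sub (h.g_summable hs)] at this
  simpa [gS, h.zero, h.one] using this.2

lemma GoodSeq.g_zero {μ : ℕ → ℝ} : gS μ 0 = 0 := by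
  unfold gS
  rw [tsum_eq_single 0]
  · simp
  · intro v hv; simp [hv]

lemma GoodSeq.g_near {μ : ℕ → ℝ} (h : GoodSeq μ) {t : ℝ} (ht : |t| ≤ 2) : |gS μ t - t| ≤ |t| / 12 := by
  have := h.g_lip (s := 0) (t := t) (by simp) ht
  simpa [GoodSeq.g_zero] using this

lemma GoodSeq.exists_unique_saddle {μ : ℕ → ℝ} (h : GoodSeq μ) :
    ∃! t : ℝ, t ∈ Set.Ioo (1 / 2 : ℝ) (3 / 2) ∧ gS μ t = 1 := by
  have hab : ∀ t ∈ Set.Icc (1 / 2 : ℝ) (3 / 2), |t| ≤ 2 := fun t ht => by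
    rw [abs_le]; constructor <;> linarith [ht.1, ht.2]
  have hcont : ContinuousOn (gS μ) (Set.Icc (1 / 2) (3 / 2)) := by
    refine (LipschitzOnWith.of_dist_le_mul (K := 2) fun s hs t ht => ?_).continuousOn
    have := h.g_lip (hab t ht) (hab s hs)
    have h2 := abs_sub_abs_le_abs_sub (gS μ s - gS μ t) (s - t)
    simp only [Real.dist_eq, NNReal.coe_ofNat]
    have := abs_nonneg (s - t)
    linarith
  have h1 : gS μ (1 / 2) < 1 := by
    have := abs_le.1 (h.g_near (t := 1 / 2) (by rw [abs_of_pos] <;> norm_num))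
    rw [abs_of_pos (by norm_num)] at this
    linarith [this.2]
  have h2 : 1 < gS μ (3 / 2) := by
    have := abs_le.1 (h.g_near (t := 3 / 2) (by rw [abs_of_pos] <;> norm_num))
    rw [abs_of_pos (by norm_num)] at this
    linarith [this.1]
  obtain ⟨t, ht, hgt⟩ := intermediate_value_Ioo (by norm_num) hcont ⟨h1, h2⟩
  refine ⟨t, ⟨ht, hgt⟩, ?_⟩
  rintro s ⟨hs, hgs⟩
  have := h.g_lip (hab t ⟨ht.1.le, ht.2.le⟩) (hab s ⟨hs.1.le, hs.2.le⟩)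
  rw [hgt, hgs, sub_self, zero_sub, abs_neg] at this
  have h3 : |s - t| = 0 := by linarith [abs_nonneg (s - t)]
  linarith [abs_eq_zero.1 h3]

lemma GoodSeq.hasDerivAt {μ : ℕ → ℝ} (h : GoodSeq μ) {t : ℝ} (ht : t ∈ Set.Ioo (-2 : ℝ) 2) :
    HasDerivAt (PhiS μ) (∑' v : ℕ, μ v * (v * t ^ (v - 1))) t := by
  refine hasDerivAt_tsum_of_isPreconnected (u := fun v : ℕ => 8 * (1 / 4) ^ v) (summable_quarter 8)
    isOpen_Ioo isPreconnected_Ioo (fun v y _ => (hasDerivAt_pow v y).const_mul (μ v)) ?_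
    (y₀ := 0) (by norm_num) ?_ ht
  · intro v y hy
    have hy2 : |y| ≤ 2 := abs_le.2 ⟨hy.1.le, hy.2.le⟩
    refine le_trans ?_ (h.weight v 1 (by norm_num))
    rw [Real.norm_eq_abs, abs_mul, abs_mul, Nat.abs_cast, abs_pow, pow_one, ← mul_assoc]
    gcongr
    calc _ ≤ (2 : ℝ) ^ (v - 1) := by gcongr
      _ ≤ 2 ^ v := pow_le_pow_right₀ (by norm_num) (by omega)
  · exact Summable.of_norm_bounded (summable_quarter 8) (h.phi_bound (by simp))

lemma GoodSeq.mul_deriv {μ : ℕ → ℝ} (h : GoodSeq μ) {t : ℝ} (ht : t ∈ Set.Ioo (-2 : ℝ) 2) :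
    t * deriv (PhiS μ) t = gS μ t := by
  rw [(h.hasDerivAt ht).deriv, gS, ← tsum_mul_left]
  congr 1; funext v
  rcases v with _ | v
  · simp
  · rw [Nat.add_sub_cancel, pow_succ]; ring

lemma tendsto_gS_sub {ι : Type*} {l : Filter ι} {μ : ι → ℕ → ℝ} {ν : ℕ → ℝ} (hμ : ∀ m, GoodSeq (μ m))
    (hν : GoodSeq ν) (hlim : ∀ v, Tendsto (fun m => μ m v) l (nhds (ν v))) {t : ι → ℝ} (ht : ∀ m, |t m| ≤ 2) :
    Tendsto (fun m => gS (μ m) (t m) - gS ν (t m)) l (nhds 0) ∧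
    Tendsto (fun m => PhiS (μ m) (t m) - PhiS ν (t m)) l (nhds 0) := by
  have aux : ∀ v : ℕ, Tendsto (fun m => |μ m v - ν v|) l (nhds 0) := fun v => by
    simpa using ((hlim v).sub_const (ν v)).abs
  have hz : (0 : ℝ) = ∑' _ : ℕ, (0 : ℝ) := by simp
  have hps : ∀ {μ : ℕ → ℝ} (_ : GoodSeq μ) {t : ℝ} (_ : |t| ≤ 2), Summable fun v : ℕ => μ v * t ^ v := fun h _ ht =>
    Summable.of_norm_bounded (summable_quarter 8) (h.phi_bound ht)
  have sq : ∀ (w : ι → ℕ → ℝ), (∀ m v, |w m v| ≤ |μ m v - ν v| * (v * 2 ^ v) + |μ m v - ν v| * 2 ^ v) →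
      (∀ m v, |w m v| ≤ 16 * (1 / 4) ^ v) → Tendsto (fun m => ∑' v, w m v) l (nhds 0) := by
    intro w h1 h2
    rw [hz]
    refine tendsto_tsum_of_dominated_convergence (summable_quarter 16) (fun v => ?_)
      (Eventually.of_forall fun m v => h2 m v)
    have := ((aux v).mul_const ((v : ℝ) * 2 ^ v)).add ((aux v).mul_const ((2 : ℝ) ^ v))
    simp only [zero_mul, add_zero] at this
    exact squeeze_zero_norm (fun m => h1 m v) this
  constructor
  · have : ∀ m, gS (μ m) (t m) - gS ν (t m) = ∑' v : ℕ, ((v : ℝ) * μ m v * t m ^ v - v * ν v * t m ^ v) := fun m =>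
      (((hμ m).g_summable (ht m)).tsum_sub (hν.g_summable (ht m))).symm
    simp only [this]
    refine sq _ (fun m v => ?_) fun m v => ?_
    · rw [show (v : ℝ) * μ m v * t m ^ v - v * ν v * t m ^ v = (μ m v - ν v) * (v * t m ^ v) by ring,
        abs_mul, abs_mul, Nat.abs_cast, abs_pow]
      have h1 : |μ m v - ν v| * (v * |t m| ^ v) ≤ |μ m v - ν v| * (v * 2 ^ v) := by gcongr; exact ht m
      have h2 : 0 ≤ |μ m v - ν v| * 2 ^ v := by positivity
      linarith
    · have h1 := (hμ m).g_bound (ht m) v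
      have h2 := hν.g_bound (ht m) v
      have := abs_sub ((v : ℝ) * μ m v * t m ^ v) (v * ν v * t m ^ v)
      linarith
  · have : ∀ m, PhiS (μ m) (t m) - PhiS ν (t m) = ∑' v : ℕ, (μ m v * t m ^ v - ν v * t m ^ v) := fun m =>
      ((hps (hμ m) (ht m)).tsum_sub (hps hν (ht m))).symm
    simp only [this]
    refine sq _ (fun m v => ?_) fun m v => ?_
    · rw [← sub_mul, abs_mul, abs_pow]
      have h1 : |μ m v - ν v| * (|t m| ^ v) ≤ |μ m v - ν v| * (2 ^ v) := by gcongr; exact ht m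
      have h2 : 0 ≤ |μ m v - ν v| * (v * 2 ^ v) := by positivity
      linarith
    · have h1 := (hμ m).phi_bound (ht m) v
      have h2 := hν.phi_bound (ht m) v
      have := abs_sub (μ m v * t m ^ v) (ν v * t m ^ v)
      linarith

lemma tendsto_log_factorial_div : Tendsto (fun n : ℕ => Real.log n.factorial / n - Real.log n) atTop (nhds (-1)) := by
  have h1 : Tendsto (fun n : ℕ => Real.log (Stirling.stirlingSeq n)) atTop (nhds (Real.log (Real.sqrt Real.pi))) :=
    (Real.continuousAt_log (by positivity)).tendsto.comp Stirling.tendsto_stirlingSeq_sqrt_pi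
  have h2 : Tendsto (fun n : ℕ => Real.log (Stirling.stirlingSeq n) / n) atTop (nhds 0) :=
    h1.div_atTop tendsto_natCast_atTop_atTop
  have h3 : Tendsto (fun n : ℕ => Real.log n / n) atTop (nhds 0) := by
    have := (Real.tendsto_pow_log_div_mul_add_atTop 1 0 1 one_ne_zero).comp tendsto_natCast_atTop_atTop
    simpa [Function.comp_def] using this
  have h4 : Tendsto (fun n : ℕ => (1 / 2 * Real.log 2) / (n : ℝ)) atTop (nhds 0) :=
    tendsto_const_nhds.div_atTop tendsto_natCast_atTop_atTop
  have h5 := ((h2.add (h3.const_mul (1 / 2))).add h4).sub_const 1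
  simp only [mul_zero, add_zero, zero_sub] at h5
  refine h5.congr' ?_
  filter_upwards [eventually_gt_atTop 0] with n hn
  have hn0 : (0 : ℝ) < n := by exact_mod_cast hn
  rw [Stirling.log_stirlingSeq_formula, Real.log_mul (by norm_num) hn0.ne',
    Real.log_div hn0.ne' (Real.exp_ne_zero _), Real.log_exp]
  field_simp
  ring

lemma GoodSeq.isSaddle {μ : ℕ → ℝ} (h : GoodSeq μ) {n : ℕ} (hn : 1 ≤ n) (hfin : ∀ v, n < v → μ v = 0)
    {t : ℝ} (ht : t ∈ Set.Ioo (1 / 2 : ℝ) (3 / 2)) (hg : gS μ t = 1) :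
    IsSaddle (fun i => μ (i + 1) * t ^ (i + 1)) n := by
  have ht2 : |t| ≤ 2 := by rw [abs_le]; constructor <;> linarith [ht.1, ht.2]
  refine ⟨hn, by simpa [h.one] using ht.1.le, by simpa [h.one] using ht.2.le, ?_, ?_⟩
  · have hsum : gS μ t = ∑ i ∈ Finset.range n, ((i : ℝ) + 1) * (μ (i + 1) * t ^ (i + 1)) := by
      rw [gS, tsum_eq_sum (s := Finset.range (n + 1)), Finset.sum_range_succ']
      · simp [mul_assoc]
      · intro v hv
        rw [hfin v (by simpa using hv)]; simp
    exact hsum.symm.trans hg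
  · calc _ ≤ ∑ i ∈ Finset.Ico 1 n, (1 / 4 : ℝ) ^ (i + 1) := by
          refine Finset.sum_le_sum fun i hi => ?_
          refine le_trans ?_ (h.small (i + 1) (by have := (Finset.mem_Ico.1 hi).1; omega))
          rw [abs_mul, abs_pow]
          calc |μ (i + 1)| * |t| ^ (i + 1) * (i + 1 : ℝ) ^ 3
              ≤ |μ (i + 1)| * 2 ^ (i + 1) * (i + 1 : ℝ) ^ 3 := by gcongr
            _ = _ := by push_cast; ring
      _ ≤ ∑' i : ℕ, (1 / 4 : ℝ) ^ (i + 2) := by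
          rw [Finset.sum_Ico_eq_sum_range]
          refine le_trans (le_of_eq (Finset.sum_congr rfl fun i _ => ?_))
            (Summable.sum_le_tsum (Finset.range (n - 1)) (fun i _ => by positivity)
              ((summable_nat_add_iff 2).2 (summable_geometric_of_lt_one (by norm_num) (by norm_num))))
          congr 1; ring
      _ ≤ 1 / 8 := by
          simp only [pow_add]
          rw [tsum_mul_right, tsum_geometric_of_lt_one (by norm_num) (by norm_num)]
          norm_num

lemma coeff_eq_saddleInt (c a : ℕ → ℝ) (n : ℕ) (hn : 1 ≤ n) (h0 : a 0 = 1)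
    (hrec : ∀ k < n, a (k + 1) = ∑ i ∈ Finset.range (k + 1), (k.choose i : ℝ) * c (i + 1) * a (k - i))
    {μ : ℕ → ℝ} (h : GoodSeq μ) (hfin : ∀ v, n < v → μ v = 0)
    (hc : ∀ i < n, c (i + 1) / (i + 1).factorial * (n : ℝ) ^ i = μ (i + 1))
    {t : ℝ} (ht : 0 < t) :
    a n = n.factorial / (2 * Real.pi) / (n * t) ^ n * Real.exp (n * PhiS μ t) *
      saddleInt (fun i => μ (i + 1) * t ^ (i + 1)) n := by
  have hn0 : (0 : ℝ) < n := by exact_mod_cast hn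
  rw [coeff_eq_real_integral c a n h0 hrec (n * t) (by positivity), mul_assoc _ (Real.exp _)]
  congr 1
  rw [saddleInt, ← intervalIntegral.integral_const_mul]
  refine intervalIntegral.integral_congr fun θ _ => ?_
  have hk : ∀ i ∈ Finset.range n, c (i + 1) / (i + 1).factorial * (n * t) ^ (i + 1) = n * (μ (i + 1) * t ^ (i + 1)) := by
    intro i hi
    rw [← hc i (Finset.mem_range.1 hi)]; ring
  have hphi : PhiS μ t = ∑ i ∈ Finset.range n, μ (i + 1) * t ^ (i + 1) := by
    rw [PhiS, tsum_eq_sum (s := Finset.range (n + 1)), Finset.sum_range_succ']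
    · simp [h.zero]
    · intro v hv; rw [hfin v (by simpa using hv)]; simp
  rw [← mul_assoc, ← Real.exp_add]
  congr 1
  · congr 1
    rw [hphi, alphaS, ← mul_add, ← Finset.sum_add_distrib, Finset.mul_sum]
    refine Finset.sum_congr rfl fun i hi => ?_
    rw [hk i hi]; ring
  · congr 1
    rw [phaseS, mul_sub, Finset.mul_sum]
    congr 1
    refine Finset.sum_congr rfl fun i hi => ?_
    rw [hk i hi]; ring

theorem tendsto_log_coeff (N : ℕ → ℕ) (hN : Tendsto N atTop atTop) (c a : ℕ → ℕ → ℝ)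
    (h0 : ∀ m, a m 0 = 1)
    (hrec : ∀ m, ∀ k < N m, a m (k + 1) =
      ∑ i ∈ Finset.range (k + 1), (k.choose i : ℝ) * c m (i + 1) * a m (k - i))
    (μ : ℕ → ℕ → ℝ) (ν : ℕ → ℝ) (hμ : ∀ m, GoodSeq (μ m)) (hν : GoodSeq ν)
    (hfin : ∀ m v, N m < v → μ m v = 0 ∨ N m = 0)
    (hc : ∀ m, ∀ i < N m, c m (i + 1) / (i + 1).factorial * (N m : ℝ) ^ i = μ m (i + 1))
    (hlim : ∀ v, Tendsto (fun m => μ m v) atTop (nhds (ν v)))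
    {t : ℝ} (ht : t ∈ Set.Ioo (1 / 2 : ℝ) (3 / 2)) (hg : gS ν t = 1) :
    Tendsto (fun m => Real.log (a m (N m)) / N m) atTop (nhds (PhiS ν t - 1 - Real.log t)) := by
  choose τ hτ using fun m => (hμ m).exists_unique_saddle.exists
  have hab : ∀ {t : ℝ}, t ∈ Set.Ioo (1 / 2 : ℝ) (3 / 2) → |t| ≤ 2 := fun {t} ht => by
    rw [abs_le]; constructor <;> linarith [ht.1, ht.2]
  obtain ⟨lg, lp⟩ := tendsto_gS_sub hμ hν hlim (fun m => hab (hτ m).1)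
  have hτt : Tendsto τ atTop (nhds t) := by
    rw [tendsto_iff_dist_tendsto_zero]
    have h2 := (lg.abs).const_mul 2
    rw [abs_zero, mul_zero] at h2
    refine squeeze_zero (fun _ => dist_nonneg) (fun m => ?_) h2
    have h1 := hν.g_lip (hab ht) (hab (hτ m).1)
    rw [hg] at h1
    rw [(hτ m).2, Real.dist_eq]
    have h3 := abs_sub_abs_le_abs_sub (τ m - t) (gS ν (τ m) - 1)
    rw [abs_sub_comm (τ m - t)] at h3
    rw [abs_sub_comm 1]
    linarith [abs_nonneg (τ m - t), abs_nonneg (gS ν (τ m) - 1)]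
  have hPhi : Tendsto (fun m => PhiS (μ m) (τ m)) atTop (nhds (PhiS ν t)) := by
    have h1 : Tendsto (fun m => PhiS ν (τ m)) atTop (nhds (PhiS ν t)) :=
      ((hν.hasDerivAt ⟨by linarith [ht.1], by linarith [ht.2]⟩).continuousAt.tendsto).comp hτt
    simpa using lp.add h1
  have hlogt : Tendsto (fun m => Real.log (τ m)) atTop (nhds (Real.log t)) :=
    ((Real.continuousAt_log (by linarith [ht.1])).tendsto).comp hτt
  set J : ℕ → ℝ := fun m => saddleInt (fun i => μ m (i + 1) * τ m ^ (i + 1)) (N m) with hJ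
  have hNr : Tendsto (fun m => (N m : ℝ)) atTop atTop := tendsto_natCast_atTop_atTop.comp hN
  have hJb : ∀ᶠ m in atTop, 1 / (8 * N m : ℝ) ≤ J m ∧ J m ≤ 2 * Real.pi := by
    filter_upwards [hN.eventually eventually_saddleInt_ge, hN.eventually (eventually_ge_atTop 1)] with m h1 h2
    have hs := (hμ m).isSaddle h2 (fun v hv => (hfin m v hv).resolve_right (by omega)) (hτ m).1 (hτ m).2
    exact ⟨h1 _ hs, hs.int_le⟩
  have hlogN : Tendsto (fun m => Real.log (N m) / (N m : ℝ)) atTop (nhds 0) := by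
    have := (Real.tendsto_pow_log_div_mul_add_atTop 1 0 1 one_ne_zero).comp hNr
    simpa [Function.comp_def] using this
  have hcst : ∀ C : ℝ, Tendsto (fun m => C / (N m : ℝ)) atTop (nhds 0) := fun C =>
    tendsto_const_nhds.div_atTop hNr
  have hJlim : Tendsto (fun m => Real.log (J m) / (N m : ℝ)) atTop (nhds 0) := by
    have hlow : Tendsto (fun m => -(Real.log 8 / (N m : ℝ)) - Real.log (N m) / (N m : ℝ)) atTop (nhds 0) := by
      simpa using (hcst (Real.log 8)).neg.sub hlogN
    refine tendsto_of_tendsto_of_tendsto_of_le_of_le' hlow (hcst (Real.log (2 * Real.pi))) ?_ ?_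
    · filter_upwards [hJb, hN.eventually (eventually_ge_atTop 1)] with m h1 h2
      have hn0 : (0 : ℝ) < N m := by exact_mod_cast h2
      have : Real.log (1 / (8 * N m)) ≤ Real.log (J m) := Real.log_le_log (by positivity) h1.1
      rw [one_div, Real.log_inv, Real.log_mul (by norm_num) hn0.ne'] at this
      rw [← neg_div, ← sub_div]
      gcongr; linarith
    · filter_upwards [hJb, hN.eventually (eventually_ge_atTop 1)] with m h1 h2
      have hn0 : (0 : ℝ) < N m := by exact_mod_cast h2
      have hJpos : 0 < J m := lt_of_lt_of_le (by positivity) h1.1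
      gcongr; exact h1.2
  have hfac := tendsto_log_factorial_div.comp hN
  have htot := (((hfac.sub (hcst (Real.log (2 * Real.pi)))).sub hlogt).add hPhi).add hJlim
  refine (htot.congr' ?_).trans (le_of_eq (by congr 1; ring))
  filter_upwards [hJb, hN.eventually (eventually_ge_atTop 1)] with m h1 h2
  have hn0 : (0 : ℝ) < N m := by exact_mod_cast h2
  have hJpos : 0 < J m := lt_of_lt_of_le (by positivity) h1.1
  have hτ0 : 0 < τ m := by linarith [(hτ m).1.1]
  have hfp : (0 : ℝ) < (N m).factorial := by exact_mod_cast Nat.factorial_pos _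
  rw [coeff_eq_saddleInt (c m) (a m) (N m) h2 (h0 m) (hrec m) (hμ m)
    (fun v hv => (hfin m v hv).resolve_right (by omega)) (hc m) hτ0]
  change _ = Real.log (_ * J m) / _
  have hpi := Real.pi_pos
  rw [Real.log_mul (by positivity) hJpos.ne', Real.log_mul (by positivity) (Real.exp_ne_zero _),
    Real.log_div (by positivity) (by positivity), Real.log_div (by positivity) (by positivity),
    Real.log_exp, Real.log_pow, Real.log_mul hn0.ne' hτ0.ne']
  simp only [Function.comp]
  field_simp
  ring

/-- The `q`-uniform hypergraphs on `S ∪ U` in which every vertex of `U` is reachable from `S`. -/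
def RE {N : ℕ} (q : ℕ) (S U : Finset (Fin N)) : Finset (Finset (Finset (Fin N))) :=
  Finset.univ.filter fun E => (∀ e ∈ E, e.card = q ∧ e ⊆ S ∪ U) ∧
    ∀ v ∈ U, ∃ s ∈ S, Relation.ReflTransGen (edgeRel E) s v

/-- The `q`-subsets of `S ∪ U` containing `x`. -/
def starEdges {N : ℕ} (q : ℕ) (A : Finset (Fin N)) (x : Fin N) : Finset (Finset (Fin N)) :=
  (A.powersetCard q).filter fun e => x ∈ e

/-- The vertices of `U` covered by the hyperedges in `D`. -/
def cov {N : ℕ} (D : Finset (Finset (Fin N))) (U : Finset (Fin N)) : Finset (Fin N) :=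
  U.filter fun v => ∃ e ∈ D, v ∈ e

lemma mem_RE {N q : ℕ} {S U : Finset (Fin N)} {E : Finset (Finset (Fin N))} :
    E ∈ RE q S U ↔ (∀ e ∈ E, e.card = q ∧ e ⊆ S ∪ U) ∧
      ∀ v ∈ U, ∃ s ∈ S, Relation.ReflTransGen (edgeRel E) s v := by simp [RE]

lemma mem_starEdges {N q : ℕ} {A : Finset (Fin N)} {x : Fin N} {e : Finset (Fin N)} :
    e ∈ starEdges q A x ↔ (e.card = q ∧ e ⊆ A) ∧ x ∈ e := by
  simp [starEdges, and_comm]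

lemma mem_cov {N : ℕ} {D : Finset (Finset (Fin N))} {U : Finset (Fin N)} {v : Fin N} :
    v ∈ cov D U ↔ v ∈ U ∧ ∃ e ∈ D, v ∈ e := by simp [cov]

lemma edgeRel_mono {N : ℕ} {D E : Finset (Finset (Fin N))} (h : D ⊆ E) {a b : Fin N}
    (hab : Relation.ReflTransGen (edgeRel D) a b) : Relation.ReflTransGen (edgeRel E) a b :=
  Relation.ReflTransGen.mono (fun _ _ ⟨e, he, h1⟩ => ⟨e, h he, h1⟩) _ _ hab

lemma cov_subset {N : ℕ} (D : Finset (Finset (Fin N))) (U : Finset (Fin N)) : cov D U ⊆ U :=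
  Finset.filter_subset _ _

lemma peel_union {N : ℕ} {S U W : Finset (Fin N)} {x : Fin N} (hx : x ∈ S)
    (hSU : Disjoint S U) (hW : W ⊆ U) : (S.erase x ∪ W) ∪ (U \ W) = (S ∪ U).erase x := by
  have hxU : x ∉ U := Finset.disjoint_left.1 hSU hx
  ext v
  have := @hW v
  simp only [Finset.mem_union, Finset.mem_erase, Finset.mem_sdiff]
  by_cases hv : v = x
  · subst hv; tauto
  · tauto

/-- Removing the hyperedges at a root `x`. -/
lemma mem_RE_peel {N q : ℕ} {S U : Finset (Fin N)} {x : Fin N} (hx : x ∈ S) (hSU : Disjoint S U)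
    (E : Finset (Finset (Fin N))) :
    E ∈ RE q S U ↔ E.filter (x ∈ ·) ⊆ starEdges q (S ∪ U) x ∧
      E.filter (x ∉ ·) ∈ RE q (S.erase x ∪ cov (E.filter (x ∈ ·)) U)
        (U \ cov (E.filter (x ∈ ·)) U) := by
  set D := E.filter (x ∈ ·) with hD
  set E' := E.filter (x ∉ ·) with hE'
  have hsub : ∀ e : Finset (Fin N), e ⊆ (S ∪ U).erase x ↔ e ⊆ S ∪ U ∧ x ∉ e := fun e =>
    Finset.subset_erase
  rw [mem_RE, mem_RE, peel_union hx hSU (cov_subset _ _)]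
  constructor
  · rintro ⟨h1, h2⟩
    refine ⟨fun e he => ?_, fun e he => ?_, fun v hv => ?_⟩
    · rw [hD, Finset.mem_filter] at he
      exact mem_starEdges.2 ⟨h1 e he.1, he.2⟩
    · rw [hE', Finset.mem_filter] at he
      exact ⟨(h1 e he.1).1, (hsub e).2 ⟨(h1 e he.1).2, he.2⟩⟩
    · rw [Finset.mem_sdiff] at hv
      obtain ⟨s, hs, hsv⟩ := h2 v hv.1
      have key : ∀ w, Relation.ReflTransGen (edgeRel E) s w → w = x ∨
          ∃ s' ∈ S.erase x ∪ cov D U, Relation.ReflTransGen (edgeRel E') s' w := by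
        intro w hw
        induction hw with
        | refl =>
          by_cases hsx : s = x
          · exact Or.inl hsx
          · exact Or.inr ⟨s, Finset.mem_union_left _ (Finset.mem_erase.2 ⟨hsx, hs⟩), .refl⟩
        | @tail w w' _ hww ih =>
          obtain ⟨e, he, hwe, hwe'⟩ := hww
          by_cases hwx : w' = x
          · exact Or.inl hwx
          right
          by_cases hxe : x ∈ e
          · have heD : e ∈ D := Finset.mem_filter.2 ⟨he, hxe⟩
            refine ⟨w', ?_, .refl⟩
            rcases Finset.mem_union.1 ((h1 e he).2 hwe') with h | h
            · exact Finset.mem_union_left _ (Finset.mem_erase.2 ⟨hwx, h⟩)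
            · exact Finset.mem_union_right _ (mem_cov.2 ⟨h, e, heD, hwe'⟩)
          · have heE : e ∈ E' := Finset.mem_filter.2 ⟨he, hxe⟩
            rcases ih with rfl | ⟨s', hs', hr⟩
            · exact absurd hwe hxe
            · exact ⟨s', hs', hr.tail ⟨e, heE, hwe, hwe'⟩⟩
      rcases key v hsv with rfl | h
      · exact absurd hv.1 (Finset.disjoint_left.1 hSU hx)
      · exact h
  · rintro ⟨h1, h2, h3⟩
    have hDE : D ⊆ E := Finset.filter_subset _ _
    have hEE : E' ⊆ E := Finset.filter_subset _ _
    have hcovr : ∀ v ∈ cov D U, Relation.ReflTransGen (edgeRel E) x v := by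
      intro v hv
      obtain ⟨_, e, he, hve⟩ := mem_cov.1 hv
      exact .single ⟨e, hDE he, (mem_starEdges.1 (h1 he)).2, hve⟩
    refine ⟨fun e he => ?_, fun v hv => ?_⟩
    · by_cases hxe : x ∈ e
      · exact (mem_starEdges.1 (h1 (Finset.mem_filter.2 ⟨he, hxe⟩))).1
      · have := h2 e (Finset.mem_filter.2 ⟨he, hxe⟩)
        exact ⟨this.1, ((hsub e).1 this.2).1⟩
    · by_cases hvc : v ∈ cov D U
      · exact ⟨x, hx, hcovr v hvc⟩
      · obtain ⟨s, hs, hsv⟩ := h3 v (Finset.mem_sdiff.2 ⟨hv, hvc⟩)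
        rcases Finset.mem_union.1 hs with h | h
        · exact ⟨s, Finset.mem_of_mem_erase h, edgeRel_mono hEE hsv⟩
        · exact ⟨x, hx, (hcovr s h).trans (edgeRel_mono hEE hsv)⟩

lemma not_mem_of_mem_RE_peel {N q : ℕ} {S U W : Finset (Fin N)} {x : Fin N} (hx : x ∈ S)
    (hSU : Disjoint S U) (hW : W ⊆ U) {E : Finset (Finset (Fin N))}
    (hE : E ∈ RE q (S.erase x ∪ W) (U \ W)) {e : Finset (Fin N)} (he : e ∈ E) : x ∉ e := by
  have := ((mem_RE.1 hE).1 e he).2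
  rw [peel_union hx hSU hW] at this
  exact fun h => Finset.notMem_erase _ _ (this h)

lemma filter_mem_union {N : ℕ} {x : Fin N} {D E' : Finset (Finset (Fin N))}
    (h1 : ∀ e ∈ D, x ∈ e) (h2 : ∀ e ∈ E', x ∉ e) :
    (D ∪ E').filter (x ∈ ·) = D ∧ (D ∪ E').filter (x ∉ ·) = E' := by
  constructor
  · rw [Finset.filter_union, Finset.filter_true_of_mem h1, Finset.filter_false_of_mem h2,
      Finset.union_empty]
  · rw [Finset.filter_union, Finset.filter_true_of_mem h2,
      Finset.filter_false_of_mem (fun e he => not_not.2 (h1 e he)), Finset.empty_union]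

/-- Summation over rooted reachable hypergraphs by peeling one root. -/
lemma sum_RE_peel {N q : ℕ} {S U : Finset (Fin N)} {x : Fin N} (hx : x ∈ S) (hSU : Disjoint S U)
    {M : Type*} [AddCommMonoid M] (f : Finset (Finset (Fin N)) → M) :
    ∑ E ∈ RE q S U, f E = ∑ D ∈ (starEdges q (S ∪ U) x).powerset,
      ∑ E' ∈ RE q (S.erase x ∪ cov D U) (U \ cov D U), f (D ∪ E') := by
  rw [Finset.sum_sigma']
  refine Finset.sum_bij' (fun E _ => ⟨E.filter (x ∈ ·), E.filter (x ∉ ·)⟩) (fun p _ => p.1 ∪ p.2)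
    ?_ ?_ ?_ ?_ ?_
  · intro E hE
    have := (mem_RE_peel hx hSU E).1 hE
    simp only [Finset.mem_sigma, Finset.mem_powerset]
    exact this
  · rintro ⟨D, E'⟩ h
    simp only [Finset.mem_sigma, Finset.mem_powerset] at h
    have h' := filter_mem_union (fun e he => (mem_starEdges.1 (h.1 he)).2)
      (fun e he => not_mem_of_mem_RE_peel hx hSU (cov_subset D U) h.2 he)
    refine (mem_RE_peel hx hSU _).2 ?_
    simp only
    rw [h'.1, h'.2]
    exact h
  · intro E _
    simp only
    exact Finset.filter_union_filter_not_eq _ _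
  · rintro ⟨D, E'⟩ h
    simp only [Finset.mem_sigma, Finset.mem_powerset] at h
    have h' := filter_mem_union (fun e he => (mem_starEdges.1 (h.1 he)).2)
      (fun e he => not_mem_of_mem_RE_peel hx hSU (cov_subset D U) h.2 he)
    simp only [h'.1, h'.2]
  · intro E _
    simp only
    rw [Finset.filter_union_filter_not_eq]

lemma RE_empty_left {N q : ℕ} (hq : 1 ≤ q) (U : Finset (Fin N)) :
    RE q ∅ U = if U = ∅ then {∅} else ∅ := by
  split_ifs with h
  · subst h
    ext E
    rw [mem_RE, Finset.mem_singleton, Finset.eq_empty_iff_forall_notMem]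
    simp only [Finset.union_self, Finset.subset_empty]
    constructor
    · rintro ⟨h1, _⟩ e he
      have := h1 e he
      rw [this.2] at this
      simp at this
      omega
    · intro h; exact ⟨fun e he => absurd he (h e), by simp⟩
  · rw [Finset.eq_empty_iff_forall_notMem]
    intro E hE
    obtain ⟨v, hv⟩ := Finset.nonempty_iff_ne_empty.2 h
    obtain ⟨s, hs, _⟩ := (mem_RE.1 hE).2 v hv
    simp at hs

lemma disjoint_peel {N : ℕ} {S U W : Finset (Fin N)} {x : Fin N} (hSU : Disjoint S U) :
    Disjoint (S.erase x ∪ W) (U \ W) := by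
  rw [Finset.disjoint_left] at hSU ⊢
  intro v hv
  rw [Finset.mem_union, Finset.mem_erase] at hv
  rw [Finset.mem_sdiff]
  rintro ⟨h1, h2⟩
  rcases hv with h | h
  · exact hSU h.2 h1
  · exact h2 h

lemma card_cov_le {N q : ℕ} {A U : Finset (Fin N)} {x : Fin N} (hx : x ∉ U)
    {D : Finset (Finset (Fin N))} (hD : D ⊆ starEdges q A x) :
    (cov D U).card ≤ (q - 1) * D.card := by
  have : cov D U ⊆ D.biUnion (fun e => e.erase x) := by
    intro v hv
    obtain ⟨h1, e, he, hve⟩ := mem_cov.1 hv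
    exact Finset.mem_biUnion.2 ⟨e, he, Finset.mem_erase.2 ⟨fun h => hx (h ▸ h1), hve⟩⟩
  refine (Finset.card_le_card this).trans ?_
  rw [mul_comm]
  refine Finset.card_biUnion_le_card_mul _ _ _ fun e he => ?_
  have := mem_starEdges.1 (hD he)
  rw [Finset.card_erase_of_mem this.2, this.1.1]

lemma card_le_of_mem_RE {N q : ℕ} (hq : 1 ≤ q) : ∀ (k : ℕ) (S U : Finset (Fin N)), (S ∪ U).card = k →
    Disjoint S U → ∀ E ∈ RE q S U, U.card ≤ (q - 1) * E.card := by
  intro k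
  induction k with
  | zero =>
    intro S U h _ E _
    have : U.card ≤ 0 := h ▸ Finset.card_le_card Finset.subset_union_right
    omega
  | succ k ih =>
    intro S U h hSU E hE
    rcases S.eq_empty_or_nonempty with rfl | ⟨x, hx⟩
    · rw [RE_empty_left hq] at hE
      split_ifs at hE with hU
      · simp [hU]
      · simp at hE
    · obtain ⟨h1, h2⟩ := (mem_RE_peel hx hSU E).1 hE
      set D := E.filter (x ∈ ·)
      have hx' : x ∉ U := Finset.disjoint_left.1 hSU hx
      have h3 := ih _ _ (by rw [peel_union hx hSU (cov_subset D U),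
        Finset.card_erase_of_mem (Finset.mem_union_left _ hx), h]; rfl) (disjoint_peel hSU) _ h2
      have h4 := card_cov_le hx' h1
      have h5 := Finset.card_filter_add_card_filter_not (s := E) (x ∈ ·)
      rw [Finset.card_sdiff_of_subset (cov_subset D U)] at h3
      rw [← h5, mul_add]
      change _ ≤ (q - 1) * D.card + _
      omega

lemma sum_powersetCard_prod_le {α : Type*} {w : α → ℝ} (hw : ∀ v, 0 ≤ w v) (A : Finset α) :
    ∀ k : ℕ, ∑ t ∈ A.powersetCard k, ∏ v ∈ t, w v ≤ (∑ v ∈ A, w v) ^ k := by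
  induction A using Finset.induction_on with
  | empty =>
    intro k
    rcases k with _ | k
    · simp
    · rw [Finset.powersetCard_eq_empty.2 (by simp)]; simp
  | insert a s ha ih =>
    intro k
    rcases k with _ | k
    · simp
    · have h0 : 0 ≤ ∑ v ∈ s, w v := Finset.sum_nonneg fun v _ => hw v
      rw [Finset.powersetCard_succ_insert ha, Finset.sum_union, Finset.sum_insert ha, Finset.sum_image]
      · have h1 : ∑ t ∈ s.powersetCard k, ∏ v ∈ insert a t, w v
            = w a * ∑ t ∈ s.powersetCard k, ∏ v ∈ t, w v := by
          rw [Finset.mul_sum]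
          refine Finset.sum_congr rfl fun t ht => ?_
          rw [Finset.prod_insert fun h => ha ((Finset.mem_powersetCard.1 ht).1 h)]
        rw [h1]
        have h2 := ih (k + 1)
        have h3 := mul_le_mul_of_nonneg_left (ih k) (hw a)
        have h4 : (∑ v ∈ s, w v) ^ k ≤ (w a + ∑ v ∈ s, w v) ^ k := by
          gcongr; linarith [hw a]
        calc _ ≤ (∑ v ∈ s, w v) ^ (k + 1) + w a * (∑ v ∈ s, w v) ^ k := add_le_add h2 h3
          _ = (w a + ∑ v ∈ s, w v) * (∑ v ∈ s, w v) ^ k := by ring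
          _ ≤ (w a + ∑ v ∈ s, w v) * (w a + ∑ v ∈ s, w v) ^ k :=
              mul_le_mul_of_nonneg_left h4 (add_nonneg (hw a) h0)
          _ = _ := by ring
      · intro t ht u hu h
        have h1 : a ∉ t := fun h => ha ((Finset.mem_powersetCard.1 ht).1 h)
        have h2 : a ∉ u := fun h => ha ((Finset.mem_powersetCard.1 hu).1 h)
        rw [← Finset.erase_insert h1, ← Finset.erase_insert h2, h]
      · rw [Finset.disjoint_left]
        intro t ht h
        obtain ⟨u, _, rfl⟩ := Finset.mem_image.1 h
        exact ha ((Finset.mem_powersetCard.1 ht).1 (Finset.mem_insert_self a u))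

lemma sum_starEdges_le {N q : ℕ} {A : Finset (Fin N)} {x : Fin N}
    {w : Fin N → ℝ} (hw : ∀ v, 0 ≤ w v) :
    ∑ e ∈ starEdges q A x, ∏ v ∈ e.erase x, w v ≤ (∑ v ∈ A, w v) ^ (q - 1) := by
  refine le_trans ?_ (sum_powersetCard_prod_le hw A (q - 1))
  have hinj : Set.InjOn (fun e : Finset (Fin N) => e.erase x) (starEdges q A x) := by
    intro e he f hf h
    have h1 := (mem_starEdges.1 he).2
    have h2 := (mem_starEdges.1 hf).2
    simp only at h
    rw [← Finset.insert_erase h1, ← Finset.insert_erase h2, h]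
  rw [← Finset.sum_image (f := fun t => ∏ v ∈ t, w v) hinj]
  refine Finset.sum_le_sum_of_subset_of_nonneg ?_ fun t _ _ => Finset.prod_nonneg fun v _ => hw v
  intro t ht
  obtain ⟨e, he, rfl⟩ := Finset.mem_image.1 ht
  have := mem_starEdges.1 he
  rw [Finset.mem_powersetCard, Finset.card_erase_of_mem this.2, this.1.1]
  exact ⟨(Finset.erase_subset _ _).trans this.1.2, rfl⟩

lemma sum_star_le_aux {N q : ℕ} {S U W : Finset (Fin N)} {x : Fin N} (hx : x ∈ S)
    (hSU : Disjoint S U) (hW : W ⊆ U) {p L : ℝ} (hp : 0 ≤ p) (hL : 1 ≤ L) :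
    ∑ D ∈ (starEdges q (S ∪ U) x).powerset with cov D U = W, p ^ D.card ≤
      (L ^ W.card)⁻¹ * Real.exp (p * ((S ∪ U).card + W.card * L) ^ (q - 1)) := by
  set w : Fin N → ℝ := fun v => if v ∈ W then L else 1 with hwdef
  have hw0 : ∀ v, 0 ≤ w v := fun v => by simp only [hwdef]; split_ifs <;> linarith
  have hxU : x ∉ U := Finset.disjoint_left.1 hSU hx
  have hprod : ∀ e : Finset (Fin N), ∏ v ∈ e.erase x, w v = L ^ ((e.erase x).filter (· ∈ W)).card := by
    intro e
    simp only [hwdef]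
    rw [Finset.prod_ite]; simp
  have hpe : ∀ e : Finset (Fin N), 0 ≤ p * ∏ v ∈ e.erase x, w v := fun e =>
    mul_nonneg hp (Finset.prod_nonneg fun v _ => hw0 v)
  have h1 : ∀ D ∈ (starEdges q (S ∪ U) x).powerset.filter (fun D => cov D U = W),
      p ^ D.card ≤ (L ^ W.card)⁻¹ * ∏ e ∈ D, (p * ∏ v ∈ e.erase x, w v) := by
    intro D hD
    obtain ⟨hD1, hD2⟩ := Finset.mem_filter.1 hD
    rw [Finset.prod_mul_distrib, Finset.prod_const, mul_left_comm]
    refine le_mul_of_one_le_right (pow_nonneg hp _) ?_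
    rw [inv_mul_eq_div, one_le_div (by positivity)]
    simp only [hprod]
    rw [Finset.prod_pow_eq_pow_sum]
    refine pow_le_pow_right₀ hL ?_
    refine le_trans (Finset.card_le_card ?_) (Finset.card_biUnion_le (s := D)
      (t := fun e => (e.erase x).filter (· ∈ W)))
    intro v hv
    have hv' := hv
    rw [← hD2] at hv'
    obtain ⟨hvU, e, he, hve⟩ := mem_cov.1 hv'
    exact Finset.mem_biUnion.2 ⟨e, he, Finset.mem_filter.2
      ⟨Finset.mem_erase.2 ⟨fun h => hxU (h ▸ hvU), hve⟩, hv⟩⟩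
  refine (Finset.sum_le_sum h1).trans ?_
  rw [← Finset.mul_sum]
  refine mul_le_mul_of_nonneg_left ?_ (by positivity)
  calc _ ≤ ∑ D ∈ (starEdges q (S ∪ U) x).powerset, ∏ e ∈ D, (p * ∏ v ∈ e.erase x, w v) :=
        Finset.sum_le_sum_of_subset_of_nonneg (Finset.filter_subset _ _)
          fun D _ _ => Finset.prod_nonneg fun e _ => hpe e
    _ = ∏ e ∈ starEdges q (S ∪ U) x, (1 + p * ∏ v ∈ e.erase x, w v) := (Finset.prod_one_add _).symm
    _ ≤ ∏ e ∈ starEdges q (S ∪ U) x, Real.exp (p * ∏ v ∈ e.erase x, w v) :=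
        Finset.prod_le_prod (fun e _ => by linarith [hpe e]) fun e _ => by
          rw [add_comm]; exact Real.add_one_le_exp _
    _ = Real.exp (p * ∑ e ∈ starEdges q (S ∪ U) x, ∏ v ∈ e.erase x, w v) := by
        rw [Finset.mul_sum, Real.exp_sum]
    _ ≤ _ := by
        refine Real.exp_le_exp.2 (mul_le_mul_of_nonneg_left ((sum_starEdges_le hw0).trans ?_) hp)
        refine pow_le_pow_left₀ (Finset.sum_nonneg fun v _ => hw0 v) ?_ _
        calc ∑ v ∈ S ∪ U, w v ≤ ∑ v ∈ S ∪ U, (1 + if v ∈ W then L else 0) :=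
              Finset.sum_le_sum fun v _ => by simp only [hwdef]; split_ifs <;> linarith
          _ = (S ∪ U).card + W.card * L := by
              rw [Finset.sum_add_distrib, ← Finset.sum_filter, Finset.sum_const, Finset.sum_const,
                Finset.filter_mem_eq_inter, Finset.inter_eq_right.2 (hW.trans Finset.subset_union_right)]
              simp

lemma sum_star_le {N q n : ℕ} {S U W : Finset (Fin N)} {x : Fin N} (hx : x ∈ S)
    (hSU : Disjoint S U) (hW : W ⊆ U) (hn : (S ∪ U).card ≤ n) {p κ : ℝ} (hp : 0 ≤ p) (hκ : 0 < κ) (hκ1 : κ ≤ 1)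
    (hpk : p * (n * (1 + κ⁻¹)) ^ (q - 1) ≤ Real.log 2) :
    ∑ D ∈ (starEdges q (S ∪ U) x).powerset with cov D U = W, p ^ D.card ≤
      2 * (κ * Real.exp 1 / n) ^ W.card * (W.card).factorial := by
  have hn0 : (0 : ℝ) < n := by
    have : 0 < (S ∪ U).card := Finset.card_pos.2 ⟨x, Finset.mem_union_left _ hx⟩
    exact_mod_cast (by omega : 0 < n)
  have hWn : (W.card : ℝ) ≤ n := by
    exact_mod_cast (Finset.card_le_card (hW.trans Finset.subset_union_right)).trans hn
  obtain ⟨L, hL, hL1, hL2⟩ : ∃ L : ℝ, 1 ≤ L ∧ W.card * L ≤ n * κ⁻¹ ∧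
      (L ^ W.card)⁻¹ ≤ (κ * Real.exp 1 / n) ^ W.card * (W.card).factorial := by
    rcases Nat.eq_zero_or_pos W.card with h | h
    · exact ⟨1, le_rfl, by rw [h]; simp; positivity, by rw [h]; simp⟩
    · have hw : (0 : ℝ) < W.card := by exact_mod_cast h
      refine ⟨n / (κ * W.card), ?_, ?_, ?_⟩
      · rw [le_div_iff₀ (by positivity), one_mul]
        nlinarith
      · apply le_of_eq; field_simp
      · have := Real.pow_div_factorial_le_exp (x := (W.card : ℝ)) hw.le W.card
        rw [div_le_iff₀ (by positivity)] at this
        rw [← inv_pow, inv_div, div_pow, div_pow, mul_pow, mul_pow, ← Real.exp_nat_mul, mul_one,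
          div_mul_eq_mul_div, mul_assoc]
        gcongr
  refine (sum_star_le_aux hx hSU hW hp hL).trans ?_
  have h1 : Real.exp (p * ((S ∪ U).card + W.card * L) ^ (q - 1)) ≤ 2 := by
    rw [← Real.le_log_iff_exp_le (by norm_num)]
    refine le_trans (mul_le_mul_of_nonneg_left (pow_le_pow_left₀ (by positivity) ?_ _) hp) hpk
    have : ((S ∪ U).card : ℝ) ≤ n := by exact_mod_cast hn
    linarith
  rw [mul_comm, mul_assoc]
  gcongr

lemma sum_RE_le {N q n : ℕ} (hq : 1 ≤ q) {p κ : ℝ} (hp : 0 ≤ p) (hκ : 0 < κ) (hκ1 : κ ≤ 1)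
    (hpk : p * (n * (1 + κ⁻¹)) ^ (q - 1) ≤ Real.log 2) :
    ∀ (k : ℕ) (S U : Finset (Fin N)), (S ∪ U).card = k → k ≤ n → Disjoint S U →
      ∑ E ∈ RE q S U, p ^ E.card ≤
        (U.card).factorial * (8 * κ * Real.exp 1 / n) ^ U.card * 4 ^ S.card := by
  intro k
  induction k with
  | zero =>
    intro S U h _ hSU
    have h1 : S ∪ U = ∅ := Finset.card_eq_zero.1 h
    obtain ⟨rfl, rfl⟩ := Finset.union_eq_empty.1 h1
    rw [RE_empty_left hq]; simp
  | succ k ih =>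
    intro S U h hkn hSU
    rcases S.eq_empty_or_nonempty with rfl | ⟨x, hx⟩
    · rw [RE_empty_left hq]
      split_ifs with hU
      · simp [hU]
      · simp; positivity
    · have hn0 : (0 : ℝ) < n := by exact_mod_cast (by omega : 0 < n)
      set a := κ * Real.exp 1 / n with ha
      have ha0 : 0 < a := by positivity
      rw [show 8 * κ * Real.exp 1 / n = 8 * a by rw [ha]; ring]
      rw [show 8 * κ * Real.exp 1 / n = 8 * a by rw [ha]; ring] at ih
      rw [sum_RE_peel hx hSU]
      set B : Finset (Fin N) → ℝ := fun W => ((U.card - W.card).factorial : ℝ) * (8 * a) ^ (U.card - W.card) *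
        4 ^ (S.card - 1 + W.card) with hB
      have hst : ∀ D ∈ (starEdges q (S ∪ U) x).powerset,
          ∑ E' ∈ RE q (S.erase x ∪ cov D U) (U \ cov D U), p ^ (D ∪ E').card ≤ p ^ D.card * B (cov D U) := by
        intro D hD
        have h1 := ih _ _ (by rw [peel_union hx hSU (cov_subset D U),
          Finset.card_erase_of_mem (Finset.mem_union_left _ hx), h]; rfl) (by omega) (disjoint_peel (x := x) (W := cov D U) hSU)
        have hd : Disjoint (S.erase x) (cov D U) :=
          Finset.disjoint_of_subset_left (Finset.erase_subset _ _)
            (Finset.disjoint_of_subset_right (cov_subset D U) hSU)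
        rw [Finset.card_sdiff_of_subset (cov_subset D U), Finset.card_union_of_disjoint hd,
          Finset.card_erase_of_mem hx] at h1
        refine le_trans (le_of_eq ?_) (mul_le_mul_of_nonneg_left h1 (pow_nonneg hp _))
        rw [Finset.mul_sum]
        refine Finset.sum_congr rfl fun E' hE' => ?_
        rw [Finset.card_union_of_disjoint, pow_add]
        rw [Finset.disjoint_left]
        intro e he he'
        exact not_mem_of_mem_RE_peel hx hSU (cov_subset D U) hE' he'
          (mem_starEdges.1 (Finset.mem_powerset.1 hD he)).2
      refine (Finset.sum_le_sum hst).trans ?_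
      rw [← Finset.sum_fiberwise_of_maps_to (g := fun D => cov D U) (t := U.powerset)
        (fun D _ => Finset.mem_powerset.2 (cov_subset D U))]
      have h2 : ∀ W ∈ U.powerset, ∑ D ∈ (starEdges q (S ∪ U) x).powerset with cov D U = W,
          p ^ D.card * B (cov D U) ≤ 2 * a ^ W.card * (W.card).factorial * B W := by
        intro W hW
        rw [Finset.sum_congr rfl (g := fun D => p ^ D.card * B W) fun D hD => by
          rw [(Finset.mem_filter.1 hD).2], ← Finset.sum_mul]
        refine mul_le_mul_of_nonneg_right ?_ (by positivity)
        exact sum_star_le hx hSU (Finset.mem_powerset.1 hW) (by omega) hp hκ hκ1 hpk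
      refine (Finset.sum_le_sum h2).trans ?_
      have h3 := Finset.sum_powerset_apply_card (x := U) (fun j => 2 * a ^ j * (j.factorial : ℝ) *
        (((U.card - j).factorial : ℝ) * (8 * a) ^ (U.card - j) * 4 ^ (S.card - 1 + j)))
      rw [h3]
      have hS : 1 ≤ S.card := Finset.card_pos.2 ⟨x, hx⟩
      have h4 : ∀ j ∈ Finset.range (U.card + 1), U.card.choose j • (2 * a ^ j * (j.factorial : ℝ) *
          (((U.card - j).factorial : ℝ) * (8 * a) ^ (U.card - j) * 4 ^ (S.card - 1 + j))) =
          (U.card.factorial * (8 * a) ^ U.card * 4 ^ (S.card - 1) * 2) * (1 / 2) ^ j := by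
        intro j hj
        have hj' : j ≤ U.card := Nat.lt_succ_iff.1 (Finset.mem_range.1 hj)
        have hc := Nat.choose_mul_factorial_mul_factorial hj'
        have hc' : (U.card.choose j : ℝ) * j.factorial * (U.card - j).factorial = U.card.factorial := by
          exact_mod_cast hc
        obtain ⟨r, hr⟩ := Nat.exists_eq_add_of_le hj'
        have hr' : U.card - j = r := by omega
        rw [hr'] at hc' ⊢
        rw [nsmul_eq_mul, ← hc', hr]
        rw [pow_add (8 * a), mul_pow 8 a j, pow_add 4 _ j, show (8 : ℝ) ^ j = 4 ^ j * 2 ^ j by rw [← mul_pow]; norm_num]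
        have : (2 : ℝ) ^ j * (1 / 2) ^ j = 1 := by rw [← mul_pow]; norm_num
        linear_combination (-((j + r).choose j : ℝ) * j.factorial * r.factorial * (4 ^ j * a ^ j * (8 * a) ^ r) * 4 ^ (S.card - 1) * 2) * this
      rw [Finset.sum_congr rfl h4, ← Finset.mul_sum]
      have h5 : ∑ j ∈ Finset.range (U.card + 1), (1 / 2 : ℝ) ^ j ≤ 2 := by
        have := (summable_geometric_of_lt_one (r := (1 / 2 : ℝ)) (by norm_num) (by norm_num)).sum_le_tsum
          (Finset.range (U.card + 1)) fun i _ => by positivity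
        rwa [tsum_geometric_two] at this
      refine (mul_le_mul_of_nonneg_left h5 (by positivity)).trans (le_of_eq ?_)
      obtain ⟨s, hs⟩ := Nat.exists_eq_add_of_le' hS
      rw [hs, Nat.add_sub_cancel, pow_succ]; ring

lemma K_sq (x y : ℝ × ℝ) : K x y * K x y = 1 := by unfold K; split_ifs <;> norm_num

lemma abs_K (x y : ℝ × ℝ) : |K x y| = 1 := by unfold K; split_ifs <;> norm_num

lemma K_zero_left (y : ℝ × ℝ) : K (0, 0) y = 1 := by
  unfold K
  rw [if_neg]
  rintro (⟨h1, h2, -⟩ | ⟨-, h2, h3⟩)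
  · exact lt_asymm h1 h2
  · exact lt_asymm h2 h3

lemma measurable_K {α : Type*} [MeasurableSpace α] {f g : α → ℝ × ℝ} (hf : Measurable f)
    (hg : Measurable g) : Measurable fun a => K (f a) (g a) := by
  unfold K
  refine Measurable.ite ?_ measurable_const measurable_const
  have h1 := hf.fst
  have h2 := hf.snd
  have h3 := hg.fst
  have h4 := hg.snd
  exact ((measurableSet_lt h1 h3).inter ((measurableSet_lt h3 h2).inter (measurableSet_lt h2 h4))).union
    ((measurableSet_lt h3 h1).inter ((measurableSet_lt h1 h4).inter (measurableSet_lt h4 h2)))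

lemma measurable_minmax : Measurable fun p : ℝ × ℝ => (min p.1 p.2, max p.1 p.2) := by fun_prop

instance : IsProbabilityMeasure (volume.restrict (Set.Icc (0 : ℝ) 1 ×ˢ Set.Icc (0 : ℝ) 1)) := by
  constructor
  rw [Measure.restrict_apply_univ, Measure.volume_eq_prod, Measure.prod_prod]
  simp

instance : IsProbabilityMeasure nu := by
  unfold nu
  exact Measure.isProbabilityMeasure_map measurable_minmax.aemeasurable

lemma measurableSet_Omega : MeasurableSet Omega := measurableSet_Icc.prod measurableSet_Icc

lemma ae_mem_Omega : ∀ᵐ x ∂nu, x ∈ Omega := by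
  unfold nu
  rw [ae_map_iff (p := fun x => x ∈ Omega) measurable_minmax.aemeasurable measurableSet_Omega]
  filter_upwards [ae_restrict_mem (measurableSet_Icc.prod measurableSet_Icc)] with p hp
  obtain ⟨⟨h1, h2⟩, h3, h4⟩ := hp
  exact ⟨⟨le_min h1 h3, (min_le_left _ _).trans h2⟩, le_max_of_le_left h1, max_le h2 h4⟩

/-- The law of a family of i.i.d. chords. -/
abbrev nuPi (ι : Type*) [Fintype ι] : Measure (ι → ℝ × ℝ) := Measure.pi fun _ => nu

lemma ae_pi_mem_Omega (ι : Type*) [Fintype ι] : ∀ᵐ y ∂nuPi ι, ∀ i, y i ∈ Omega := by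
  rw [ae_all_iff]
  intro i
  exact (measurePreserving_eval (fun _ : ι => nu) i).quasiMeasurePreserving.ae ae_mem_Omega

/-- Resampling the coordinates outside `D` preserves the product law. -/
lemma measurePreserving_piecewise {ι : Type*} [Fintype ι] (D : Finset ι) :
    MeasurePreserving (fun p : (ι → ℝ × ℝ) × (ι → ℝ × ℝ) => fun i => if i ∈ D then p.1 i else p.2 i)
      ((nuPi ι).prod (nuPi ι)) (nuPi ι) := by
  have hm : Measurable fun p : (ι → ℝ × ℝ) × (ι → ℝ × ℝ) => fun i => if i ∈ D then p.1 i else p.2 i := by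
    refine measurable_pi_lambda _ fun i => ?_
    split_ifs
    · exact (measurable_pi_apply i).comp measurable_fst
    · exact (measurable_pi_apply i).comp measurable_snd
  refine ⟨hm, (Measure.pi_eq fun s hs => ?_).symm⟩
  rw [Measure.map_apply hm (MeasurableSet.univ_pi hs)]
  have : (fun p : (ι → ℝ × ℝ) × (ι → ℝ × ℝ) => fun i => if i ∈ D then p.1 i else p.2 i) ⁻¹' Set.univ.pi s =
      (Set.univ.pi fun i => if i ∈ D then s i else Set.univ) ×ˢ
        (Set.univ.pi fun i => if i ∈ D then Set.univ else s i) := by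
    ext p
    simp only [Set.mem_preimage, Set.mem_pi, Set.mem_univ, true_implies, Set.mem_prod]
    constructor
    · intro h
      constructor <;> intro i <;> have := h i <;> split_ifs at this ⊢ <;> simp_all
    · rintro ⟨h1, h2⟩ i
      have h1 := h1 i
      have h2 := h2 i
      split_ifs at h1 h2 ⊢ <;> simp_all
  rw [this, Measure.prod_prod, Measure.pi_pi, Measure.pi_pi, ← Finset.prod_mul_distrib]
  refine Finset.prod_congr rfl fun i _ => ?_
  split_ifs <;> simp

lemma integral_piecewise {ι : Type*} [Fintype ι] (D : Finset ι) {f : (ι → ℝ × ℝ) → ℝ}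
    (hf : Measurable f) {C : ℝ} (hC : ∀ X, |f X| ≤ C) :
    ∫ X, f X ∂nuPi ι = ∫ X, ∫ X', f (fun i => if i ∈ D then X i else X' i) ∂nuPi ι ∂nuPi ι := by
  have hp := measurePreserving_piecewise D
  rw [← hp.map_eq, integral_map hp.measurable.aemeasurable hf.aestronglyMeasurable]
  rw [integral_prod]
  · rw [hp.map_eq]
  · exact Integrable.of_bound (hf.comp hp.measurable).aestronglyMeasurable C
      (Eventually.of_forall fun p => hC _)

/-- Reindexing along an injection maps i.i.d. chords to i.i.d. chords. -/
lemma measurePreserving_comp_injective {ι κ : Type*} [Fintype ι] [Fintype κ] {e : κ → ι}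
    (he : Function.Injective e) :
    MeasurePreserving (fun X : ι → ℝ × ℝ => fun k => X (e k)) (nuPi ι) (nuPi κ) := by
  have hm : Measurable (fun X : ι → ℝ × ℝ => fun k => X (e k)) :=
    measurable_pi_lambda _ fun k => measurable_pi_apply _
  refine ⟨hm, (Measure.pi_eq fun s hs => ?_).symm⟩
  rw [Measure.map_apply hm (MeasurableSet.univ_pi hs)]
  have : (fun X : ι → ℝ × ℝ => fun k => X (e k)) ⁻¹' Set.univ.pi s =
      Set.univ.pi fun i => ⋂ k, ⋂ (_ : e k = i), s k := by
    ext X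
    simp only [Set.mem_preimage, Set.mem_pi, Set.mem_univ, true_implies, Set.mem_iInter]
    exact ⟨fun h i k hk => hk ▸ h k, fun h k => h _ k rfl⟩
  rw [this, Measure.pi_pi, ← Finset.prod_subset (Finset.subset_univ (Finset.univ.image e)),
    Finset.prod_image he.injOn]
  · refine Finset.prod_congr rfl fun k _ => ?_
    congr 1
    ext x
    simp only [Set.mem_iInter]
    exact ⟨fun h => h k rfl, fun h k' hk => he hk ▸ h⟩
  · intro i _ hi
    have : (⋂ k, ⋂ (_ : e k = i), s k) = Set.univ := by
      rw [Set.eq_univ_iff_forall]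
      intro x
      simp only [Set.mem_iInter]
      intro k hk
      exact absurd (Finset.mem_image.2 ⟨k, Finset.mem_univ _, hk⟩) hi
    rw [this, measure_univ]

lemma measurable_pairSign {N : ℕ} {α : Type*} [MeasurableSpace α] {X : α → Finset (Fin N) → ℝ × ℝ}
    (hX : ∀ e, Measurable fun a => X a e) (p : Sym2 (Finset (Fin N))) :
    Measurable fun a => pairSign (X a) p := by
  induction p using Sym2.ind with
  | _ e f =>
    simp only [pairSign, Sym2.lift_mk]
    split_ifs
    · exact measurable_K (hX e) (hX f)
    · exact measurable_const

lemma abs_pairSign {N : ℕ} (X : Finset (Fin N) → ℝ × ℝ) (p : Sym2 (Finset (Fin N))) :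
    |pairSign X p| = 1 := by
  induction p using Sym2.ind with
  | _ e f =>
    simp only [pairSign, Sym2.lift_mk]
    split_ifs
    · exact abs_K _ _
    · simp

lemma measurable_BE {N : ℕ} {α : Type*} [MeasurableSpace α] {X : α → Finset (Fin N) → ℝ × ℝ}
    (hX : ∀ e, Measurable fun a => X a e) (E : Finset (Finset (Fin N))) :
    Measurable fun a => BE E (X a) := by
  unfold BE
  exact Finset.measurable_prod _ fun p _ => measurable_pairSign hX p

lemma abs_BE {N : ℕ} (E : Finset (Finset (Fin N))) (X : Finset (Fin N) → ℝ × ℝ) : |BE E X| = 1 := by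
  unfold BE
  rw [Finset.abs_prod]
  exact Finset.prod_eq_one fun p _ => abs_pairSign X p

/-- Factorization of `BE` over a disjoint union. -/
lemma BE_union {N : ℕ} {D E : Finset (Finset (Fin N))} (h : Disjoint D E) (X : Finset (Fin N) → ℝ × ℝ) :
    BE (D ∪ E) X = BE D X * (∏ e ∈ D, ∏ f ∈ E, pairSign X s(e, f)) * BE E X := by
  unfold BE
  rw [← Finset.prod_product' (f := fun e f => pairSign X s(e, f))]
  have hinj : Set.InjOn (fun p : Finset (Fin N) × Finset (Fin N) => s(p.1, p.2)) (D ×ˢ E : Finset _) := by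
    rintro ⟨a, b⟩ h1 ⟨c, d⟩ h2 h3
    simp only [Finset.coe_product, Set.mem_prod, Finset.mem_coe] at h1 h2
    simp only [Sym2.eq_iff] at h3
    rcases h3 with ⟨rfl, rfl⟩ | ⟨rfl, rfl⟩
    · rfl
    · exact absurd h2.2 (Finset.disjoint_left.1 h h1.1)
  rw [← Finset.prod_image (f := fun p => pairSign X p) (g := fun p : Finset (Fin N) × Finset (Fin N) => s(p.1, p.2)) hinj,
    ← Finset.prod_union, ← Finset.prod_union]
  · congr 1
    ext p
    induction p using Sym2.ind with
    | _ a b =>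
      simp only [Finset.mem_filter, Finset.mem_sym2_iff, Finset.mem_union, Finset.mem_image,
        Finset.mem_product, Prod.exists, Sym2.mem_iff, forall_eq_or_imp, forall_eq, Sym2.mk_isDiag_iff,
        Sym2.eq_iff]
      have h' : ∀ a, a ∈ D → a ∉ E := fun a ha => Finset.disjoint_left.1 h ha
      constructor
      · rintro ⟨⟨h1 | h1, h2 | h2⟩, h3⟩
        · exact Or.inl (Or.inl ⟨⟨h1, h2⟩, h3⟩)
        · exact Or.inl (Or.inr ⟨a, b, ⟨h1, h2⟩, Or.inl ⟨rfl, rfl⟩⟩)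
        · exact Or.inl (Or.inr ⟨b, a, ⟨h2, h1⟩, Or.inr ⟨rfl, rfl⟩⟩)
        · exact Or.inr ⟨⟨h1, h2⟩, h3⟩
      · rintro ((⟨⟨h1, h2⟩, h3⟩ | ⟨c, d, ⟨h1, h2⟩, (⟨rfl, rfl⟩ | ⟨rfl, rfl⟩)⟩) | ⟨⟨h1, h2⟩, h3⟩)
        · exact ⟨⟨Or.inl h1, Or.inl h2⟩, h3⟩
        · exact ⟨⟨Or.inl h1, Or.inr h2⟩, fun hh => h' _ h1 (hh ▸ h2)⟩
        · exact ⟨⟨Or.inr h2, Or.inl h1⟩, fun hh => h' _ h1 (hh ▸ h2)⟩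
        · exact ⟨⟨Or.inr h1, Or.inr h2⟩, h3⟩
  · rw [Finset.disjoint_left]
    intro p
    induction p using Sym2.ind with
    | _ a b =>
      simp only [Finset.mem_filter, Finset.mem_sym2_iff, Finset.mem_union, Finset.mem_image,
        Finset.mem_product, Prod.exists, Sym2.mem_iff, forall_eq_or_imp, forall_eq, Sym2.eq_iff]
      have h' : ∀ a, a ∈ D → a ∉ E := fun a ha => Finset.disjoint_left.1 h ha
      rintro (⟨⟨h1, h2⟩, h3⟩ | ⟨c, d, ⟨h1, h2⟩, (⟨rfl, rfl⟩ | ⟨rfl, rfl⟩)⟩) ⟨⟨h4, h5⟩, h6⟩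
      · exact h' _ h1 h4
      · exact h' _ h1 h4
      · exact h' _ h1 h5
  · rw [Finset.disjoint_left]
    intro p
    induction p using Sym2.ind with
    | _ a b =>
      simp only [Finset.mem_filter, Finset.mem_sym2_iff, Finset.mem_image,
        Finset.mem_product, Prod.exists, Sym2.mem_iff, forall_eq_or_imp, forall_eq, Sym2.eq_iff]
      have h' : ∀ a, a ∈ D → a ∉ E := fun a ha => Finset.disjoint_left.1 h ha
      rintro ⟨⟨h4, h5⟩, h6⟩ ⟨c, d, ⟨h1, h2⟩, (⟨rfl, rfl⟩ | ⟨rfl, rfl⟩)⟩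
      · exact h' _ h5 h2
      · exact h' _ h4 h2

lemma pairSign_eq_prod_inter {N : ℕ} (X : Finset (Fin N) → ℝ × ℝ) (e f : Finset (Fin N)) :
    pairSign X s(e, f) = ∏ _v ∈ e ∩ f, K (X e) (X f) := by
  simp only [pairSign, Sym2.lift_mk, Finset.prod_const]
  split_ifs with h
  · obtain ⟨k, hk⟩ := h
    rw [hk, pow_succ, pow_mul, pow_two, K_sq, one_pow, one_mul]
  · obtain ⟨k, hk⟩ := Nat.not_odd_iff_even.1 h
    rw [hk, ← two_mul, pow_mul, pow_two, K_sq, one_pow]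

/-- Rooted hyperforests on `S ∪ U` with root set `S`. -/
def FO {N : ℕ} (q : ℕ) (S U : Finset (Fin N)) : Finset (Finset (Finset (Fin N))) :=
  (RE q S U).filter fun E => (q - 1) * E.card = U.card

lemma mem_FO {N q : ℕ} {S U : Finset (Fin N)} {E : Finset (Finset (Fin N))} :
    E ∈ FO q S U ↔ E ∈ RE q S U ∧ (q - 1) * E.card = U.card := by simp [FO]

/-- Sets of hyperedges which all contain `x` and are otherwise disjoint subsets of `U`. -/
def petals {N : ℕ} (q : ℕ) (x : Fin N) (U : Finset (Fin N)) : Finset (Finset (Finset (Fin N))) :=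
  Finset.univ.filter fun D => (∀ e ∈ D, e.card = q ∧ x ∈ e ∧ e.erase x ⊆ U) ∧
    ∀ e ∈ D, ∀ f ∈ D, e ≠ f → Disjoint (e.erase x) (f.erase x)

lemma mem_petals {N q : ℕ} {x : Fin N} {U : Finset (Fin N)} {D : Finset (Finset (Fin N))} :
    D ∈ petals q x U ↔ (∀ e ∈ D, e.card = q ∧ x ∈ e ∧ e.erase x ⊆ U) ∧
    ∀ e ∈ D, ∀ f ∈ D, e ≠ f → Disjoint (e.erase x) (f.erase x) := by simp [petals]

lemma cov_eq_biUnion {N q : ℕ} {x : Fin N} {U : Finset (Fin N)} {D : Finset (Finset (Fin N))}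
    (hx : x ∉ U) (hD : D ∈ petals q x U) : cov D U = D.biUnion fun e => e.erase x := by
  obtain ⟨h1, _⟩ := mem_petals.1 hD
  ext v
  rw [mem_cov, Finset.mem_biUnion]
  constructor
  · rintro ⟨hv, e, he, hve⟩
    exact ⟨e, he, Finset.mem_erase.2 ⟨fun h => hx (h ▸ hv), hve⟩⟩
  · rintro ⟨e, he, hve⟩
    exact ⟨(h1 e he).2.2 hve, e, he, Finset.mem_of_mem_erase hve⟩

lemma card_cov_petals {N q : ℕ} {x : Fin N} {U : Finset (Fin N)} {D : Finset (Finset (Fin N))}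
    (hx : x ∉ U) (hD : D ∈ petals q x U) : (cov D U).card = (q - 1) * D.card := by
  obtain ⟨h1, h2⟩ := mem_petals.1 hD
  rw [cov_eq_biUnion hx hD, Finset.card_biUnion fun e he f hf hef => h2 e he f hf hef,
    Finset.sum_const_nat (m := q - 1), mul_comm]
  intro e he
  rw [Finset.card_erase_of_mem (h1 e he).2.1, (h1 e he).1]

lemma mem_petals_of_card_cov {N q : ℕ} {A U : Finset (Fin N)} {x : Fin N} (hx : x ∉ U)
    {D : Finset (Finset (Fin N))} (hD : D ⊆ starEdges q A x) (hc : (q - 1) * D.card ≤ (cov D U).card) :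
    D ∈ petals q x U := by
  have hq : ∀ e ∈ D, (e.erase x).card = q - 1 := fun e he => by
    have := mem_starEdges.1 (hD he)
    rw [Finset.card_erase_of_mem this.2, this.1.1]
  have key : ∀ b ∈ D, ∀ B : Finset (Fin N), (cov D U) ⊆ B ∪ cov (D.erase b) U → q - 1 ≤ B.card := by
    intro b hb B hB
    have h1 := (Finset.card_le_card hB).trans (Finset.card_union_le _ _)
    have h2 := card_cov_le hx ((Finset.erase_subset b D).trans hD)
    rw [Finset.card_erase_of_mem hb] at h2
    have h3 : 1 ≤ D.card := Finset.card_pos.2 ⟨b, hb⟩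
    obtain ⟨d, hd⟩ := Nat.exists_eq_add_of_le' h3
    rw [hd] at h2 hc
    rw [Nat.add_sub_cancel] at h2
    rw [mul_add, mul_one] at hc
    omega
  have hU : ∀ e ∈ D, e.erase x ⊆ U := by
    intro e he
    have h1 := key e he (e.erase x ∩ U) (by
      intro v hv
      obtain ⟨hvU, f, hf, hvf⟩ := mem_cov.1 hv
      by_cases hfe : f = e
      · subst hfe
        exact Finset.mem_union_left _ (Finset.mem_inter.2 ⟨Finset.mem_erase.2 ⟨fun h => hx (h ▸ hvU), hvf⟩, hvU⟩)
      · exact Finset.mem_union_right _ (mem_cov.2 ⟨hvU, f, Finset.mem_erase.2 ⟨hfe, hf⟩, hvf⟩))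
    rw [← hq e he] at h1
    exact Finset.inter_eq_left.1 (Finset.eq_of_subset_of_card_le Finset.inter_subset_left h1)
  refine mem_petals.2 ⟨fun e he => ⟨(mem_starEdges.1 (hD he)).1.1, (mem_starEdges.1 (hD he)).2, hU e he⟩, ?_⟩
  intro e he f hf hef
  rw [Finset.disjoint_left]
  intro v hve hvf
  have h1 := key e he ((e.erase x).erase v) (by
    intro w hw
    obtain ⟨hwU, g, hg, hwg⟩ := mem_cov.1 hw
    by_cases hge : g = e
    · subst hge
      by_cases hwv : w = v
      · subst hwv
        exact Finset.mem_union_right _ (mem_cov.2 ⟨hwU, f, Finset.mem_erase.2 ⟨hef.symm, hf⟩, Finset.mem_of_mem_erase hvf⟩)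
      · exact Finset.mem_union_left _ (Finset.mem_erase.2 ⟨hwv, Finset.mem_erase.2 ⟨fun h => hx (h ▸ hwU), hwg⟩⟩)
    · exact Finset.mem_union_right _ (mem_cov.2 ⟨hwU, g, Finset.mem_erase.2 ⟨hge, hg⟩, hwg⟩))
  have h2 : 0 < (e.erase x).card := Finset.card_pos.2 ⟨v, hve⟩
  rw [Finset.card_erase_of_mem hve, hq e he] at h1
  rw [hq e he] at h2
  omega

lemma petals_subset_star {N q : ℕ} {S U : Finset (Fin N)} {x : Fin N} (hx : x ∈ S)
    {D : Finset (Finset (Fin N))} (hD : D ∈ petals q x U) : D ⊆ starEdges q (S ∪ U) x := by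
  intro e he
  obtain ⟨h1, h2, h3⟩ := (mem_petals.1 hD).1 e he
  refine mem_starEdges.2 ⟨⟨h1, fun v hv => ?_⟩, h2⟩
  by_cases hvx : v = x
  · exact Finset.mem_union_left _ (hvx ▸ hx)
  · exact Finset.mem_union_right _ (h3 (Finset.mem_erase.2 ⟨hvx, hv⟩))

/-- Summation over rooted hyperforests by peeling one root. -/
lemma sum_FO_peel {N q : ℕ} (hq : 1 ≤ q) {S U : Finset (Fin N)} {x : Fin N} (hx : x ∈ S)
    (hSU : Disjoint S U) {M : Type*} [AddCommMonoid M] (f : Finset (Finset (Fin N)) → M) :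
    ∑ E ∈ FO q S U, f E = ∑ D ∈ petals q x U,
      ∑ E' ∈ FO q (S.erase x ∪ cov D U) (U \ cov D U), f (D ∪ E') := by
  have hxU : x ∉ U := Finset.disjoint_left.1 hSU hx
  have h1 : ∀ D ∈ (starEdges q (S ∪ U) x).powerset, ∀ E' ∈ RE q (S.erase x ∪ cov D U) (U \ cov D U),
      ((q - 1) * (D ∪ E').card = U.card ↔ D ∈ petals q x U ∧
        E' ∈ FO q (S.erase x ∪ cov D U) (U \ cov D U)) := by
    intro D hD E' hE'
    rw [Finset.mem_powerset] at hD
    have hc := card_cov_le hxU hD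
    have hc' := card_le_of_mem_RE hq _ _ _ rfl (disjoint_peel (x := x) (W := cov D U) hSU) E' hE'
    have hsub := Finset.card_le_card (cov_subset D U)
    rw [mem_FO]
    rw [Finset.card_sdiff_of_subset (cov_subset D U)] at hc' ⊢
    have hdisj : Disjoint D E' := by
      rw [Finset.disjoint_left]
      intro e he he'
      exact not_mem_of_mem_RE_peel hx hSU (cov_subset D U) hE' he' (mem_starEdges.1 (hD he)).2
    rw [Finset.card_union_of_disjoint hdisj, mul_add]
    constructor
    · intro h
      exact ⟨mem_petals_of_card_cov hxU hD (by omega), hE', by omega⟩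
    · rintro ⟨h2, _, h3⟩
      have := card_cov_petals hxU h2
      omega
  have h2 : ∑ E ∈ FO q S U, f E = ∑ E ∈ RE q S U, if (q - 1) * E.card = U.card then f E else 0 := by
    rw [FO, Finset.sum_filter]
  rw [h2, sum_RE_peel hx hSU]
  have h3 : petals q x U ⊆ (starEdges q (S ∪ U) x).powerset := fun D hD =>
    Finset.mem_powerset.2 (petals_subset_star hx hD)
  rw [← Finset.sum_subset h3]
  · refine Finset.sum_congr rfl fun D hD => ?_
    rw [FO, Finset.sum_filter]
    refine Finset.sum_congr rfl fun E' hE' => ?_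
    refine if_congr ?_ rfl rfl
    rw [h1 D (h3 hD) E' hE', mem_FO]
    tauto
  · intro D hD hD'
    refine Finset.sum_eq_zero fun E' hE' => if_neg ?_
    rw [h1 D hD E' hE']
    tauto

lemma card_petals_succ {N q : ℕ} (hq : 2 ≤ q) {x : Fin N} {U : Finset (Fin N)} (hx : x ∉ U) (d : ℕ) :
    (d + 1) * ((petals q x U).filter (·.card = d + 1)).card =
      ∑ A ∈ U.powersetCard (q - 1), ((petals q x (U \ A)).filter (·.card = d)).card := by
  have h1 : (d + 1) * ((petals q x U).filter (·.card = d + 1)).card =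
      ∑ D ∈ (petals q x U).filter (·.card = d + 1), ∑ _e ∈ D, 1 := by
    rw [Finset.sum_congr rfl fun D hD => by
      rw [← Finset.card_eq_sum_ones, (Finset.mem_filter.1 hD).2], Finset.sum_const, smul_eq_mul, mul_comm]
  rw [h1, Finset.sum_sigma']
  rw [Finset.sum_congr rfl fun A _ => Finset.card_eq_sum_ones ((petals q x (U \ A)).filter (·.card = d)),
    Finset.sum_sigma']
  refine Finset.sum_bij' (fun p _ => (⟨p.2.erase x, p.1.erase p.2⟩ : Σ _ : Finset (Fin N), Finset (Finset (Fin N))))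
    (fun p _ => ⟨insert (insert x p.1) p.2, insert x p.1⟩) ?_ ?_ ?_ ?_ ?_
  · rintro ⟨D, e⟩ h
    simp only [Finset.mem_sigma, Finset.mem_filter, mem_petals] at h
    obtain ⟨⟨⟨h1, h2⟩, h3⟩, h4⟩ := h
    simp only [Finset.mem_sigma, Finset.mem_filter, mem_petals, Finset.mem_powersetCard]
    refine ⟨⟨(h1 e h4).2.2, by rw [Finset.card_erase_of_mem (h1 e h4).2.1, (h1 e h4).1]⟩, ⟨?_, ?_⟩, ?_⟩
    · intro f hf
      rw [Finset.mem_erase] at hf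
      refine ⟨(h1 f hf.2).1, (h1 f hf.2).2.1, fun v hv => Finset.mem_sdiff.2 ⟨(h1 f hf.2).2.2 hv, ?_⟩⟩
      exact Finset.disjoint_left.1 (h2 f hf.2 e h4 hf.1) hv
    · intro f hf g hg
      exact h2 f (Finset.mem_of_mem_erase hf) g (Finset.mem_of_mem_erase hg)
    · rw [Finset.card_erase_of_mem h4, h3]; rfl
  · rintro ⟨A, D⟩ h
    simp only [Finset.mem_sigma, Finset.mem_filter, mem_petals, Finset.mem_powersetCard] at h
    obtain ⟨⟨hA1, hA2⟩, ⟨h1, h2⟩, h3⟩ := h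
    have hxA : x ∉ A := fun h => hx (hA1 h)
    have hins : insert x A ∉ D := by
      intro hmem
      have := (h1 _ hmem).2.2
      rw [Finset.erase_insert hxA] at this
      obtain ⟨v, hv⟩ := Finset.card_pos.1 (by omega : 0 < A.card)
      exact (Finset.mem_sdiff.1 (this hv)).2 hv
    simp only [Finset.mem_sigma, Finset.mem_filter, mem_petals]
    refine ⟨⟨⟨?_, ?_⟩, ?_⟩, Finset.mem_insert_self _ _⟩
    · intro e he
      rcases Finset.mem_insert.1 he with rfl | he
      · rw [Finset.card_insert_of_notMem hxA, Finset.erase_insert hxA]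
        exact ⟨by omega, Finset.mem_insert_self _ _, hA1⟩
      · exact ⟨(h1 e he).1, (h1 e he).2.1, (h1 e he).2.2.trans Finset.sdiff_subset⟩
    · have hdis : ∀ f ∈ D, Disjoint A (f.erase x) := fun f hf =>
        Finset.disjoint_of_subset_right (h1 f hf).2.2 Finset.disjoint_sdiff
      intro e he f hf hef
      rcases Finset.mem_insert.1 he with rfl | he <;> rcases Finset.mem_insert.1 hf with rfl | hf
      · exact absurd rfl hef
      · rw [Finset.erase_insert hxA]; exact hdis f hf
      · rw [Finset.erase_insert hxA]; exact (hdis e he).symm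
      · exact h2 e he f hf hef
    · rw [Finset.card_insert_of_notMem hins, h3]
  · rintro ⟨D, e⟩ h
    simp only [Finset.mem_sigma, Finset.mem_filter, mem_petals] at h
    obtain ⟨⟨⟨h1, h2⟩, h3⟩, h4⟩ := h
    simp only [Finset.insert_erase (h1 e h4).2.1, Finset.insert_erase h4]
  · rintro ⟨A, D⟩ h
    simp only [Finset.mem_sigma, Finset.mem_filter, mem_petals, Finset.mem_powersetCard] at h
    obtain ⟨⟨hA1, hA2⟩, ⟨h1, h2⟩, h3⟩ := h
    have hxA : x ∉ A := fun h => hx (hA1 h)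
    have hins : insert x A ∉ D := by
      intro hmem
      have := (h1 _ hmem).2.2
      rw [Finset.erase_insert hxA] at this
      obtain ⟨v, hv⟩ := Finset.card_pos.1 (by omega : 0 < A.card)
      exact (Finset.mem_sdiff.1 (this hv)).2 hv
    simp only [Finset.erase_insert hxA, Finset.erase_insert hins]
  · intros; rfl

lemma card_petals {N q : ℕ} (hq : 2 ≤ q) {x : Fin N} (d : ℕ) : ∀ (U : Finset (Fin N)), x ∉ U →
    (q - 1) * d ≤ U.card →
    ((petals q x U).filter (·.card = d)).card * (d.factorial * (q - 1).factorial ^ d *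
      (U.card - (q - 1) * d).factorial) = U.card.factorial := by
  induction d with
  | zero =>
    intro U hx _
    have : (petals q x U).filter (·.card = 0) = {∅} := by
      ext D
      simp only [Finset.mem_filter, mem_petals, Finset.card_eq_zero, Finset.mem_singleton]
      constructor
      · exact fun h => h.2
      · rintro rfl; simp
    rw [this]; simp
  | succ d ih =>
    intro U hx hU
    have h1 := card_petals_succ hq hx d
    have hU' : (q - 1) ≤ U.card := by rw [mul_add] at hU; omega
    have h2 : ∀ A ∈ U.powersetCard (q - 1), ((petals q x (U \ A)).filter (·.card = d)).card *
        (d.factorial * (q - 1).factorial ^ d * (U.card - (q - 1) * (d + 1)).factorial) =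
        (U.card - (q - 1)).factorial := by
      intro A hA
      obtain ⟨hA1, hA2⟩ := Finset.mem_powersetCard.1 hA
      have h3 := ih (U \ A) (fun h => hx (Finset.mem_sdiff.1 h).1) (by
        rw [Finset.card_sdiff_of_subset hA1, hA2]; rw [mul_add] at hU; omega)
      rw [Finset.card_sdiff_of_subset hA1, hA2] at h3
      rw [← h3]
      congr 3
      rw [mul_add]; omega
    have h4 : (∑ A ∈ U.powersetCard (q - 1), ((petals q x (U \ A)).filter (·.card = d)).card) *
        (d.factorial * (q - 1).factorial ^ d * (U.card - (q - 1) * (d + 1)).factorial) =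
        U.card.choose (q - 1) * (U.card - (q - 1)).factorial := by
      rw [Finset.sum_mul, Finset.sum_congr rfl h2, Finset.sum_const, Finset.card_powersetCard, smul_eq_mul]
    rw [← h1] at h4
    rw [← Nat.choose_mul_factorial_mul_factorial hU', Nat.factorial_succ, pow_succ]
    linear_combination (q - 1).factorial * h4

lemma petals_card_eq_empty {N q : ℕ} {x : Fin N} {U : Finset (Fin N)} (hx : x ∉ U) {d : ℕ}
    (h : U.card < (q - 1) * d) : (petals q x U).filter (·.card = d) = ∅ := by
  rw [Finset.filter_eq_empty_iff]
  rintro D hD rfl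
  have h1 := card_cov_petals hx hD
  have h2 := Finset.card_le_card (cov_subset D U)
  omega

/-- Each chord of the family `y` repeated `q - 1` times. -/
def rep (q d : ℕ) (y : Fin d → ℝ × ℝ) : List (ℝ × ℝ) :=
  (List.ofFn y).flatMap fun a => List.replicate (q - 1) a

/-- Normalized signed count of rooted hyperforests with `k` vertices whose roots carry the chords
in the list. -/
def treeT (q : ℕ) : ℕ → List (ℝ × ℝ) → ℝ
  | 0, [] => 1
  | 0, _ :: _ => 0
  | _ + 1, [] => 0
  | k + 1, x :: L => ∑ d ∈ Finset.range (k + 1), ((d.factorial : ℝ) * ((q - 1).factorial : ℝ) ^ d)⁻¹ *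
      ∫ y : Fin d → ℝ × ℝ, (∏ i, K x (y i)) * pairProd d y * treeT q k (rep q d y ++ L) ∂nuPi (Fin d)

lemma length_rep (q d : ℕ) (y : Fin d → ℝ × ℝ) : (rep q d y).length = d * (q - 1) := by
  simp [rep, List.length_flatMap, Function.comp_def]

lemma abs_pairProd (d : ℕ) (y : Fin d → ℝ × ℝ) : |pairProd d y| = 1 := by
  unfold pairProd
  rw [Finset.abs_prod]
  exact Finset.prod_eq_one fun p _ => abs_K _ _

lemma abs_prod_K {ι : Type*} [Fintype ι] (x : ℝ × ℝ) (y : ι → ℝ × ℝ) : |∏ i, K x (y i)| = 1 := by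
  rw [Finset.abs_prod]
  exact Finset.prod_eq_one fun p _ => abs_K _ _

lemma measurable_pairProd (d : ℕ) : Measurable (pairProd d) := by
  unfold pairProd
  exact Finset.measurable_prod _ fun p _ => measurable_K (measurable_pi_apply _) (measurable_pi_apply _)

lemma treeT_eq_zero (q : ℕ) : ∀ (k : ℕ) (L : List (ℝ × ℝ)), k < L.length → treeT q k L = 0 := by
  intro k
  induction k with
  | zero =>
    intro L hL
    cases L with
    | nil => simp at hL
    | cons x L => simp [treeT]
  | succ k ih =>
    intro L hL
    cases L with
    | nil => simp at hL
    | cons x L =>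
      rw [treeT]
      refine Finset.sum_eq_zero fun d _ => ?_
      have : ∀ y : Fin d → ℝ × ℝ, treeT q k (rep q d y ++ L) = 0 := fun y => by
        apply ih
        rw [List.length_append]
        simp only [List.length_cons] at hL
        omega
      simp [this]

lemma abs_treeT_le (q : ℕ) : ∀ (k : ℕ) (L : List (ℝ × ℝ)), |treeT q k L| ≤ Real.exp 1 ^ k := by
  intro k
  induction k with
  | zero => intro L; cases L <;> simp [treeT]
  | succ k ih =>
    intro L
    cases L with
    | nil => simp [treeT]; positivity
    | cons x L =>
      rw [treeT]
      have h1 : ∀ d ∈ Finset.range (k + 1), |((d.factorial : ℝ) * ((q - 1).factorial : ℝ) ^ d)⁻¹ *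
          ∫ y : Fin d → ℝ × ℝ, (∏ i, K x (y i)) * pairProd d y * treeT q k (rep q d y ++ L) ∂nuPi (Fin d)|
          ≤ (1 / (d.factorial : ℝ)) * Real.exp 1 ^ k := by
        intro d _
        rw [abs_mul]
        have h2 : |∫ y : Fin d → ℝ × ℝ, (∏ i, K x (y i)) * pairProd d y * treeT q k (rep q d y ++ L) ∂nuPi (Fin d)|
            ≤ Real.exp 1 ^ k := by
          have := norm_integral_le_of_norm_le_const (μ := nuPi (Fin d)) (C := Real.exp 1 ^ k)
            (f := fun y => (∏ i, K x (y i)) * pairProd d y * treeT q k (rep q d y ++ L))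
            (Eventually.of_forall fun y => by
              rw [Real.norm_eq_abs, abs_mul, abs_mul, abs_prod_K, abs_pairProd, one_mul, one_mul]
              exact ih _)
          simpa using this
        refine mul_le_mul ?_ h2 (abs_nonneg _) (by positivity)
        rw [abs_of_pos (by positivity), ← one_div]
        have h3 : (1 : ℝ) ≤ ((q - 1).factorial : ℝ) ^ d :=
          one_le_pow₀ (by exact_mod_cast Nat.one_le_iff_ne_zero.2 (Nat.factorial_ne_zero _))
        have h4 : (0 : ℝ) < d.factorial := by exact_mod_cast Nat.factorial_pos _
        gcongr
        exact le_mul_of_one_le_right h4.le h3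
      refine (Finset.abs_sum_le_sum_abs _ _).trans ((Finset.sum_le_sum h1).trans ?_)
      rw [← Finset.sum_mul, pow_succ, mul_comm]
      gcongr
      have := Real.sum_le_exp_of_nonneg (x := 1) zero_le_one (k + 1)
      simpa using this

lemma measurable_treeT (q : ℕ) : ∀ (k : ℕ) {α : Type} [MeasurableSpace α] (fs : List (α → ℝ × ℝ)),
    (∀ f ∈ fs, Measurable f) → Measurable fun a => treeT q k (fs.map fun f => f a) := by
  intro k
  induction k with
  | zero =>
    intro α _ fs _
    cases fs <;> simp [treeT]
  | succ k ih =>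
    intro α _ fs hfs
    cases fs with
    | nil => simp [treeT]
    | cons f fs =>
      simp only [List.map_cons, treeT]
      refine Finset.measurable_sum _ fun d _ => Measurable.const_mul ?_ _
      refine StronglyMeasurable.measurable (StronglyMeasurable.integral_prod_right' (f := fun (p : α × (Fin d → ℝ × ℝ)) =>
        (∏ i, K (f p.1) (p.2 i)) * pairProd d p.2 * treeT q k (rep q d p.2 ++ fs.map fun f => f p.1)) ?_)
      refine Measurable.stronglyMeasurable ?_
      refine Measurable.mul (Measurable.mul (Finset.measurable_prod _ fun i _ => measurable_K
        ((hfs f (by simp)).comp measurable_fst) ((measurable_pi_apply i).comp measurable_snd))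
        ((measurable_pairProd d).comp measurable_snd)) ?_
      have := ih (α := α × (Fin d → ℝ × ℝ))
        (((List.ofFn fun i : Fin d => fun p : α × (Fin d → ℝ × ℝ) => p.2 i).flatMap
          fun a => List.replicate (q - 1) a) ++ fs.map fun f => fun p => f p.1) (by
          intro g hg
          rw [List.mem_append, List.mem_flatMap, List.mem_map] at hg
          rcases hg with ⟨a, ha, hg⟩ | ⟨f', hf', rfl⟩
          · obtain ⟨i, rfl⟩ := List.mem_ofFn.1 ha
            rw [List.eq_of_mem_replicate hg]
            exact (measurable_pi_apply i).comp measurable_snd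
          · exact (hfs f' (List.mem_cons_of_mem _ hf')).comp measurable_fst)
      convert this using 3 with p
      rw [List.map_append, List.map_flatMap, List.map_map, rep]
      congr 1
      have hy : List.ofFn p.2 = (List.ofFn fun (i : Fin d) (p : α × (Fin d → ℝ × ℝ)) => p.2 i).map (fun g => g p) := by
        simp [List.map_ofFn, Function.comp_def]
      rw [hy, List.flatMap_map]
      simp

/-- Crossing signs between the hyperedges and the chords carried by the roots they contain. -/
def RS {N : ℕ} (S : Finset (Fin N)) (E : Finset (Finset (Fin N))) (y : Fin N → ℝ × ℝ)
    (X : Finset (Fin N) → ℝ × ℝ) : ℝ :=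
  ∏ r ∈ S, ∏ e ∈ E, if r ∈ e then K (y r) (X e) else 1

/-- The signed count of hyperforests rooted at `S`. -/
def Rsum {N : ℕ} (q : ℕ) (S U : Finset (Fin N)) (y : Fin N → ℝ × ℝ) : ℝ :=
  ∑ E ∈ FO q S U, ∫ X, BE E X * RS S E y X ∂nuPi (Finset (Fin N))

/-- The chords inherited by the vertices covered by `D`. -/
def inherit {N : ℕ} (x : Fin N) (D : Finset (Finset (Fin N))) (y : Fin N → ℝ × ℝ)
    (X : Finset (Fin N) → ℝ × ℝ) (v : Fin N) : ℝ × ℝ :=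
  if h : ∃ e ∈ D, v ∈ e.erase x then X h.choose else y v

lemma inherit_of_mem {N q : ℕ} {x : Fin N} {U : Finset (Fin N)} {D : Finset (Finset (Fin N))}
    (hD : D ∈ petals q x U) (y : Fin N → ℝ × ℝ) (X : Finset (Fin N) → ℝ × ℝ) {e : Finset (Fin N)}
    (he : e ∈ D) {v : Fin N} (hv : v ∈ e.erase x) : inherit x D y X v = X e := by
  have h : ∃ e ∈ D, v ∈ e.erase x := ⟨e, he, hv⟩
  rw [inherit, dif_pos h]
  congr 1
  by_contra hne
  exact Finset.disjoint_left.1 ((mem_petals.1 hD).2 _ h.choose_spec.1 _ he hne) h.choose_spec.2 hv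

lemma inherit_of_notMem {N q : ℕ} {x : Fin N} {U : Finset (Fin N)} {D : Finset (Finset (Fin N))}
    (hD : D ∈ petals q x U) (y : Fin N → ℝ × ℝ) (X : Finset (Fin N) → ℝ × ℝ) {v : Fin N} (hv : v ∉ U) :
    inherit x D y X v = y v := by
  rw [inherit, dif_neg]
  rintro ⟨e, he, hve⟩
  exact hv (((mem_petals.1 hD).1 e he).2.2 hve)

lemma measurable_RS {N : ℕ} {α : Type*} [MeasurableSpace α] {y : α → Fin N → ℝ × ℝ}
    {X : α → Finset (Fin N) → ℝ × ℝ} (hy : ∀ v, Measurable fun a => y a v)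
    (hX : ∀ e, Measurable fun a => X a e) (S : Finset (Fin N)) (E : Finset (Finset (Fin N))) :
    Measurable fun a => RS S E (y a) (X a) := by
  unfold RS
  refine Finset.measurable_prod _ fun r _ => Finset.measurable_prod _ fun e _ => ?_
  split_ifs
  · exact measurable_K (hy r) (hX e)
  · exact measurable_const

lemma abs_RS {N : ℕ} (S : Finset (Fin N)) (E : Finset (Finset (Fin N))) (y : Fin N → ℝ × ℝ)
    (X : Finset (Fin N) → ℝ × ℝ) : |RS S E y X| = 1 := by
  unfold RS
  rw [Finset.abs_prod]
  refine Finset.prod_eq_one fun r _ => ?_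
  rw [Finset.abs_prod]
  refine Finset.prod_eq_one fun e _ => ?_
  split_ifs
  · exact abs_K _ _
  · simp

/-- Factorization of the sign of a rooted hyperforest along the hyperedges at a root. -/
lemma sign_peel {N q : ℕ} {S U : Finset (Fin N)} {x : Fin N} (hx : x ∈ S)
    (hSU : Disjoint S U) {D E' : Finset (Finset (Fin N))} (hD : D ∈ petals q x U)
    (hE' : ∀ e ∈ E', x ∉ e) (y : Fin N → ℝ × ℝ) (X : Finset (Fin N) → ℝ × ℝ) :
    BE (D ∪ E') X * RS S (D ∪ E') y X = (BE D X * ∏ e ∈ D, K (y x) (X e)) *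
      (BE E' X * RS (S.erase x ∪ cov D U) E' (inherit x D y X) X) := by
  have hxU : x ∉ U := Finset.disjoint_left.1 hSU hx
  obtain ⟨hD1, hD2⟩ := mem_petals.1 hD
  have hdisj : Disjoint D E' := Finset.disjoint_left.2 fun e he he' => hE' e he' (hD1 e he).2.1
  have hcov : Disjoint (S.erase x) (cov D U) :=
    (hSU.mono_left (Finset.erase_subset _ _)).mono_right (cov_subset _ _)
  have h1 : ∏ e ∈ D, ∏ f ∈ E', pairSign X s(e, f) = RS (cov D U) E' (inherit x D y X) X := by
    rw [RS, cov_eq_biUnion hxU hD, Finset.prod_biUnion fun e he f hf hef => hD2 e he f hf hef]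
    refine Finset.prod_congr rfl fun e he => ?_
    rw [Finset.prod_comm]
    refine Finset.prod_congr rfl fun f hf => ?_
    rw [pairSign_eq_prod_inter, ← Finset.prod_filter]
    have : e ∩ f = (e.erase x).filter (· ∈ f) := by
      ext v
      simp only [Finset.mem_inter, Finset.mem_filter, Finset.mem_erase]
      constructor
      · exact fun h => ⟨⟨fun hvx => hE' f hf (hvx ▸ h.2), h.1⟩, h.2⟩
      · exact fun h => ⟨h.1.2, h.2⟩
    rw [this]
    refine Finset.prod_congr rfl fun v hv => ?_
    rw [inherit_of_mem hD y X he (Finset.mem_filter.1 hv).1]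
  have h2 : RS S (D ∪ E') y X = (∏ e ∈ D, K (y x) (X e)) *
      RS (S.erase x) E' (inherit x D y X) X := by
    unfold RS
    rw [← Finset.mul_prod_erase S _ hx]
    congr 1
    · rw [Finset.prod_union hdisj, Finset.prod_eq_one (s := E') fun e he => if_neg (hE' e he), mul_one]
      exact Finset.prod_congr rfl fun e he => if_pos (hD1 e he).2.1
    · refine Finset.prod_congr rfl fun r hr => ?_
      obtain ⟨hrx, hrS⟩ := Finset.mem_erase.1 hr
      have hrU := Finset.disjoint_left.1 hSU hrS
      rw [Finset.prod_union hdisj, Finset.prod_eq_one (s := D), one_mul,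
        inherit_of_notMem hD y X hrU]
      intro e he
      exact if_neg fun h => hrU ((hD1 e he).2.2 (Finset.mem_erase.2 ⟨hrx, h⟩))
  have h3 : RS (S.erase x ∪ cov D U) E' (inherit x D y X) X =
      RS (S.erase x) E' (inherit x D y X) X * RS (cov D U) E' (inherit x D y X) X := by
    unfold RS
    rw [Finset.prod_union hcov]
  rw [BE_union hdisj, h1, h2, h3]
  ring

lemma BE_congr {N : ℕ} {E : Finset (Finset (Fin N))} {X X' : Finset (Fin N) → ℝ × ℝ}
    (h : ∀ e ∈ E, X e = X' e) : BE E X = BE E X' := by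
  unfold BE
  refine Finset.prod_congr rfl fun p hp => ?_
  induction p using Sym2.ind with
  | _ a b =>
    obtain ⟨ha, hb⟩ := Finset.mk_mem_sym2_iff.1 (Finset.mem_filter.1 hp).1
    simp only [pairSign, Sym2.lift_mk, h a ha, h b hb]

lemma RS_congr {N : ℕ} {S : Finset (Fin N)} {E : Finset (Finset (Fin N))} {y y' : Fin N → ℝ × ℝ}
    {X X' : Finset (Fin N) → ℝ × ℝ} (hy : ∀ v ∈ S, y v = y' v) (h : ∀ e ∈ E, X e = X' e) :
    RS S E y X = RS S E y' X' := by
  unfold RS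
  refine Finset.prod_congr rfl fun r hr => Finset.prod_congr rfl fun e he => ?_
  rw [hy r hr, h e he]

lemma inherit_congr {N : ℕ} {x : Fin N} {D : Finset (Finset (Fin N))} {y : Fin N → ℝ × ℝ}
    {X X' : Finset (Fin N) → ℝ × ℝ} (h : ∀ e ∈ D, X e = X' e) :
    inherit x D y X = inherit x D y X' := by
  funext v
  unfold inherit
  split_ifs with hv
  · exact h _ hv.choose_spec.1
  · rfl

/-- The configuration equal to `X` on `D` and to `X'` elsewhere. -/
def splice {ι : Type*} (D : Finset ι) (X X' : ι → ℝ × ℝ) (i : ι) : ℝ × ℝ := if i ∈ D then X i else X' i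

lemma splice_of_mem {ι : Type*} {D : Finset ι} {X X' : ι → ℝ × ℝ} {i : ι} (h : i ∈ D) :
    splice D X X' i = X i := if_pos h

lemma splice_of_notMem {ι : Type*} {D : Finset ι} {X X' : ι → ℝ × ℝ} {i : ι} (h : i ∉ D) :
    splice D X X' i = X' i := if_neg h

lemma measurable_splice {ι : Type*} (D : Finset ι) (X : ι → ℝ × ℝ) (i : ι) :
    Measurable fun X' : ι → ℝ × ℝ => splice D X X' i := by
  unfold splice
  split_ifs
  · exact measurable_const
  · exact measurable_pi_apply i

lemma integral_splice {ι : Type*} [Fintype ι] (D : Finset ι) {f : (ι → ℝ × ℝ) → ℝ}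
    (hf : Measurable f) {C : ℝ} (hC : ∀ X, |f X| ≤ C) :
    ∫ X, f X ∂nuPi ι = ∫ X, ∫ X', f (splice D X X') ∂nuPi ι ∂nuPi ι := integral_piecewise D hf hC

/-- One step of the recursion for `Rsum`, before enumeration of the hyperedges at the root. -/
lemma Rsum_peel {N q : ℕ} (hq : 1 ≤ q) {S U : Finset (Fin N)} {x : Fin N} (hx : x ∈ S)
    (hSU : Disjoint S U) (y : Fin N → ℝ × ℝ) :
    Rsum q S U y = ∑ D ∈ petals q x U, ∫ X, (BE D X * ∏ e ∈ D, K (y x) (X e)) *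
      Rsum q (S.erase x ∪ cov D U) (U \ cov D U) (inherit x D y X) ∂nuPi (Finset (Fin N)) := by
  rw [Rsum, sum_FO_peel hq hx hSU]
  refine Finset.sum_congr rfl fun D hD => ?_
  have hnot : ∀ E' ∈ FO q (S.erase x ∪ cov D U) (U \ cov D U), ∀ e ∈ E', x ∉ e := fun E' hE' e he =>
    not_mem_of_mem_RE_peel hx hSU (cov_subset D U) (mem_FO.1 hE').1 he
  have hmX : ∀ e : Finset (Fin N), Measurable fun X : Finset (Fin N) → ℝ × ℝ => X e :=
    fun e => measurable_pi_apply e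
  have hm : ∀ E : Finset (Finset (Fin N)),
      Measurable fun X : Finset (Fin N) → ℝ × ℝ => BE E X * RS S E y X := fun E =>
    (measurable_BE hmX E).mul (measurable_RS (y := fun _ => y) (fun _ => measurable_const) hmX S E)
  have hb : ∀ (E : Finset (Finset (Fin N))) S y X, |BE E X * RS S E y X| ≤ 1 := fun E S y X => by
    rw [abs_mul, abs_BE, abs_RS, one_mul]
  rw [← integral_finsetSum]
  swap
  · intro E' _
    exact Integrable.of_bound (hm _).aestronglyMeasurable 1 (Eventually.of_forall fun X => hb _ _ _ X)
  rw [integral_splice D (Finset.measurable_sum _ fun E' _ => hm _)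
    (C := ∑ _E' ∈ FO q (S.erase x ∪ cov D U) (U \ cov D U), (1 : ℝ))]
  swap
  · exact fun X => (Finset.abs_sum_le_sum_abs _ _).trans (Finset.sum_le_sum fun E' _ => hb _ _ _ _)
  refine integral_congr_ae (Eventually.of_forall fun X => ?_)
  simp only
  rw [Rsum, Finset.mul_sum, integral_finsetSum]
  · refine Finset.sum_congr rfl fun E' hE' => ?_
    rw [← integral_const_mul]
    refine integral_congr_ae (Eventually.of_forall fun X' => ?_)
    simp only
    rw [sign_peel hx hSU hD (hnot E' hE')]
    have hXD : ∀ e ∈ D, splice D X X' e = X e := fun e he => splice_of_mem he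
    have hXE : ∀ e ∈ E', splice D X X' e = X' e := fun e he =>
      splice_of_notMem fun h => hnot E' hE' e he ((mem_petals.1 hD).1 e h).2.1
    rw [BE_congr hXD, BE_congr hXE, inherit_congr hXD, RS_congr (fun _ _ => rfl) hXE]
    congr 2
    exact Finset.prod_congr rfl fun e he => by rw [hXD e he]
  · intro E' _
    exact Integrable.of_bound ((measurable_BE (measurable_splice D X) _).mul
      (measurable_RS (y := fun _ => y) (fun _ => measurable_const) (measurable_splice D X) S
        _)).aestronglyMeasurable 1 (Eventually.of_forall fun X' => hb _ _ _ _)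

lemma BE_petals {N q : ℕ} {x : Fin N} {U : Finset (Fin N)}
    {D : Finset (Finset (Fin N))} (hD : D ∈ petals q x U) {d : ℕ} {e : Fin d → Finset (Fin N)}
    (he : Function.Injective e) (heD : ∀ f, f ∈ D ↔ ∃ i, e i = f) (X : Finset (Fin N) → ℝ × ℝ) :
    BE D X = pairProd d fun i => X (e i) := by
  obtain ⟨hD1, hD2⟩ := mem_petals.1 hD
  unfold BE pairProd
  symm
  refine Finset.prod_bij (fun p _ => s(e p.1, e p.2)) ?_ ?_ ?_ ?_
  · intro p hp
    rw [Finset.mem_filter, Finset.mk_mem_sym2_iff]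
    refine ⟨⟨(heD _).2 ⟨_, rfl⟩, (heD _).2 ⟨_, rfl⟩⟩, ?_⟩
    rw [Sym2.mk_isDiag_iff]
    exact fun h => (Finset.mem_filter.1 hp).2.ne (he h)
  · rintro ⟨a, b⟩ hp ⟨c, d'⟩ hp' h
    have h1 := (Finset.mem_filter.1 hp).2
    have h2 := (Finset.mem_filter.1 hp').2
    simp only at h h1 h2
    rw [Sym2.eq_iff] at h
    rcases h with ⟨h3, h4⟩ | ⟨h3, h4⟩
    · rw [he h3, he h4]
    · rw [he h3, he h4] at h1
      exact absurd h1 (not_lt.2 h2.le)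
  · intro p hp
    induction p using Sym2.ind with
    | _ a b =>
      rw [Finset.mem_filter, Finset.mk_mem_sym2_iff, Sym2.mk_isDiag_iff] at hp
      obtain ⟨⟨ha, hb⟩, hab⟩ := hp
      obtain ⟨i, rfl⟩ := (heD _).1 ha
      obtain ⟨j, rfl⟩ := (heD _).1 hb
      rcases lt_trichotomy i j with h | h | h
      · exact ⟨(i, j), by simpa using h, rfl⟩
      · exact absurd (h ▸ rfl) hab
      · exact ⟨(j, i), by simpa using h, Sym2.eq_swap⟩
  · intro p hp
    have hlt := (Finset.mem_filter.1 hp).2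
    simp only [pairSign, Sym2.lift_mk]
    rw [if_pos]
    have hne : e p.1 ≠ e p.2 := fun h => hlt.ne (he h)
    have h1 := (heD (e p.1)).2 ⟨_, rfl⟩
    have h2 := (heD (e p.2)).2 ⟨_, rfl⟩
    have : e p.1 ∩ e p.2 = {x} := by
      ext v
      rw [Finset.mem_inter, Finset.mem_singleton]
      constructor
      · rintro ⟨h3, h4⟩
        by_contra hv
        exact Finset.disjoint_left.1 (hD2 _ h1 _ h2 hne) (Finset.mem_erase.2 ⟨hv, h3⟩)
          (Finset.mem_erase.2 ⟨hv, h4⟩)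
      · rintro rfl
        exact ⟨(hD1 _ h1).2.1, (hD1 _ h2).2.1⟩
    rw [this]
    simp

/-- The child list of a root. -/
lemma children_list {N q : ℕ} {S U : Finset (Fin N)} {x : Fin N} {l : List (Fin N)}
    (hl : (x :: l).Nodup) (hlS : (x :: l).toFinset = S) (hSU : Disjoint S U)
    {D : Finset (Finset (Fin N))} (hD : D ∈ petals q x U) {d : ℕ} {e : Fin d → Finset (Fin N)}
    (he : Function.Injective e) (heD : ∀ f, f ∈ D ↔ ∃ i, e i = f) :
    ∃ l' : List (Fin N), l'.Nodup ∧ l'.toFinset = S.erase x ∪ cov D U ∧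
      ∀ y X, l'.map (inherit x D y X) = rep q d (fun i => X (e i)) ++ l.map y := by
  obtain ⟨hD1, hD2⟩ := mem_petals.1 hD
  have hxS : x ∈ S := by rw [← hlS]; simp
  have hxU : x ∉ U := Finset.disjoint_left.1 hSU hxS
  have hmemD : ∀ f, f ∈ List.ofFn e ↔ f ∈ D := fun f => by rw [List.mem_ofFn, heD]
  have hlS' : ∀ v, v ∈ l → v ∈ S := fun v hv => by rw [← hlS]; simp [hv]
  refine ⟨(List.ofFn e).flatMap (fun f => (f.erase x).toList) ++ l, ?_, ?_, ?_⟩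
  · rw [List.nodup_append]
    refine ⟨?_, (List.nodup_cons.1 hl).2, ?_⟩
    · rw [List.nodup_flatMap]
      refine ⟨fun f _ => Finset.nodup_toList _, ?_⟩
      rw [List.pairwise_ofFn]
      intro i j hij
      have := hD2 _ ((heD (e i)).2 ⟨_, rfl⟩) _ ((heD (e j)).2 ⟨_, rfl⟩) fun h => hij.ne (he h)
      rw [Function.onFun, List.disjoint_left]
      intro v hv hv'
      exact Finset.disjoint_left.1 this (Finset.mem_toList.1 hv) (Finset.mem_toList.1 hv')
    · intro a ha b hb hab
      obtain ⟨f, hf, haf⟩ := List.mem_flatMap.1 ha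
      have := (hD1 f ((hmemD f).1 hf)).2.2 (Finset.mem_toList.1 haf)
      exact Finset.disjoint_left.1 hSU (hlS' b hb) (hab ▸ this)
  · ext v
    rw [List.mem_toFinset, List.mem_append, List.mem_flatMap, Finset.mem_union, cov_eq_biUnion hxU hD,
      Finset.mem_biUnion, or_comm]
    refine or_congr ?_ ?_
    · rw [← hlS, Finset.mem_erase, List.mem_toFinset, List.mem_cons]
      have := (List.nodup_cons.1 hl).1
      constructor
      · exact fun h => ⟨fun hv => this (hv ▸ h), Or.inr h⟩
      · exact fun h => h.2.resolve_left h.1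
    · simp only [hmemD, Finset.mem_toList]
  · intro y X
    rw [List.map_append, rep]
    congr 1
    · have : (List.ofFn fun i => X (e i)) = (List.ofFn e).map X := by rw [List.map_ofFn]; rfl
      rw [this, List.map_flatMap, List.flatMap_map]
      refine List.flatMap_congr fun f hf => ?_
      have hfD := (hmemD f).1 hf
      rw [List.eq_replicate_iff]
      constructor
      · rw [List.length_map, Finset.length_toList, Finset.card_erase_of_mem (hD1 f hfD).2.1, (hD1 f hfD).1]
      · intro b hb
        obtain ⟨v, hv, rfl⟩ := List.mem_map.1 hb
        exact inherit_of_mem hD y X hfD (Finset.mem_toList.1 hv)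
    · refine List.map_congr_left fun v hv => ?_
      exact inherit_of_notMem hD y X (Finset.disjoint_left.1 hSU (hlS' v hv))

/-- The signed count of rooted hyperforests in terms of `treeT`. -/
theorem Rsum_eq_treeT {N q : ℕ} (hq : 2 ≤ q) : ∀ (k : ℕ) (l : List (Fin N)) (S U : Finset (Fin N)),
    S.card + U.card = k → l.Nodup → l.toFinset = S → Disjoint S U → ∀ y,
    Rsum q S U y = (U.card.factorial : ℝ) * treeT q k (l.map y) := by
  intro k
  induction k with
  | zero =>
    intro l S U hk _ hl _ y
    have hS : S = ∅ := Finset.card_eq_zero.1 (by omega)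
    have hU : U = ∅ := Finset.card_eq_zero.1 (by omega)
    subst hU
    have hl0 : l = [] := by rw [hS] at hl; simpa using hl
    subst hl0 hS
    rw [Rsum]
    have : FO (N := N) q ∅ ∅ = {∅} := by
      ext E
      rw [mem_FO, RE_empty_left (by omega), if_pos rfl, Finset.mem_singleton]
      constructor
      · exact fun h => h.1
      · rintro rfl; simp
    rw [this]
    simp [treeT, BE, RS]
  | succ k ih =>
    intro l S U hk hl hlS hSU y
    cases l with
    | nil =>
      have hS : S = ∅ := by rw [← hlS]; simp
      subst hS
      have hU : U ≠ ∅ := by rintro rfl; simp at hk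
      rw [Rsum, FO, RE_empty_left (by omega), if_neg hU]
      simp [treeT]
    | cons x l =>
      have hxS : x ∈ S := by rw [← hlS]; simp
      have hxU : x ∉ U := Finset.disjoint_left.1 hSU hxS
      rw [Rsum_peel (by omega) hxS hSU]
      have hterm : ∀ D ∈ petals q x U, ∫ X, (BE D X * ∏ e ∈ D, K (y x) (X e)) *
          Rsum q (S.erase x ∪ cov D U) (U \ cov D U) (inherit x D y X) ∂nuPi (Finset (Fin N)) =
          ((U.card - (q - 1) * D.card).factorial : ℝ) * ∫ z : Fin D.card → ℝ × ℝ,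
            (∏ i, K (y x) (z i)) * pairProd D.card z * treeT q k (rep q D.card z ++ l.map y)
              ∂nuPi (Fin D.card) := by
        intro D hD
        have hcov := card_cov_petals hxU hD
        obtain ⟨e, he, heD⟩ : ∃ e : Fin D.card → Finset (Fin N), Function.Injective e ∧
            ∀ f, f ∈ D ↔ ∃ i, e i = f := by
          refine ⟨fun i => (D.equivFin.symm i).1, Subtype.val_injective.comp D.equivFin.symm.injective,
            fun f => ⟨fun hf => ⟨D.equivFin ⟨f, hf⟩, by simp⟩, ?_⟩⟩
          rintro ⟨i, rfl⟩
          exact (D.equivFin.symm i).2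
        obtain ⟨l', hl'1, hl'2, hl'3⟩ := children_list hl hlS hSU hD he heD
        have hUc : (U \ cov D U).card = U.card - (q - 1) * D.card := by
          rw [Finset.card_sdiff_of_subset (cov_subset _ _), hcov]
        have hcard : (S.erase x ∪ cov D U).card + (U \ cov D U).card = k := by
          have h1 := disjoint_peel (x := x) (W := cov D U) hSU
          rw [← Finset.card_union_of_disjoint h1, peel_union hxS hSU (cov_subset _ _),
            Finset.card_erase_of_mem (Finset.mem_union_left _ hxS), Finset.card_union_of_disjoint hSU, hk]
          rfl
        have hmp := measurePreserving_comp_injective he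
        rw [← hmp.map_eq, integral_map hmp.measurable.aemeasurable, ← integral_const_mul]
        · refine integral_congr_ae (Eventually.of_forall fun X => ?_)
          simp only
          rw [ih l' _ _ hcard hl'1 hl'2 (disjoint_peel hSU), hl'3, hUc, BE_petals hD he heD]
          have : ∏ f ∈ D, K (y x) (X f) = ∏ i, K (y x) (X (e i)) := by
            have : D = Finset.univ.image e := by ext f; simp [heD]
            exact (Finset.prod_congr this fun _ _ => rfl).trans (Finset.prod_image he.injOn)
          rw [this]
          ring
        · refine Measurable.aestronglyMeasurable ?_
          refine ((Finset.measurable_prod _ fun i _ => measurable_K measurable_const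
            (measurable_pi_apply i)).mul (measurable_pairProd _)).mul ?_
          have := measurable_treeT q k (α := Fin D.card → ℝ × ℝ)
            ((List.ofFn fun (i : Fin D.card) (z : Fin D.card → ℝ × ℝ) => z i).flatMap
              (fun f => List.replicate (q - 1) f) ++ (l.map y).map fun c _ => c) (by
              intro f hf
              rcases List.mem_append.1 hf with h | h
              · obtain ⟨g, hg, hfg⟩ := List.mem_flatMap.1 h
                rw [List.eq_of_mem_replicate hfg]
                rw [List.mem_ofFn] at hg
                obtain ⟨i, rfl⟩ := hg
                exact measurable_pi_apply i
              · obtain ⟨c, _, rfl⟩ := List.mem_map.1 h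
                exact measurable_const)
          convert this using 3 with z
          rw [List.map_append, rep, List.map_flatMap, List.map_map]
          congr 1
          · have : List.ofFn z = (List.ofFn fun (i : Fin D.card) (z : Fin D.card → ℝ × ℝ) => z i).map
                fun f => f z := by rw [List.map_ofFn]; rfl
            rw [this, List.flatMap_map]
            simp
          · simp [Function.comp_def]
      rw [Finset.sum_congr rfl hterm]
      have hlen : l.length + 1 = S.card := by
        rw [← hlS, List.toFinset_card_of_nodup hl, List.length_cons]
      have hDk : ∀ D ∈ petals q x U, D.card ∈ Finset.range (k + 1) := by
        intro D hD
        have h1 := card_cov_petals hxU hD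
        have h2 := Finset.card_le_card (cov_subset D U)
        rw [Finset.mem_range]
        have : D.card ≤ (q - 1) * D.card := Nat.le_mul_of_pos_left _ (by omega)
        omega
      rw [← Finset.sum_fiberwise_of_maps_to hDk, List.map_cons, treeT, Finset.mul_sum]
      refine Finset.sum_congr rfl fun d _ => ?_
      rw [Finset.sum_congr rfl (g := fun _ => ((U.card - (q - 1) * d).factorial : ℝ) *
        ∫ z : Fin d → ℝ × ℝ, (∏ i, K (y x) (z i)) * pairProd d z * treeT q k (rep q d z ++ l.map y)
          ∂nuPi (Fin d))]
      swap
      · intro D hD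
        obtain ⟨_, rfl⟩ := Finset.mem_filter.1 hD
        rfl
      rw [Finset.sum_const, nsmul_eq_mul]
      by_cases hd : (q - 1) * d ≤ U.card
      · have h1 := card_petals hq d U hxU hd
        have h2 : (d.factorial : ℝ) * ((q - 1).factorial : ℝ) ^ d ≠ 0 := by positivity
        have h3 : ((Finset.card ((petals q x U).filter (·.card = d)) : ℕ) : ℝ) *
            ((d.factorial : ℝ) * ((q - 1).factorial : ℝ) ^ d *
              ((U.card - (q - 1) * d).factorial : ℝ)) = (U.card.factorial : ℝ) := by
          exact_mod_cast h1
        rw [← h3]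
        field_simp
      · rw [petals_card_eq_empty hxU (by omega)]
        have : ∀ z : Fin d → ℝ × ℝ, treeT q k (rep q d z ++ l.map y) = 0 := fun z => by
          apply treeT_eq_zero
          rw [List.length_append, length_rep, List.length_map, mul_comm]
          omega
        simp [this]

lemma edgeRel_symm {N : ℕ} {E : Finset (Finset (Fin N))} {a b : Fin N}
    (h : Relation.ReflTransGen (edgeRel E) a b) : Relation.ReflTransGen (edgeRel E) b a :=
  by
  induction h with
  | refl => exact Relation.ReflTransGen.refl
  | tail _ hbc ih =>
    obtain ⟨e, he, h1, h2⟩ := hbc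
    exact Relation.ReflTransGen.head ⟨e, he, h2, h1⟩ ih

lemma mem_trees {N q : ℕ} {E : Finset (Finset (Fin N))} : E ∈ trees q N ↔
    (∀ e ∈ E, e.card = q) ∧ HGConnected E ∧ (q - 1) * E.card = N - 1 := by
  simp [trees, IsHypertree]

lemma connected_of_root {N : ℕ} {E : Finset (Finset (Fin N))} (x : Fin N)
    (h : ∀ v, Relation.ReflTransGen (edgeRel E) x v) : HGConnected E := fun a b =>
  (edgeRel_symm (h a)).trans (h b)

lemma FO_vertex {q k : ℕ} (x : Fin (k + 1)) : FO q {x} (Finset.univ.erase x) = trees q (k + 1) := by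
  ext E
  rw [mem_FO, mem_RE, mem_trees, Finset.card_erase_of_mem (Finset.mem_univ _), Finset.card_univ,
    Fintype.card_fin]
  constructor
  · rintro ⟨⟨h1, h2⟩, h3⟩
    refine ⟨fun e he => (h1 e he).1, connected_of_root x fun v => ?_, h3⟩
    by_cases hv : v = x
    · rw [hv]
    · obtain ⟨s, hs, hsv⟩ := h2 v (Finset.mem_erase.2 ⟨hv, Finset.mem_univ _⟩)
      rwa [Finset.mem_singleton.1 hs] at hsv
  · rintro ⟨h1, h2, h3⟩
    refine ⟨⟨fun e he => ⟨h1 e he, fun v _ => ?_⟩, fun v _ => ⟨x, by simp, h2 x v⟩⟩, h3⟩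
    by_cases hv : v = x <;> simp [hv]

lemma RS_zero {N : ℕ} (S : Finset (Fin N)) (E : Finset (Finset (Fin N))) (X : Finset (Fin N) → ℝ × ℝ) :
    RS S E (fun _ => (0, 0)) X = 1 := by
  unfold RS
  refine Finset.prod_eq_one fun r _ => Finset.prod_eq_one fun e _ => ?_
  rw [K_zero_left, ite_self]

lemma sum_trees_vertex {q : ℕ} (hq : 2 ≤ q) (k : ℕ) :
    ∑ E ∈ trees q (k + 1), bT E = (k.factorial : ℝ) * treeT q (k + 1) [(0, 0)] := by
  have h := Rsum_eq_treeT hq (k + 1) [(0 : Fin (k + 1))] {0} (Finset.univ.erase 0)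
    (by rw [Finset.card_erase_of_mem (Finset.mem_univ _)]; simp; omega) (by simp) (by simp) (by simp)
    (fun _ => (0, 0))
  rw [Rsum, FO_vertex, Finset.card_erase_of_mem (Finset.mem_univ _), Finset.card_univ,
    Fintype.card_fin] at h
  simp only [RS_zero, mul_one] at h
  exact h

lemma reach_erase {N : ℕ} {T : Finset (Finset (Fin N))} {e : Finset (Fin N)} {a b : Fin N} (ha : a ∈ e)
    (h : Relation.ReflTransGen (edgeRel T) a b) :
    ∃ s ∈ e, Relation.ReflTransGen (edgeRel (T.erase e)) s b := by
  induction h with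
  | refl => exact ⟨a, ha, Relation.ReflTransGen.refl⟩
  | tail _ hbc ih =>
    obtain ⟨s, hs, hsb⟩ := ih
    obtain ⟨f, hf, h1, h2⟩ := hbc
    by_cases hfe : f = e
    · exact ⟨_, hfe ▸ h2, Relation.ReflTransGen.refl⟩
    · exact ⟨s, hs, hsb.tail ⟨f, Finset.mem_erase.2 ⟨hfe, hf⟩, h1, h2⟩⟩

lemma notMem_of_mem_FO_edge {N q : ℕ} (hq : 2 ≤ q) {e : Finset (Fin N)}
    {E : Finset (Finset (Fin N))} (hE : E ∈ FO q e (Finset.univ \ e)) : e ∉ E := by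
  intro he
  obtain ⟨h1, h2⟩ := mem_FO.1 hE
  obtain ⟨h3, h4⟩ := mem_RE.1 h1
  have h5 : E.erase e ∈ RE q e (Finset.univ \ e) := by
    refine mem_RE.2 ⟨fun f hf => h3 f (Finset.mem_of_mem_erase hf), fun v hv => ?_⟩
    obtain ⟨s, hs, hsv⟩ := h4 v hv
    exact reach_erase hs hsv
  have h6 := card_le_of_mem_RE (by omega) _ _ _ rfl Finset.disjoint_sdiff _ h5
  rw [Finset.card_erase_of_mem he, ← h2] at h6
  have h7 : 1 ≤ E.card := Finset.card_pos.2 ⟨e, he⟩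
  have h8 := Nat.le_of_mul_le_mul_left h6 (by omega)
  omega

lemma sum_trees_edge_FO {N q : ℕ} (hq : 2 ≤ q) {e : Finset (Fin N)} (he : e.card = q)
    (f : Finset (Finset (Fin N)) → ℝ) :
    ∑ T ∈ (trees q N).filter (e ∈ ·), f T = ∑ E ∈ FO q e (Finset.univ \ e), f (insert e E) := by
  have hN : q ≤ N := by
    have := Finset.card_le_univ e
    rwa [he, Fintype.card_fin] at this
  have hUc : (Finset.univ \ e).card = N - q := by
    rw [Finset.card_sdiff_of_subset (Finset.subset_univ _), Finset.card_univ, Fintype.card_fin, he]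
  obtain ⟨x, hx⟩ : e.Nonempty := Finset.card_pos.1 (by omega)
  refine Finset.sum_bij' (fun T _ => T.erase e) (fun E _ => insert e E) ?_ ?_ ?_ ?_ ?_
  · intro T hT
    obtain ⟨hT, heT⟩ := Finset.mem_filter.1 hT
    obtain ⟨h1, h2, h3⟩ := mem_trees.1 hT
    refine mem_FO.2 ⟨mem_RE.2 ⟨fun f hf => ⟨h1 f (Finset.mem_of_mem_erase hf), fun v _ => ?_⟩,
      fun v _ => reach_erase hx (h2 x v)⟩, ?_⟩
    · by_cases hv : v ∈ e <;> simp [hv]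
    · rw [Finset.card_erase_of_mem heT, hUc, Nat.mul_sub, h3]
      omega
  · intro E hE
    have hne := notMem_of_mem_FO_edge hq hE
    obtain ⟨h1, h2⟩ := mem_FO.1 hE
    obtain ⟨h3, h4⟩ := mem_RE.1 h1
    refine Finset.mem_filter.2 ⟨mem_trees.2 ⟨?_, connected_of_root x fun v => ?_, ?_⟩,
      Finset.mem_insert_self _ _⟩
    · intro f hf
      rcases Finset.mem_insert.1 hf with rfl | hf
      · exact he
      · exact (h3 f hf).1
    · by_cases hv : v ∈ e
      · exact Relation.ReflTransGen.single ⟨e, Finset.mem_insert_self _ _, hx, hv⟩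
      · obtain ⟨s, hs, hsv⟩ := h4 v (Finset.mem_sdiff.2 ⟨Finset.mem_univ _, hv⟩)
        exact (Relation.ReflTransGen.single ⟨e, Finset.mem_insert_self _ _, hx, hs⟩).trans
          (edgeRel_mono (Finset.subset_insert _ _) hsv)
    · rw [Finset.card_insert_of_notMem hne, mul_add, h2, hUc]
      omega
  · intro T hT
    exact Finset.insert_erase (Finset.mem_filter.1 hT).2
  · intro E hE
    exact Finset.erase_insert (notMem_of_mem_FO_edge hq hE)
  · intro T hT
    rw [Finset.insert_erase (Finset.mem_filter.1 hT).2]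

lemma BE_insert {N : ℕ} {e : Finset (Fin N)} {E : Finset (Finset (Fin N))} (he : e ∉ E)
    (X : Finset (Fin N) → ℝ × ℝ) : BE (insert e E) X = BE E X * RS e E (fun _ => X e) X := by
  have h1 : BE {e} X = 1 := by
    unfold BE
    refine Finset.prod_eq_one fun p hp => ?_
    induction p using Sym2.ind with
    | _ a b =>
      rw [Finset.mem_filter, Finset.mk_mem_sym2_iff, Sym2.mk_isDiag_iff, Finset.mem_singleton,
        Finset.mem_singleton] at hp
      exact absurd (hp.1.1.trans hp.1.2.symm) hp.2
  rw [Finset.insert_eq, BE_union (Finset.disjoint_singleton_left.2 he), h1, one_mul,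
    Finset.prod_singleton, mul_comm, RS, Finset.prod_comm]
  congr 1
  refine Finset.prod_congr rfl fun f _ => ?_
  rw [pairSign_eq_prod_inter, ← Finset.prod_filter, Finset.filter_mem_eq_inter]

lemma measurable_treeT_replicate (q k j : ℕ) : Measurable fun y : ℝ × ℝ => treeT q k (List.replicate j y) := by
  have := measurable_treeT q k (α := ℝ × ℝ) (List.replicate j fun y => y) (by
    intro f hf
    rw [List.eq_of_mem_replicate hf]
    exact measurable_id)
  simpa using this

lemma measurable_sign {N : ℕ} {α : Type*} [MeasurableSpace α] (y : α → Fin N → ℝ × ℝ)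
    (X : α → Finset (Fin N) → ℝ × ℝ) (hy : ∀ v, Measurable fun a => y a v)
    (hX : ∀ e, Measurable fun a => X a e) (S : Finset (Fin N)) (E : Finset (Finset (Fin N))) :
    Measurable fun a => BE E (X a) * RS S E (y a) (X a) :=
  (measurable_BE hX E).mul (measurable_RS hy hX S E)

lemma sum_trees_edge {N q : ℕ} (hq : 2 ≤ q) {e : Finset (Fin N)} (he : e.card = q) :
    ∑ T ∈ (trees q N).filter (e ∈ ·), bT T =
      ((N - q).factorial : ℝ) * ∫ y, treeT q N (List.replicate q y) ∂nu := by
  have hUc : (Finset.univ \ e).card = N - q := by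
    rw [Finset.card_sdiff_of_subset (Finset.subset_univ _), Finset.card_univ, Fintype.card_fin, he]
  have hN : q ≤ N := by
    have := Finset.card_le_univ e
    rwa [he, Fintype.card_fin] at this
  have hmX : ∀ e : Finset (Fin N), Measurable fun X : Finset (Fin N) → ℝ × ℝ => X e :=
    fun e => measurable_pi_apply e
  have hb : ∀ (E : Finset (Finset (Fin N))) S y X, |BE E X * RS S E y X| ≤ 1 := fun E S y X => by
    rw [abs_mul, abs_BE, abs_RS, one_mul]
  have hm : ∀ E : Finset (Finset (Fin N)),
      Measurable fun X : Finset (Fin N) → ℝ × ℝ => BE E X * RS e E (fun _ => X e) X := by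
    intro E
    exact measurable_sign (N := N) (α := Finset (Fin N) → ℝ × ℝ) (fun X _ => X e) (fun X => X)
      (fun _ => hmX e) hmX e E
  rw [sum_trees_edge_FO hq he]
  have h1 : ∑ E ∈ FO q e (Finset.univ \ e), bT (insert e E) =
      ∫ X, ∑ E ∈ FO q e (Finset.univ \ e), BE E X * RS e E (fun _ => X e) X ∂nuPi (Finset (Fin N)) := by
    rw [integral_finsetSum]
    · refine Finset.sum_congr rfl fun E hE => ?_
      unfold bT
      exact integral_congr_ae (Eventually.of_forall fun X => BE_insert (notMem_of_mem_FO_edge hq hE) X)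
    · intro E _
      exact Integrable.of_bound (hm E).aestronglyMeasurable 1 (Eventually.of_forall fun X => hb _ _ _ X)
  rw [h1, integral_splice {e} (Finset.measurable_sum _ fun E _ => hm E)
    (C := ∑ _E ∈ FO q e (Finset.univ \ e), (1 : ℝ))]
  swap
  · exact fun X => (Finset.abs_sum_le_sum_abs _ _).trans (Finset.sum_le_sum fun E _ => hb _ _ _ _)
  have h2 : ∀ X : Finset (Fin N) → ℝ × ℝ, ∫ X', ∑ E ∈ FO q e (Finset.univ \ e),
      BE E (splice {e} X X') * RS e E (fun _ => splice {e} X X' e) (splice {e} X X')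
        ∂nuPi (Finset (Fin N)) =
      ((N - q).factorial : ℝ) * treeT q N (List.replicate q (X e)) := by
    intro X
    have h3 := Rsum_eq_treeT hq N e.toList e (Finset.univ \ e) (by omega) (Finset.nodup_toList e)
      (Finset.toList_toFinset e) Finset.disjoint_sdiff (fun _ => X e)
    rw [hUc, List.map_const', Finset.length_toList, he] at h3
    rw [← h3, Rsum, ← integral_finsetSum]
    · refine integral_congr_ae (Eventually.of_forall fun X' => Finset.sum_congr rfl fun E hE => ?_)
      have hne := notMem_of_mem_FO_edge hq hE
      have hXE : ∀ f ∈ E, splice {e} X X' f = X' f := fun f hf =>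
        splice_of_notMem fun h => hne (Finset.mem_singleton.1 h ▸ hf)
      rw [BE_congr hXE, RS_congr (y' := fun _ => X e) (fun _ _ => splice_of_mem (by simp)) hXE]
    · intro E _
      exact Integrable.of_bound (measurable_sign (N := N) (α := Finset (Fin N) → ℝ × ℝ) (fun _ _ => X e) (fun X => X)
        (fun _ => measurable_const) hmX e E).aestronglyMeasurable 1
          (Eventually.of_forall fun X' => hb _ _ _ X')
  simp_rw [h2]
  rw [integral_const_mul]
  congr 1
  have hmp := measurePreserving_eval (fun _ : Finset (Fin N) => nu) e
  rw [← hmp.map_eq, integral_map hmp.measurable.aemeasurable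
    (measurable_treeT_replicate q N q).aestronglyMeasurable]

lemma sum_trees_card {N q : ℕ} (hq : 2 ≤ q) :
    ∑ T ∈ trees q N, (T.card : ℝ) * bT T =
      (N.factorial : ℝ) / q.factorial * ∫ y, treeT q N (List.replicate q y) ∂nu := by
  have h1 : ∑ T ∈ trees q N, (T.card : ℝ) * bT T =
      ∑ e ∈ (Finset.univ : Finset (Fin N)).powersetCard q, ∑ T ∈ (trees q N).filter (e ∈ ·), bT T := by
    simp_rw [Finset.sum_filter]
    rw [Finset.sum_comm]
    refine Finset.sum_congr rfl fun T hT => ?_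
    rw [← Finset.sum_filter, Finset.sum_const, nsmul_eq_mul]
    congr 3
    ext e
    rw [Finset.mem_filter, Finset.mem_powersetCard]
    exact ⟨fun h => ⟨⟨Finset.subset_univ _, (mem_trees.1 hT).1 e h⟩, h⟩, fun h => h.2⟩
  rw [h1, Finset.sum_congr rfl fun e he => sum_trees_edge hq (Finset.mem_powersetCard.1 he).2,
    Finset.sum_const, nsmul_eq_mul, Finset.card_powersetCard, Finset.card_univ, Fintype.card_fin]
  by_cases hN : q ≤ N
  · rw [Nat.cast_choose ℝ hN]
    field_simp
  · have : ∀ y : ℝ × ℝ, treeT q N (List.replicate q y) = 0 := fun y =>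
      treeT_eq_zero _ _ _ (by rw [List.length_replicate]; omega)
    simp [this]

/-- The dissymmetry identity for signed hypertrees. -/
theorem treeT_dissymmetry {q : ℕ} (hq : 2 ≤ q) (k : ℕ) :
    treeT q (k + 1) [(0, 0)] - ((q : ℝ) - 1) * ((q.factorial : ℝ)⁻¹ *
      ∫ y, treeT q (k + 1) (List.replicate q y) ∂nu) =
      ((k + 1).factorial : ℝ)⁻¹ * ∑ T ∈ trees q (k + 1), bT T := by
  have h1 := sum_trees_vertex hq k
  have h2 := sum_trees_card (N := k + 1) hq
  have h3 : ((q : ℝ) - 1) * ∑ T ∈ trees q (k + 1), (T.card : ℝ) * bT T =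
      k * ∑ T ∈ trees q (k + 1), bT T := by
    rw [Finset.mul_sum, Finset.mul_sum]
    refine Finset.sum_congr rfl fun T hT => ?_
    have h4 := (mem_trees.1 hT).2.2
    have h5 : ((q : ℝ) - 1) * T.card = k := by
      have : (((q - 1) * T.card : ℕ) : ℝ) = k := by exact_mod_cast h4
      rw [← this, Nat.cast_mul, Nat.cast_sub (by omega), Nat.cast_one]
    rw [← mul_assoc, h5]
  rw [h2] at h3
  rw [Nat.factorial_succ] at h3 ⊢
  push_cast at h3 ⊢
  have hk : (k.factorial : ℝ) ≠ 0 := by positivity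
  have hk1 : (k : ℝ) + 1 ≠ 0 := by positivity
  have hqf : (q.factorial : ℝ) ≠ 0 := by positivity
  rw [h1] at h3 ⊢
  field_simp at h3 ⊢
  linear_combination -h3

lemma norm_le_of_mem_De {z : ℂ} (hz : z ∈ De) : ‖z‖ ≤ Real.exp (-2) := by
  simpa [De] using hz

lemma norm_mul_exp_le {z : ℂ} (hz : z ∈ De) : ‖z‖ * Real.exp 1 ≤ 1 / 2 := by
  have h1 := norm_le_of_mem_De hz
  have h2 : Real.exp (-2) * Real.exp 1 = (Real.exp 1)⁻¹ := by
    rw [← Real.exp_add, ← Real.exp_neg]; norm_num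
  have h3 : (2 : ℝ) ≤ Real.exp 1 := by
    have := Real.add_one_le_exp (1 : ℝ); linarith
  calc ‖z‖ * Real.exp 1 ≤ Real.exp (-2) * Real.exp 1 := by gcongr
    _ = (Real.exp 1)⁻¹ := h2
    _ ≤ 1 / 2 := by rw [one_div]; exact inv_anti₀ two_pos h3

lemma aestronglyMeasurable_of_memF {H : ℂ → ℝ × ℝ → ℂ} (hH : memF H) {z : ℂ} (hz : z ∈ De) :
    AEStronglyMeasurable (H z) nu := by
  have hc : ContinuousOn (H z) Omega := by
    have h1 : ContinuousOn (fun x : ℝ × ℝ => ((z, x) : ℂ × (ℝ × ℝ))) Omega := by fun_prop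
    exact hH.1.comp h1 fun x hx => ⟨hz, hx⟩
  have h2 := hc.aestronglyMeasurable (μ := nu) measurableSet_Omega
  have h3 : nu.restrict Omega = nu := by
    rw [Measure.restrict_eq_self_of_ae_mem ae_mem_Omega]
  rwa [h3] at h2

lemma aestronglyMeasurable_prod_pow {H : ℂ → ℝ × ℝ → ℂ} (hH : memF H) {z : ℂ} (hz : z ∈ De) (d j : ℕ) :
    AEStronglyMeasurable (fun y : Fin d → ℝ × ℝ => ∏ i, H z (y i) ^ j) (nuPi (Fin d)) := by
  refine Finset.aestronglyMeasurable_fun_prod _ fun i _ => ?_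
  have h1 := (aestronglyMeasurable_of_memF hH hz).comp_quasiMeasurePreserving
    (measurePreserving_eval (fun _ : Fin d => nu) i).quasiMeasurePreserving
  exact h1.pow j

lemma prod_map_rep (H : ℂ → ℝ × ℝ → ℂ) (z : ℂ) (q d : ℕ) (y : Fin d → ℝ × ℝ) (L : List (ℝ × ℝ)) :
    ((rep q d y ++ L).map (H z)).prod = (∏ i, H z (y i) ^ (q - 1)) * (L.map (H z)).prod := by
  rw [List.map_append, List.prod_append]
  congr 1
  rw [rep, List.map_flatMap, ← List.prod_ofFn]
  generalize hM : List.ofFn y = M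
  have : (List.ofFn fun i => H z (y i) ^ (q - 1)) = M.map fun a => H z a ^ (q - 1) := by
    rw [← hM, List.map_ofFn]; rfl
  rw [this]
  clear this hM
  induction M with
  | nil => simp
  | cons a M ih => rw [List.flatMap_cons, List.prod_append, ih]; simp

/-- Partial sums of the generating series of `treeT`. -/
def treeSum (q : ℕ) (z : ℂ) (k : ℕ) (L : List (ℝ × ℝ)) : ℂ :=
  ∑ j ∈ Finset.range k, z ^ j * (treeT q j L : ℂ)

lemma measurable_treeT_rep (q k d : ℕ) (L : List (ℝ × ℝ)) :
    Measurable fun y : Fin d → ℝ × ℝ => treeT q k (rep q d y ++ L) := by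
  have := measurable_treeT q k (α := Fin d → ℝ × ℝ)
    ((List.ofFn fun (i : Fin d) (z : Fin d → ℝ × ℝ) => z i).flatMap
      (fun f => List.replicate (q - 1) f) ++ L.map fun c _ => c) (by
      intro f hf
      rcases List.mem_append.1 hf with h | h
      · obtain ⟨g, hg, hfg⟩ := List.mem_flatMap.1 h
        rw [List.eq_of_mem_replicate hfg]
        rw [List.mem_ofFn] at hg
        obtain ⟨i, rfl⟩ := hg
        exact measurable_pi_apply i
      · obtain ⟨c, _, rfl⟩ := List.mem_map.1 h
        exact measurable_const)
  convert this using 3 with z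
  rw [List.map_append, rep, List.map_flatMap, List.map_map]
  congr 1
  · have : List.ofFn z = (List.ofFn fun (i : Fin d) (z : Fin d → ℝ × ℝ) => z i).map
        fun f => f z := by rw [List.map_ofFn]; rfl
    rw [this, List.flatMap_map]
    simp
  · simp [Function.comp_def]

/-- The weight of `d` children in the recursion. -/
def childInt (q : ℕ) (x : ℝ × ℝ) (d : ℕ) (F : List (ℝ × ℝ) → ℂ) (L : List (ℝ × ℝ)) : ℂ :=
  (((d.factorial : ℝ) * ((q - 1).factorial : ℝ) ^ d)⁻¹ : ℝ) *
    ∫ y : Fin d → ℝ × ℝ, (((∏ i, K x (y i)) * pairProd d y : ℝ) : ℂ) * F (rep q d y ++ L) ∂nuPi (Fin d)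

lemma measurable_childKernel (x : ℝ × ℝ) (d : ℕ) :
    Measurable fun y : Fin d → ℝ × ℝ => (((∏ i, K x (y i)) * pairProd d y : ℝ) : ℂ) :=
  Complex.measurable_ofReal.comp ((Finset.measurable_prod _ fun i _ => measurable_K measurable_const
    (measurable_pi_apply i)).mul (measurable_pairProd _))

lemma norm_childKernel (x : ℝ × ℝ) (d : ℕ) (y : Fin d → ℝ × ℝ) :
    ‖(((∏ i, K x (y i)) * pairProd d y : ℝ) : ℂ)‖ = 1 := by
  rw [Complex.norm_real, Real.norm_eq_abs, abs_mul, abs_prod_K, abs_pairProd, one_mul]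

lemma integrable_childTree (q : ℕ) (x : ℝ × ℝ) (d j : ℕ) (L : List (ℝ × ℝ)) :
    Integrable (fun y : Fin d → ℝ × ℝ => (((∏ i, K x (y i)) * pairProd d y : ℝ) : ℂ) *
      (treeT q j (rep q d y ++ L) : ℂ)) (nuPi (Fin d)) := by
  refine Integrable.of_bound ((measurable_childKernel x d).mul
    (Complex.measurable_ofReal.comp (measurable_treeT_rep q j d L))).aestronglyMeasurable
    (Real.exp 1 ^ j) (Eventually.of_forall fun y => ?_)
  rw [norm_mul, norm_childKernel, one_mul, Complex.norm_real]
  exact abs_treeT_le _ _ _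

lemma childInt_treeSum_eq (q : ℕ) (z : ℂ) (k : ℕ) (x : ℝ × ℝ) (d : ℕ) (L : List (ℝ × ℝ)) :
    childInt q x d (treeSum q z k) L = ∑ j ∈ Finset.range k, z ^ j *
      childInt q x d (fun M => (treeT q j M : ℂ)) L := by
  unfold childInt treeSum
  simp_rw [Finset.mul_sum]
  rw [integral_finsetSum, Finset.mul_sum]
  · refine Finset.sum_congr rfl fun j _ => ?_
    rw [mul_left_comm, ← integral_const_mul (z ^ j)]
    congr 2
    funext y
    ring
  · intro j _
    have := (integrable_childTree q x d j L).const_mul (z ^ j)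
    refine this.congr (Eventually.of_forall fun y => ?_)
    simp only
    ring

lemma childInt_treeT_zero {q : ℕ} (hq : 2 ≤ q) {j d : ℕ} (h : j < d) (x : ℝ × ℝ) (L : List (ℝ × ℝ)) :
    childInt q x d (fun M => (treeT q j M : ℂ)) L = 0 := by
  have : ∀ y : Fin d → ℝ × ℝ, treeT q j (rep q d y ++ L) = 0 := fun y => by
    apply treeT_eq_zero
    rw [List.length_append, length_rep]
    have : d ≤ d * (q - 1) := Nat.le_mul_of_pos_right _ (by omega)
    omega
  simp [childInt, this]

lemma treeSum_succ {q : ℕ} (hq : 2 ≤ q) (z : ℂ) (k : ℕ) (x : ℝ × ℝ) (L : List (ℝ × ℝ)) :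
    HasSum (fun d => z * childInt q x d (treeSum q z k) L) (treeSum q z (k + 1) (x :: L)) := by
  have h1 : treeSum q z (k + 1) (x :: L) =
      ∑ d ∈ Finset.range k, z * childInt q x d (treeSum q z k) L := by
    simp_rw [childInt_treeSum_eq, Finset.mul_sum]
    rw [Finset.sum_comm, treeSum, Finset.sum_range_succ']
    simp only [treeT, Complex.ofReal_zero, mul_zero, add_zero]
    refine Finset.sum_congr rfl fun j hj => ?_
    rw [← Finset.sum_subset (Finset.range_subset_range.2 (Finset.mem_range.1 hj) : Finset.range (j + 1) ⊆ _)]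
    · rw [Complex.ofReal_sum, Finset.mul_sum]
      refine Finset.sum_congr rfl fun d _ => ?_
      rw [childInt, Complex.ofReal_mul, ← integral_complex_ofReal, pow_succ']
      simp only [Complex.ofReal_mul]
      ring
    · intro d _ hd
      rw [childInt_treeT_zero hq (by simpa using hd), mul_zero, mul_zero]
  rw [h1]
  refine hasSum_sum_of_ne_finset_zero fun d hd => ?_
  rw [childInt_treeSum_eq, Finset.sum_eq_zero, mul_zero]
  intro j hj
  rw [childInt_treeT_zero hq, mul_zero]
  exact (Finset.mem_range.1 hj).trans_le (by simpa using hd)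

lemma norm_childInt_le (q : ℕ) (x : ℝ × ℝ) (d : ℕ) {F : List (ℝ × ℝ) → ℂ} {L : List (ℝ × ℝ)}
    {C : ℝ} (hC : ∀ y : Fin d → ℝ × ℝ, (∀ i, y i ∈ Omega) → ‖F (rep q d y ++ L)‖ ≤ C) :
    ‖childInt q x d F L‖ ≤ (d.factorial : ℝ)⁻¹ * C := by
  have h1 : ‖∫ y : Fin d → ℝ × ℝ, (((∏ i, K x (y i)) * pairProd d y : ℝ) : ℂ) * F (rep q d y ++ L)
      ∂nuPi (Fin d)‖ ≤ C := by
    have := norm_integral_le_of_norm_le_const (μ := nuPi (Fin d)) (C := C)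
      (f := fun y => (((∏ i, K x (y i)) * pairProd d y : ℝ) : ℂ) * F (rep q d y ++ L)) (by
        filter_upwards [ae_pi_mem_Omega (Fin d)] with y hy
        rw [norm_mul, norm_childKernel, one_mul]
        exact hC y hy)
    simpa using this
  have hC0 : 0 ≤ C := (norm_nonneg _).trans h1
  rw [childInt, norm_mul, Complex.norm_real, Real.norm_of_nonneg (by positivity)]
  have h2 : ((d.factorial : ℝ) * ((q - 1).factorial : ℝ) ^ d)⁻¹ ≤ (d.factorial : ℝ)⁻¹ := by
    refine inv_anti₀ (by positivity) (le_mul_of_one_le_right (by positivity) (one_le_pow₀ ?_))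
    exact_mod_cast Nat.one_le_iff_ne_zero.2 (Nat.factorial_ne_zero _)
  exact mul_le_mul h2 h1 (norm_nonneg _) (by positivity)

lemma norm_prod_map_le {H : ℂ → ℝ × ℝ → ℂ} (hH : memF H) {z : ℂ} (hz : z ∈ De) (L : List (ℝ × ℝ))
    (hL : ∀ x ∈ L, x ∈ Omega) : ‖(L.map (H z)).prod‖ ≤ 1 := by
  induction L with
  | nil => simp
  | cons a L ih =>
    rw [List.map_cons, List.prod_cons, norm_mul]
    exact mul_le_one₀ (hH.2 z hz a (hL a (by simp))) (norm_nonneg _)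
      (ih fun x hx => hL x (List.mem_cons_of_mem _ hx))

lemma mem_rep_append {q d : ℕ} {y : Fin d → ℝ × ℝ} (hy : ∀ i, y i ∈ Omega) {L : List (ℝ × ℝ)}
    (hL : ∀ x ∈ L, x ∈ Omega) : ∀ x ∈ rep q d y ++ L, x ∈ Omega := by
  intro x hx
  rcases List.mem_append.1 hx with h | h
  · obtain ⟨a, ha, hxa⟩ := List.mem_flatMap.1 h
    rw [List.mem_ofFn] at ha
    obtain ⟨i, rfl⟩ := ha
    rw [List.eq_of_mem_replicate hxa]
    exact hy i
  · exact hL x h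

lemma hasSum_inv_factorial (C : ℝ) : HasSum (fun d : ℕ => (d.factorial : ℝ)⁻¹ * C) (Real.exp 1 * C) := by
  have := (NormedSpace.expSeries_div_hasSum_exp (1 : ℝ)).mul_right C
  rw [← congrFun Real.exp_eq_exp_ℝ] at this
  simpa using this

/-- The fixed point equation multiplied by a product over a list. -/
lemma hasSum_ccg {q : ℕ} {H : ℂ → ℝ × ℝ → ℂ} (hH : IsCCG q H) {z : ℂ} (hz : z ∈ De) {x : ℝ × ℝ}
    (hx : x ∈ Omega) (L : List (ℝ × ℝ)) :
    HasSum (fun d => z * childInt q x d (fun M => (M.map (H z)).prod) L) ((x :: L).map (H z)).prod := by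
  have hT : ∀ d, childInt q x d (fun M => (M.map (H z)).prod) L =
      Tterm q H z x d * (L.map (H z)).prod := by
    intro d
    rw [childInt, Tterm, Complex.ofReal_inv, Complex.ofReal_mul, mul_inv, mul_assoc, mul_assoc,
      ← integral_mul_const]
    rw [← integral_const_mul]
    push_cast
    congr 2
    funext y
    rw [prod_map_rep]
    have : ∏ i, ((K x (y i) : ℂ) * H z (y i) ^ (q - 1) / ((q - 1).factorial : ℂ)) =
        (∏ i, (K x (y i) : ℂ)) * (∏ i, H z (y i) ^ (q - 1)) * (((q - 1).factorial : ℂ) ^ d)⁻¹ := by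
      simp_rw [div_eq_mul_inv, Finset.prod_mul_distrib]
      simp
    rw [this]
    ring
  have hs : Summable fun d => Tterm q H z x d := by
    refine Summable.of_norm_bounded (hasSum_inv_factorial 1).summable fun d => ?_
    have h1 := hT d
    have : childInt q x d (fun M => (M.map (H z)).prod) [] = Tterm q H z x d := by
      rw [childInt, Tterm, Complex.ofReal_inv, Complex.ofReal_mul, mul_inv, mul_assoc,
        ← integral_const_mul]
      push_cast
      congr 2
      funext y
      rw [prod_map_rep]
      have : ∏ i, ((K x (y i) : ℂ) * H z (y i) ^ (q - 1) / ((q - 1).factorial : ℂ)) =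
          (∏ i, (K x (y i) : ℂ)) * (∏ i, H z (y i) ^ (q - 1)) * (((q - 1).factorial : ℂ) ^ d)⁻¹ := by
        simp_rw [div_eq_mul_inv, Finset.prod_mul_distrib]
        simp
      rw [this]
      simp
      ring
    rw [← this]
    refine norm_childInt_le q x d fun y hy => ?_
    exact norm_prod_map_le hH.1 hz _ (mem_rep_append hy (by simp))
  have h0 : Tterm q H z x 0 = 1 := by
    simp [Tterm, pairProd]
  have h2 : HasSum (fun d => Tterm q H z x d) (1 + ∑' d, Tterm q H z x (d + 1)) := by
    rw [← h0, ← hs.tsum_eq_zero_add]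
    exact hs.hasSum
  have h3 := (h2.mul_left z).mul_right ((L.map (H z)).prod)
  rw [List.map_cons, List.prod_cons, hH.2 z hz x hx, Tcal]
  simp_rw [hT]
  have e1 : (fun d => z * (Tterm q H z x d * (L.map (H z)).prod)) =
      fun d => z * Tterm q H z x d * (L.map (H z)).prod := by funext d; ring
  have e2 : (z + z * ∑' d, Tterm q H z x (d + 1)) * (L.map (H z)).prod =
      z * (1 + ∑' d, Tterm q H z x (d + 1)) * (L.map (H z)).prod := by ring
  rw [e1, e2]
  exact h3

lemma norm_prod_sub_treeSum {q : ℕ} (hq : 2 ≤ q) {H : ℂ → ℝ × ℝ → ℂ} (hH : IsCCG q H) {z : ℂ}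
    (hz : z ∈ De) : ∀ (k : ℕ) (L : List (ℝ × ℝ)), (∀ x ∈ L, x ∈ Omega) →
    ‖(L.map (H z)).prod - treeSum q z k L‖ ≤ (1 / 2) ^ k := by
  intro k
  induction k with
  | zero =>
    intro L hL
    simpa [treeSum] using norm_prod_map_le hH.1 hz L hL
  | succ k ih =>
    intro L hL
    cases L with
    | nil =>
      rw [treeSum, Finset.sum_range_succ']
      simp [treeT]
    | cons x L =>
      have hx := hL x (by simp)
      have hL' : ∀ x ∈ L, x ∈ Omega := fun y hy => hL y (List.mem_cons_of_mem _ hy)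
      have h1 := (hasSum_ccg hH hz hx L).sub (treeSum_succ hq z k x L)
      have h2 : ∀ d, childInt q x d (fun M => (M.map (H z)).prod) L - childInt q x d (treeSum q z k) L =
          childInt q x d (fun M => (M.map (H z)).prod - treeSum q z k M) L := by
        intro d
        unfold childInt
        rw [← mul_sub, ← integral_sub]
        · simp_rw [mul_sub]
        · simp_rw [prod_map_rep]
          refine Integrable.of_bound ((measurable_childKernel x d).aestronglyMeasurable.mul
            ((aestronglyMeasurable_prod_pow hH.1 hz d (q - 1)).mul_const _)) 1 ?_
          filter_upwards [ae_pi_mem_Omega (Fin d)] with y hy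
          rw [norm_mul, norm_childKernel, one_mul, ← prod_map_rep]
          exact norm_prod_map_le hH.1 hz _ (mem_rep_append hy hL')
        · unfold treeSum
          simp_rw [Finset.mul_sum]
          refine integrable_finsetSum _ fun j _ => ?_
          refine ((integrable_childTree q x d j L).const_mul (z ^ j)).congr
            (Eventually.of_forall fun y => ?_)
          simp only
          ring
      have h3 : ∀ d, ‖z * childInt q x d (fun M => (M.map (H z)).prod) L -
          z * childInt q x d (treeSum q z k) L‖ ≤ ‖z‖ * ((d.factorial : ℝ)⁻¹ * (1 / 2) ^ k) := by
        intro d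
        rw [← mul_sub, h2, norm_mul]
        gcongr
        exact norm_childInt_le q x d fun y hy => ih _ (mem_rep_append hy hL')
      have h4 := (hasSum_inv_factorial ((1 / 2) ^ k)).mul_left ‖z‖
      rw [← h1.tsum_eq]
      refine (tsum_of_norm_bounded h4 h3).trans ?_
      rw [← mul_assoc, pow_succ']
      gcongr
      exact norm_mul_exp_le hz

/-- Products of the CCG are generating functions of rooted signed hyperforests. -/
lemma hasSum_treeT {q : ℕ} (hq : 2 ≤ q) {H : ℂ → ℝ × ℝ → ℂ} (hH : IsCCG q H) {z : ℂ}
    (hz : z ∈ De) (L : List (ℝ × ℝ)) (hL : ∀ x ∈ L, x ∈ Omega) :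
    HasSum (fun k => z ^ k * (treeT q k L : ℂ)) (L.map (H z)).prod := by
  have hs : Summable fun k => z ^ k * (treeT q k L : ℂ) := by
    refine Summable.of_norm_bounded summable_geometric_two fun k => ?_
    rw [norm_mul, norm_pow, Complex.norm_real, Real.norm_eq_abs]
    calc ‖z‖ ^ k * |treeT q k L| ≤ ‖z‖ ^ k * Real.exp 1 ^ k := by
          gcongr; exact abs_treeT_le _ _ _
      _ = (‖z‖ * Real.exp 1) ^ k := (mul_pow _ _ _).symm
      _ ≤ (1 / 2) ^ k := by gcongr; exact norm_mul_exp_le hz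
  have h1 : Tendsto (fun k => (L.map (H z)).prod - treeSum q z k L) atTop (nhds 0) :=
    squeeze_zero_norm (fun k => norm_prod_sub_treeSum hq hH hz k L hL)
      (tendsto_pow_atTop_nhds_zero_of_lt_one (by norm_num) (by norm_num))
  have h2 : Tendsto (fun k => treeSum q z k L) atTop (nhds (L.map (H z)).prod) := by
    have := h1.const_sub (L.map (H z)).prod
    simpa using this
  have h3 := tendsto_nhds_unique h2 hs.hasSum.tendsto_sum_nat
  rw [h3]
  exact hs.hasSum

lemma zero_mem_Omega : ((0 : ℝ), (0 : ℝ)) ∈ Omega := by simp [Omega]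

lemma Rcal_eq {q : ℕ} {H : ℂ → ℝ × ℝ → ℂ} (hH : IsCCG q H) {z : ℂ} (hz : z ∈ De) :
    Rcal q H z = H z (0, 0) := by
  rw [hH.2 z hz _ zero_mem_Omega, Rcal, Tcal]
  congr 3
  funext d
  simp [Rterm, Tterm, K_zero_left]

lemma hasSum_Ecal {q : ℕ} (hq : 2 ≤ q) {H : ℂ → ℝ × ℝ → ℂ} (hH : IsCCG q H) {z : ℂ}
    (hz : z ∈ De) : HasSum (fun k => z ^ k * (((q.factorial : ℝ)⁻¹ *
      ∫ y, treeT q k (List.replicate q y) ∂nu : ℝ) : ℂ)) (Ecal q H z) := by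
  have hF : ∀ k (y : ℝ × ℝ), ‖z ^ k * (treeT q k (List.replicate q y) : ℂ)‖ ≤ (1 / 2) ^ k := by
    intro k y
    rw [norm_mul, norm_pow, Complex.norm_real, Real.norm_eq_abs]
    calc ‖z‖ ^ k * |treeT q k (List.replicate q y)| ≤ ‖z‖ ^ k * Real.exp 1 ^ k := by
          gcongr; exact abs_treeT_le _ _ _
      _ = (‖z‖ * Real.exp 1) ^ k := (mul_pow _ _ _).symm
      _ ≤ (1 / 2) ^ k := by gcongr; exact norm_mul_exp_le hz
  have hi : ∀ k, Integrable (fun y : ℝ × ℝ => z ^ k * (treeT q k (List.replicate q y) : ℂ)) nu :=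
    fun k => Integrable.of_bound ((Complex.measurable_ofReal.comp
      (measurable_treeT_replicate q k q)).const_mul _).aestronglyMeasurable _
        (Eventually.of_forall (hF k))
  have h1 := hasSum_integral_of_summable_integral_norm hi (by
    refine Summable.of_nonneg_of_le (fun k => integral_nonneg fun _ => norm_nonneg _) (fun k => ?_)
      summable_geometric_two
    have := norm_integral_le_of_norm_le_const (μ := nu)
      (f := fun y => ‖z ^ k * (treeT q k (List.replicate q y) : ℂ)‖) (C := (1 / 2) ^ k)
      (Eventually.of_forall fun y => by rw [norm_norm]; exact hF k y)
    refine (le_abs_self _).trans ?_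
    simpa using this)
  have h2 : ∫ y, ∑' k, z ^ k * (treeT q k (List.replicate q y) : ℂ) ∂nu = ∫ y, H z y ^ q ∂nu := by
    refine integral_congr_ae ?_
    filter_upwards [ae_mem_Omega] with y hy
    have := hasSum_treeT hq hH hz (List.replicate q y) (by
      intro x hx; rw [List.eq_of_mem_replicate hx]; exact hy)
    rw [this.tsum_eq]
    simp
  rw [h2] at h1
  have h3 := h1.mul_left ((q.factorial : ℂ)⁻¹)
  have e : (fun k => z ^ k * (((q.factorial : ℝ)⁻¹ *
      ∫ y, treeT q k (List.replicate q y) ∂nu : ℝ) : ℂ)) = fun k => (q.factorial : ℂ)⁻¹ *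
      ∫ y, z ^ k * (treeT q k (List.replicate q y) : ℂ) ∂nu := by
    funext k
    rw [integral_const_mul, integral_complex_ofReal]
    push_cast
    ring
  rw [e]
  exact h3

/-- `ℱ` is the generating function of the tree coefficients. -/
theorem Fcal_eq_PhiR {q : ℕ} (hq : 2 ≤ q) {H : ℂ → ℝ × ℝ → ℂ} (hH : IsCCG q H) {β t : ℝ}
    (hρ : rho q β ≠ 0) (ht : |rho q β * t| ≤ Real.exp (-2)) :
    Fcal q β H (t : ℂ) = (PhiR q β t : ℂ) := by
  set ρ := rho q β with hρdef
  have hz : (ρ : ℂ) * (t : ℂ) ∈ De := by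
    simp only [De, Metric.mem_closedBall, dist_zero_right]
    rwa [← Complex.ofReal_mul, Complex.norm_real]
  have h1 := hasSum_treeT hq hH hz [(0, 0)] (by simpa using zero_mem_Omega)
  have h2 := (hasSum_Ecal hq hH hz).mul_left ((q : ℂ) - 1)
  have h3 := (h1.sub h2)
  rw [← hasSum_nat_add_iff' 1] at h3
  have h4 : treeT q 0 [((0 : ℝ), (0 : ℝ))] = 0 := treeT_eq_zero _ _ _ (by simp)
  have h5 : ∀ y : ℝ × ℝ, treeT q 0 (List.replicate q y) = 0 := fun y =>
    treeT_eq_zero _ _ _ (by rw [List.length_replicate]; omega)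
  simp only [Finset.range_one, Finset.sum_singleton, h4, h5, integral_zero, mul_zero,
    Complex.ofReal_zero, sub_zero, List.map_cons, List.map_nil, List.prod_singleton] at h3
  have h6 := h3.mul_left ((ρ : ℂ)⁻¹)
  rw [Fcal, Rcal_eq hH hz, ← hρdef, ← h6.tsum_eq, PhiR, Complex.ofReal_tsum]
  refine tsum_congr fun k => ?_
  have h7 := treeT_dissymmetry hq k
  have hρ' : (ρ : ℂ) ≠ 0 := Complex.ofReal_ne_zero.2 hρ
  have h8 : (treeT q (k + 1) [(0, 0)] : ℂ) - ((q : ℂ) - 1) * (((q.factorial : ℝ)⁻¹ *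
      ∫ y, treeT q (k + 1) (List.replicate q y) ∂nu : ℝ) : ℂ) =
      ((((k + 1).factorial : ℝ)⁻¹ * ∑ T ∈ trees q (k + 1), bT T : ℝ) : ℂ) := by
    rw [← h7]; push_cast; ring
  have h9 : ((ρ : ℂ) * t) ^ (k + 1) * (treeT q (k + 1) [(0, 0)] : ℂ) - ((q : ℂ) - 1) *
      (((ρ : ℂ) * t) ^ (k + 1) * (((q.factorial : ℝ)⁻¹ *
        ∫ y, treeT q (k + 1) (List.replicate q y) ∂nu : ℝ) : ℂ)) = ((ρ : ℂ) * t) ^ (k + 1) *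
      ((((k + 1).factorial : ℝ)⁻¹ * ∑ T ∈ trees q (k + 1), bT T : ℝ) : ℂ) := by
    rw [← h8]; ring
  rw [h9, mu, ← hρdef]
  push_cast
  field_simp
  ring

section Words

variable {ι : Type*} {M : ℕ}

/-- The sign produced by sorting a word whose letters commute up to the signs `s`. -/
def wsgn (s : ι → ι → ℝ) (r : ι ≃ Fin M) {k : ℕ} (w : Fin k → ι) : ℝ :=
  ∏ i, ∏ j, if i < j ∧ r (w j) < r (w i) then s (w i) (w j) else 1

lemma wsgn_cons (s : ι → ι → ℝ) (r : ι ≃ Fin M) {k : ℕ} (a : ι) (w : Fin k → ι) :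
    wsgn s r (Fin.cons a w : Fin (k + 1) → ι) =
      (∏ j, if r (w j) < r a then s a (w j) else 1) * wsgn s r w := by
  unfold wsgn
  rw [Fin.prod_univ_succ]
  congr 1
  · rw [Fin.prod_univ_succ]; simp
  · refine Finset.prod_congr rfl fun i _ => ?_
    rw [Fin.prod_univ_succ]; simp

lemma abs_wsgn {s : ι → ι → ℝ} (hs : ∀ e f, |s e f| = 1) (r : ι ≃ Fin M) {k : ℕ} (w : Fin k → ι) :
    |wsgn s r w| = 1 := by
  unfold wsgn
  rw [Finset.abs_prod]
  refine Finset.prod_eq_one fun i _ => ?_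
  rw [Finset.abs_prod]
  refine Finset.prod_eq_one fun j _ => ?_
  split_ifs
  · exact hs _ _
  · simp

lemma wsgn_comp (s : ι → ι → ℝ) (r : ι ≃ Fin M) {φ : ι ≃ ι} (hφ : ∀ e f, s (φ e) (φ f) = s e f)
    {k : ℕ} (w : Fin k → ι) : wsgn s r (fun i => φ (w i)) = wsgn s (φ.trans r) w := by
  refine Finset.prod_congr rfl fun i _ => Finset.prod_congr rfl fun j _ => ?_
  rw [hφ]
  rfl

/-- The number of occurrences of a letter in a word. -/
def wcount {k : ℕ} (w : Fin k → ι) (e : ι) : ℕ := ∑ i, if w i = e then 1 else 0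

lemma wcount_cons {k : ℕ} (a : ι) (w : Fin k → ι) (e : ι) :
    wcount (Fin.cons a w : Fin (k + 1) → ι) e = (if a = e then 1 else 0) + wcount w e := by
  unfold wcount
  rw [Fin.sum_univ_succ]
  simp

lemma prod_eq_prod_pow_wcount [Fintype ι] {k : ℕ} (w : Fin k → ι) (f : ι → ℝ) :
    ∏ i, f (w i) = ∏ e, f e ^ wcount w e := by
  unfold wcount
  simp_rw [← Finset.prod_pow_eq_pow_sum]
  rw [Finset.prod_comm]
  refine Finset.prod_congr rfl fun i _ => ?_
  rw [Finset.prod_eq_single (w i)]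
  · simp
  · intro b _ hb; rw [if_neg (Ne.symm hb), pow_zero]
  · simp

/-- All letters occur an even number of times. -/
def EvenWord {k : ℕ} (w : Fin k → ι) : Prop := ∀ e, Even (wcount w e)

variable {R : Type*} [Ring R]

lemma sum_pow_eq_sum_words [Fintype ι] (x : ι → R) (k : ℕ) :
    (∑ e, x e) ^ k = ∑ w : Fin k → ι, (List.ofFn fun i => x (w i)).prod := by
  induction k with
  | zero => simp
  | succ k ih =>
    rw [pow_succ', ih, Finset.sum_mul_sum, ← (Fin.consEquiv fun _ => ι).sum_comp,
      Fintype.sum_prod_type]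
    refine Finset.sum_congr rfl fun a _ => Finset.sum_congr rfl fun w _ => ?_
    rw [List.ofFn_succ, List.prod_cons]
    simp [Fin.consEquiv]

variable [Algebra ℝ R]

lemma mul_sorted_prod {A : ι → R} {s : ι → ι → ℝ} (hA : ∀ e f, A e * A f = s e f • (A f * A e))
    (r : ι ≃ Fin M) (a : ι) (c : ι → ℕ) : ∀ l : List ι, l.Pairwise (fun e f => r e < r f) → a ∈ l →
    A a * (l.map fun e => A e ^ c e).prod =
      ((l.map fun e => if r e < r a then s a e ^ c e else 1).prod) •
        (l.map fun e => A e ^ ((if a = e then 1 else 0) + c e)).prod := by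
  have hpow : ∀ (f : ι) (k : ℕ), A a * A f ^ k = s a f ^ k • (A f ^ k * A a) := by
    intro f k
    induction k with
    | zero => simp
    | succ k ih =>
      rw [pow_succ, ← mul_assoc, ih, smul_mul_assoc, mul_assoc, hA, mul_smul_comm, smul_smul,
        ← pow_succ, mul_assoc]
  intro l
  induction l with
  | nil => simp
  | cons b l ih =>
    intro hl ha
    rw [List.pairwise_cons] at hl
    simp only [List.map_cons, List.prod_cons]
    by_cases hab : a = b
    · subst hab
      have h1 : (l.map fun e => if r e < r a then s a e ^ c e else (1 : ℝ)).prod = 1 := by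
        apply List.prod_eq_one
        intro x hx
        obtain ⟨e, he, rfl⟩ := List.mem_map.1 hx
        rw [if_neg (hl.1 e he).le.not_gt]
      have h2 : (l.map fun e => A e ^ ((if a = e then 1 else 0) + c e)) = l.map fun e => A e ^ c e := by
        refine List.map_congr_left fun e he => ?_
        have : a ≠ e := fun h => (hl.1 e he).ne (by rw [h])
        rw [if_neg this, zero_add]
      rw [h1, h2, if_neg (lt_irrefl _), one_mul, one_smul, if_pos rfl, ← mul_assoc, pow_add, pow_one]
    · have ha' : a ∈ l := by simpa [hab] using ha
      rw [if_pos (hl.1 a ha'), if_neg hab, zero_add, ← mul_assoc, hpow, smul_mul_assoc, mul_assoc,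
        ih hl.2 ha', mul_smul_comm, smul_smul]

/-- The letters listed in increasing order. -/
def sortedLetters (r : ι ≃ Fin M) : List ι := (List.finRange M).map r.symm

lemma pairwise_sortedLetters (r : ι ≃ Fin M) :
    (sortedLetters r).Pairwise (fun e f => r e < r f) := by
  rw [sortedLetters, List.pairwise_map]
  simpa using List.pairwise_lt_finRange M

lemma mem_sortedLetters (r : ι ≃ Fin M) (e : ι) : e ∈ sortedLetters r :=
  List.mem_map.2 ⟨r e, List.mem_finRange _, by simp⟩

lemma prod_map_sortedLetters [Fintype ι] (r : ι ≃ Fin M) (f : ι → ℝ) :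
    ((sortedLetters r).map f).prod = ∏ e, f e := by
  rw [sortedLetters, List.map_map, ← List.ofFn_eq_map, List.prod_ofFn]
  exact r.symm.prod_comp f

lemma word_prod [Fintype ι] {A : ι → R} {s : ι → ι → ℝ} (hA : ∀ e f, A e * A f = s e f • (A f * A e))
    (r : ι ≃ Fin M) : ∀ (k : ℕ) (w : Fin k → ι), (List.ofFn fun i => A (w i)).prod =
      wsgn s r w • ((sortedLetters r).map fun e => A e ^ wcount w e).prod := by
  intro k
  induction k with
  | zero =>
    intro w
    have : ((sortedLetters r).map fun e => A e ^ wcount w e).prod = 1 := by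
      apply List.prod_eq_one
      intro x hx
      obtain ⟨e, he, rfl⟩ := List.mem_map.1 hx
      simp [wcount]
    rw [this]
    simp [wsgn]
  | succ k ih =>
    intro w
    obtain ⟨a, v, rfl⟩ : ∃ a v, w = Fin.cons a v := ⟨w 0, Fin.tail w, (Fin.cons_self_tail w).symm⟩
    rw [List.ofFn_succ, List.prod_cons]
    simp only [Fin.cons_zero, Fin.cons_succ, wcount_cons]
    rw [ih, mul_smul_comm, mul_sorted_prod hA r a _ _ (pairwise_sortedLetters r)
      (mem_sortedLetters r a), smul_smul, prod_map_sortedLetters, wsgn_cons]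
    congr 1
    rw [mul_comm]
    congr 1
    rw [prod_eq_prod_pow_wcount v fun e => if r e < r a then s a e else 1]
    refine Finset.prod_congr rfl fun e _ => ?_
    split_ifs <;> simp

lemma word_prod_even [Fintype ι] {A : ι → R} {s : ι → ι → ℝ} (hA : ∀ e f, A e * A f = s e f • (A f * A e))
    (hA2 : ∀ e, A e * A e = 1) (r : ι ≃ Fin M) {k : ℕ} {w : Fin k → ι} (hw : EvenWord w) :
    (List.ofFn fun i => A (w i)).prod = wsgn s r w • (1 : R) := by
  rw [word_prod hA r]
  congr 1
  apply List.prod_eq_one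
  intro x hx
  obtain ⟨e, he, rfl⟩ := List.mem_map.1 hx
  obtain ⟨j, hj⟩ := hw e
  rw [hj, ← two_mul, pow_mul, pow_two, hA2, one_pow]

lemma wsgn_order_indep [Fintype ι] [Nontrivial R] {A : ι → R} {s : ι → ι → ℝ}
    (hA : ∀ e f, A e * A f = s e f • (A f * A e))
    (hA2 : ∀ e, A e * A e = 1) (r r' : ι ≃ Fin M) {k : ℕ} {w : Fin k → ι} (hw : EvenWord w) :
    wsgn s r w = wsgn s r' w := by
  have := (word_prod_even hA hA2 r hw).symm.trans (word_prod_even hA hA2 r' hw)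
  exact smul_left_injective ℝ (one_ne_zero : (1 : R) ≠ 0) this

end Words

section Averages

variable {ι : Type*} [Fintype ι] {M : ℕ}

/-- The contribution of words of length `k` satisfying `P`. -/
def wterm (s : ι → ι → ℝ) (r : ι ≃ Fin M) (g : ℝ) (P : ∀ k, (Fin k → ι) → Prop) (k : ℕ) : ℝ :=
  g ^ k / k.factorial * ∑ w : Fin k → ι, if EvenWord w ∧ P k w then wsgn s r w else 0

/-- The exponential generating series of even words with letters in `E`. -/
def Fw (s : ι → ι → ℝ) (r : ι ≃ Fin M) (g : ℝ) (E : Finset ι) : ℝ :=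
  ∑' k, wterm s r g (fun _ w => ∀ i, w i ∈ E) k

/-- The exponential generating series of even words whose set of letters is exactly `E`. -/
def Ww (s : ι → ι → ℝ) (r : ι ≃ Fin M) (g : ℝ) (E : Finset ι) : ℝ :=
  ∑' k, wterm s r g (fun _ w => Finset.univ.image w = E) k

lemma abs_wterm_le {s : ι → ι → ℝ} (hs : ∀ e f, |s e f| = 1) (r : ι ≃ Fin M) (g : ℝ)
    (P : ∀ k, (Fin k → ι) → Prop) (k : ℕ) :
    |wterm s r g P k| ≤ (|g| * Fintype.card ι) ^ k / k.factorial := by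
  rw [wterm, abs_mul, abs_div, abs_pow, Nat.abs_cast, mul_pow, mul_div_right_comm]
  gcongr
  refine (Finset.abs_sum_le_sum_abs _ _).trans ?_
  calc ∑ w : Fin k → ι, |if EvenWord w ∧ P k w then wsgn s r w else 0| ≤ ∑ w : Fin k → ι, (1 : ℝ) := by
        refine Finset.sum_le_sum fun w _ => ?_
        split_ifs
        · exact (abs_wsgn hs r w).le
        · simp
    _ = (Fintype.card ι : ℝ) ^ k := by simp

lemma summable_wterm {s : ι → ι → ℝ} (hs : ∀ e f, |s e f| = 1) (r : ι ≃ Fin M) (g : ℝ)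
    (P : ∀ k, (Fin k → ι) → Prop) : Summable (wterm s r g P) :=
  Summable.of_norm_bounded (Real.summable_pow_div_factorial _) (abs_wterm_le hs r g P)

lemma Fw_eq_sum_Ww {s : ι → ι → ℝ} (hs : ∀ e f, |s e f| = 1) (r : ι ≃ Fin M) (g : ℝ)
    (E : Finset ι) : Fw s r g E = ∑ D ∈ E.powerset, Ww s r g D := by
  unfold Fw Ww
  rw [← Summable.tsum_finsetSum fun D _ => summable_wterm hs r g _]
  refine tsum_congr fun k => ?_
  unfold wterm
  rw [← Finset.mul_sum, Finset.sum_comm]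
  congr 1
  refine Finset.sum_congr rfl fun w _ => ?_
  by_cases h : ∀ i, w i ∈ E
  · rw [Finset.sum_eq_single (Finset.univ.image w)]
    · simp [h]
    · intro D _ hD
      rw [if_neg]
      exact fun h' => hD h'.2.symm
    · intro hD
      exact absurd (Finset.mem_powerset.2 (Finset.image_subset_iff.2 fun i _ => h i)) hD
  · rw [if_neg fun h' => h h'.2, Finset.sum_eq_zero]
    intro D hD
    rw [if_neg]
    rintro ⟨-, h'⟩
    refine h fun i => Finset.mem_powerset.1 hD ?_
    rw [← h']
    exact Finset.mem_image_of_mem _ (Finset.mem_univ i)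

/-- The real sign of a Boolean. -/
def eps (b : Bool) : ℝ := if b then 1 else -1

lemma sum_prod_eps {k : ℕ} (w : Fin k → ι) :
    ∑ ε : ι → Bool, ∏ i, eps (ε (w i)) = if EvenWord w then 2 ^ Fintype.card ι else 0 := by
  have h1 : ∀ ε : ι → Bool, ∏ i, eps (ε (w i)) = ∏ e, eps (ε e) ^ wcount w e := fun ε =>
    prod_eq_prod_pow_wcount w fun e => eps (ε e)
  simp_rw [h1]
  have h2 := (Finset.prod_univ_sum (fun _ : ι => (Finset.univ : Finset Bool))
    (fun e b => eps b ^ wcount w e))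
  rw [Fintype.piFinset_univ] at h2
  rw [← h2]
  have h3 : ∀ e, ∑ b, eps b ^ wcount w e = if Even (wcount w e) then 2 else 0 := by
    intro e
    rw [Fintype.sum_bool]
    split_ifs with h
    · simp [eps, h.neg_one_pow]; norm_num
    · simp [eps, (Nat.not_even_iff_odd.1 h).neg_one_pow]
  simp_rw [h3]
  split_ifs with h
  · rw [Finset.prod_congr rfl fun e _ => if_pos (h e)]
    simp
  · simp only [EvenWord, not_forall] at h
    obtain ⟨e, he⟩ := h
    exact Finset.prod_eq_zero (Finset.mem_univ e) (if_neg he)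

section Algebra

variable {R : Type*} [NormedRing R] [NormedAlgebra ℝ R]

/-- The random Hamiltonian with couplings in `E`. -/
def ham (A : ι → R) (E : Finset ι) (ε : ι → Bool) : R :=
  ∑ e, (if e ∈ E then eps (ε e) else 0) • A e

lemma prod_ofFn_smul {α : Type*} (A : α → R) (c : α → ℝ) (k : ℕ) (w : Fin k → α) :
    (List.ofFn fun i => c (w i) • A (w i)).prod = (∏ i, c (w i)) • (List.ofFn fun i => A (w i)).prod := by
  induction k with
  | zero => simp
  | succ k ih =>
    rw [List.ofFn_succ, List.ofFn_succ, List.prod_cons, List.prod_cons, Fin.prod_univ_succ,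
      ih fun i => w i.succ, smul_mul_smul_comm]

lemma smul_ham_pow (A : ι → R) (E : Finset ι) (g : ℝ) (ε : ι → Bool) (k : ℕ) :
    (g • ham A E ε) ^ k = ∑ w : Fin k → ι, (if ∀ i, w i ∈ E then g ^ k * ∏ i, eps (ε (w i)) else 0) •
      (List.ofFn fun i => A (w i)).prod := by
  rw [smul_pow, ham, sum_pow_eq_sum_words, Finset.smul_sum]
  refine Finset.sum_congr rfl fun w _ => ?_
  rw [prod_ofFn_smul A (fun e => if e ∈ E then eps (ε e) else 0), smul_smul]
  congr 1
  split_ifs with h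
  · congr 1
    exact Finset.prod_congr rfl fun i _ => if_pos (h i)
  · obtain ⟨i, hi⟩ := not_forall.1 h
    rw [Finset.prod_eq_zero (Finset.mem_univ i) (if_neg hi), mul_zero]

lemma hasSum_avg_exp [CompleteSpace R] {A : ι → R} {s : ι → ι → ℝ}
    (hs : ∀ e f, |s e f| = 1) (hA : ∀ e f, A e * A f = s e f • (A f * A e))
    (hA2 : ∀ e, A e * A e = 1) (r : ι ≃ Fin M) (g : ℝ) (E : Finset ι) :
    HasSum (fun k : ℕ => ∑ ε : ι → Bool, (k.factorial : ℝ)⁻¹ • (g • ham A E ε) ^ k)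
      (((2 : ℝ) ^ Fintype.card ι * Fw s r g E) • (1 : R)) := by
  have h1 := (((summable_wterm hs r g (fun _ w => ∀ i, w i ∈ E)).hasSum.mul_left
    ((2 : ℝ) ^ Fintype.card ι))).smul_const (1 : R)
  have e : (fun k : ℕ => ∑ ε : ι → Bool, (k.factorial : ℝ)⁻¹ • (g • ham A E ε) ^ k) =
      fun k => ((2 : ℝ) ^ Fintype.card ι * wterm s r g (fun _ w => ∀ i, w i ∈ E) k) • (1 : R) := by
    funext k
    simp_rw [smul_ham_pow, Finset.smul_sum]
    rw [Finset.sum_comm, wterm, Finset.mul_sum, Finset.mul_sum, Finset.sum_smul]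
    refine Finset.sum_congr rfl fun w _ => ?_
    simp_rw [smul_smul]
    rw [← Finset.sum_smul]
    by_cases h : ∀ i, w i ∈ E
    · simp_rw [if_pos h]
      rw [← Finset.mul_sum, ← Finset.mul_sum, sum_prod_eps]
      by_cases hw : EvenWord w
      · rw [if_pos hw, if_pos ⟨hw, h⟩, word_prod_even hA hA2 r hw, smul_smul]
        congr 1
        ring
      · rw [if_neg hw, if_neg fun h' => hw h'.1]
        simp
    · simp_rw [if_neg h]
      rw [if_neg fun h' => h h'.2]
      simp
  rw [e]
  exact h1

lemma sum_exp_ham [CompleteSpace R] {A : ι → R} {s : ι → ι → ℝ}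
    (hs : ∀ e f, |s e f| = 1) (hA : ∀ e f, A e * A f = s e f • (A f * A e))
    (hA2 : ∀ e, A e * A e = 1) (r : ι ≃ Fin M) (g : ℝ) (E : Finset ι) :
    ∑ ε : ι → Bool, NormedSpace.exp (g • ham A E ε) =
      ((2 : ℝ) ^ Fintype.card ι * Fw s r g E) • (1 : R) := by
  have h1 := hasSum_avg_exp hs hA hA2 r g E
  have h2 : HasSum (fun k : ℕ => ∑ ε : ι → Bool, (k.factorial : ℝ)⁻¹ • (g • ham A E ε) ^ k)
      (∑ ε : ι → Bool, NormedSpace.exp (g • ham A E ε)) :=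
    hasSum_sum fun ε _ => NormedSpace.exp_series_hasSum_exp' (𝕂 := ℝ) _
  exact h2.unique h1

lemma ham_congr (A : ι → R) {E : Finset ι} {ε ε' : ι → Bool} (h : ∀ e ∈ E, ε e = ε' e) :
    ham A E ε = ham A E ε' := by
  refine Finset.sum_congr rfl fun e _ => ?_
  split_ifs with he
  · rw [h e he]
  · rfl

/-- Interchange of the coordinates outside `E` of two functions. -/
def swapOff (E : Finset ι) : ((ι → Bool) × (ι → Bool)) ≃ ((ι → Bool) × (ι → Bool)) :=
  Function.Involutive.toPerm
    (fun p => (fun e => if e ∈ E then p.1 e else p.2 e, fun e => if e ∈ E then p.2 e else p.1 e))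
    fun p => by
      refine Prod.ext (funext fun e => ?_) (funext fun e => ?_) <;> by_cases he : e ∈ E <;> simp [he]

lemma sum_mul_sum_of_disjoint {D E : Finset ι} (h : Disjoint D E) (f : R → R)
    (A : ι → R) : (∑ ε, f (ham A D ε)) * (∑ ε, f (ham A E ε)) =
      (2 : ℝ) ^ Fintype.card ι • ∑ ε, f (ham A D ε) * f (ham A E ε) := by
  rw [Finset.sum_mul_sum, ← Fintype.sum_prod_type' (f := fun ε ε' => f (ham A D ε) * f (ham A E ε'))]
  have h1 : ∀ p : (ι → Bool) × (ι → Bool), f (ham A D p.1) * f (ham A E p.2) =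
      f (ham A D (swapOff D p).1) * f (ham A E (swapOff D p).1) := by
    intro p
    congr 2
    · refine ham_congr A fun e he => ?_
      exact (if_pos he).symm
    · refine ham_congr A fun e he => ?_
      exact (if_neg fun h' => Finset.disjoint_left.1 h h' he).symm
  simp_rw [h1]
  rw [(swapOff D).sum_comp fun p => f (ham A D p.1) * f (ham A E p.1), Fintype.sum_prod_type,
    Finset.smul_sum]
  refine Finset.sum_congr rfl fun ε _ => ?_
  simp only
  rw [Finset.sum_const, ← Nat.cast_smul_eq_nsmul ℝ]
  simp

lemma ham_union (A : ι → R) {D E : Finset ι} (h : Disjoint D E) (ε : ι → Bool) :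
    ham A (D ∪ E) ε = ham A D ε + ham A E ε := by
  unfold ham
  rw [← Finset.sum_add_distrib]
  refine Finset.sum_congr rfl fun e _ => ?_
  rw [← add_smul]
  congr 1
  by_cases h1 : e ∈ D
  · simp [h1, Finset.disjoint_left.1 h h1]
  · simp [h1]

lemma commute_ham {A : ι → R} {D E : Finset ι} (h : ∀ e ∈ D, ∀ f ∈ E, A e * A f = A f * A e)
    (ε ε' : ι → Bool) : Commute (ham A D ε) (ham A E ε') := by
  refine Commute.sum_left _ _ _ fun e _ => Commute.sum_right _ _ _ fun f _ => ?_
  by_cases he : e ∈ D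
  · by_cases hf : f ∈ E
    · exact ((show Commute (A e) (A f) from h e he f hf).smul_left _).smul_right _
    · simp [hf]
  · simp [he]

lemma Fw_union [NormedAlgebra ℚ R] [CompleteSpace R] [Nontrivial R] {A : ι → R} {s : ι → ι → ℝ}
    (hs : ∀ e f, |s e f| = 1) (hA : ∀ e f, A e * A f = s e f • (A f * A e))
    (hA2 : ∀ e, A e * A e = 1) (r : ι ≃ Fin M) (g : ℝ) {D E : Finset ι} (hDE : Disjoint D E)
    (h : ∀ e ∈ D, ∀ f ∈ E, s e f = 1) : Fw s r g (D ∪ E) = Fw s r g D * Fw s r g E := by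
  have h1 := sum_exp_ham hs hA hA2 r g (D ∪ E)
  have h2 : ∀ ε, NormedSpace.exp (g • ham A (D ∪ E) ε) =
      NormedSpace.exp (g • ham A D ε) * NormedSpace.exp (g • ham A E ε) := by
    intro ε
    rw [ham_union A hDE, smul_add]
    refine NormedSpace.exp_add_of_commute ?_
    refine ((commute_ham (fun e he f hf => ?_) ε ε).smul_left g).smul_right g
    rw [hA, h e he f hf, one_smul]
  simp_rw [h2] at h1
  have h3 := sum_mul_sum_of_disjoint hDE (fun x => NormedSpace.exp (g • x)) A
  rw [sum_exp_ham hs hA hA2 r, sum_exp_ham hs hA hA2 r, h1, smul_mul_smul_comm, one_mul, smul_smul] at h3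
  have h4 := smul_left_injective ℝ (one_ne_zero : (1 : R) ≠ 0) h3
  have h5 : ((2 : ℝ) ^ Fintype.card ι) ≠ 0 := by positivity
  apply mul_left_cancel₀ (mul_ne_zero h5 h5)
  linear_combination -h4

lemma sum_powerset_union {α : Type*} {D E : Finset α} (hDE : Disjoint D E) (f : Finset α → ℝ) :
    ∑ X ∈ (D ∪ E).powerset, f X = ∑ P ∈ D.powerset ×ˢ E.powerset, f (P.1 ∪ P.2) := by
  refine (Finset.sum_bij' (fun P _ => P.1 ∪ P.2) (fun X _ => (X ∩ D, X ∩ E)) ?_ ?_ ?_ ?_ ?_).symm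
  · intro P hP
    rw [Finset.mem_product, Finset.mem_powerset, Finset.mem_powerset] at hP
    exact Finset.mem_powerset.2 (Finset.union_subset_union hP.1 hP.2)
  · intro X _
    simp [Finset.inter_subset_right]
  · intro P hP
    rw [Finset.mem_product, Finset.mem_powerset, Finset.mem_powerset] at hP
    have h1 : ∀ x ∈ D, x ∉ E := fun x hx => Finset.disjoint_left.1 hDE hx
    ext x
    · have := @hP.1 x; have := @hP.2 x; have := h1 x
      simp only [Finset.mem_inter, Finset.mem_union]; tauto
    · have := @hP.1 x; have := @hP.2 x; have := h1 x
      simp only [Finset.mem_inter, Finset.mem_union]; tauto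
  · intro X hX
    rw [← Finset.inter_union_distrib_left]
    exact Finset.inter_eq_left.2 (Finset.mem_powerset.1 hX)
  · intro P _; rfl

lemma Ww_union [NormedAlgebra ℚ R] [CompleteSpace R] [Nontrivial R] {A : ι → R} {s : ι → ι → ℝ}
    (hs : ∀ e f, |s e f| = 1) (hA : ∀ e f, A e * A f = s e f • (A f * A e))
    (hA2 : ∀ e, A e * A e = 1) (r : ι ≃ Fin M) (g : ℝ) {D E : Finset ι} (hDE : Disjoint D E)
    (h : ∀ e ∈ D, ∀ f ∈ E, s e f = 1) : Ww s r g (D ∪ E) = Ww s r g D * Ww s r g E := by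
  induction hn : D.card + E.card using Nat.strong_induction_on generalizing D E with
  | _ n ih =>
    have h1 := Fw_union hs hA hA2 r g hDE h
    rw [Fw_eq_sum_Ww hs, Fw_eq_sum_Ww hs, Fw_eq_sum_Ww hs, sum_powerset_union hDE,
      Finset.sum_mul_sum, ← Finset.sum_product'] at h1
    have hmem : (D, E) ∈ D.powerset ×ˢ E.powerset := by simp
    rw [← Finset.add_sum_erase _ _ hmem, ← Finset.add_sum_erase _ _ hmem] at h1
    have h2 : ∑ P ∈ (D.powerset ×ˢ E.powerset).erase (D, E), Ww s r g (P.1 ∪ P.2) =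
        ∑ P ∈ (D.powerset ×ˢ E.powerset).erase (D, E), Ww s r g P.1 * Ww s r g P.2 := by
      refine Finset.sum_congr rfl fun P hP => ?_
      rw [Finset.mem_erase, Finset.mem_product, Finset.mem_powerset, Finset.mem_powerset] at hP
      obtain ⟨hne, hPD, hPE⟩ := hP
      refine ih _ ?_ (Finset.disjoint_of_subset_left hPD (Finset.disjoint_of_subset_right hPE hDE))
        (fun e he f hf => h e (hPD he) f (hPE hf)) rfl
      rw [← hn]
      by_contra hlt
      have c1 := Finset.card_le_card hPD
      have c2 := Finset.card_le_card hPE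
      exact hne (Prod.ext (Finset.eq_of_subset_of_card_le hPD (by simp only; omega))
        (Finset.eq_of_subset_of_card_le hPE (by simp only; omega)))
    rw [h2] at h1
    exact add_right_cancel h1

end Algebra

end Averages

section Bounds

variable {ι : Type*} [Fintype ι] {M : ℕ}

lemma wsgn_one {α : Type*} (r : α ≃ Fin M) {k : ℕ} (w : Fin k → α) : wsgn (fun _ _ => 1) r w = 1 := by
  simp [wsgn]

lemma Fw_one (r : ι ≃ Fin M) (g : ℝ) (E : Finset ι) :
    Fw (fun _ _ => 1) r g E = Real.cosh g ^ E.card := by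
  have h1 := sum_exp_ham (R := ℝ) (A := fun _ : ι => (1 : ℝ)) (s := fun _ _ => 1) (by simp) (by simp)
    (by simp) r g E
  have h2 : ∀ ε : ι → Bool, NormedSpace.exp (g • ham (fun _ : ι => (1 : ℝ)) E ε) =
      ∏ e, if e ∈ E then Real.exp (g * eps (ε e)) else 1 := by
    intro ε
    rw [← congrFun Real.exp_eq_exp_ℝ, ham, Finset.smul_sum, Real.exp_sum]
    refine Finset.prod_congr rfl fun e _ => ?_
    split_ifs <;> simp
  simp_rw [h2] at h1
  have h3 := (Finset.prod_univ_sum (fun _ : ι => (Finset.univ : Finset Bool))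
    (fun e b => if e ∈ E then Real.exp (g * eps b) else 1))
  rw [Fintype.piFinset_univ] at h3
  rw [← h3] at h1
  have h4 : ∀ e, (∑ b, if e ∈ E then Real.exp (g * eps b) else 1) =
      2 * if e ∈ E then Real.cosh g else 1 := by
    intro e
    rw [Fintype.sum_bool]
    split_ifs
    · simp [eps, Real.cosh_eq]; ring
    · norm_num
  simp_rw [h4, Finset.prod_mul_distrib] at h1
  simp only [Finset.prod_const, Finset.card_univ, smul_eq_mul, mul_one, Finset.prod_ite_mem,
    Finset.univ_inter] at h1
  have h5 : ((2 : ℝ) ^ Fintype.card ι) ≠ 0 := by positivity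
  exact (mul_left_cancel₀ h5 h1).symm

lemma Ww_one (r : ι ≃ Fin M) (g : ℝ) (E : Finset ι) :
    Ww (fun _ _ => 1) r g E = (Real.cosh g - 1) ^ E.card := by
  induction hn : E.card using Nat.strong_induction_on generalizing E with
  | _ n ih =>
    have h1 := Fw_eq_sum_Ww (s := fun _ _ => 1) (by simp) r g E
    have h2 : Real.cosh g ^ E.card = ∑ D ∈ E.powerset, (Real.cosh g - 1) ^ D.card := by
      have := Finset.prod_one_add (R := ℝ) E (f := fun _ => Real.cosh g - 1)
      simpa using this
    rw [Fw_one, h2, ← Finset.add_sum_erase _ _ (Finset.mem_powerset_self E),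
      ← Finset.add_sum_erase _ _ (Finset.mem_powerset_self E)] at h1
    have h3 : ∑ D ∈ E.powerset.erase E, Ww (fun _ _ => 1) r g D =
        ∑ D ∈ E.powerset.erase E, (Real.cosh g - 1) ^ D.card := by
      refine Finset.sum_congr rfl fun D hD => ?_
      rw [Finset.mem_erase, Finset.mem_powerset] at hD
      exact ih _ (hn ▸ Finset.card_lt_card (hD.2.ssubset_of_ne hD.1)) D rfl
    rw [h3] at h1
    rw [← hn]
    exact (add_right_cancel h1).symm

lemma wterm_one (r : ι ≃ Fin M) (g : ℝ) (P : ∀ k, (Fin k → ι) → Prop) (k : ℕ) :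
    wterm (fun _ _ => 1) r g P k = g ^ k / k.factorial *
      ∑ w : Fin k → ι, if EvenWord w ∧ P k w then 1 else 0 := by
  simp only [wterm, wsgn_one]

lemma abs_wterm_le_one {s : ι → ι → ℝ} (hs : ∀ e f, |s e f| = 1) (r : ι ≃ Fin M) {g : ℝ} (hg : 0 ≤ g)
    (P : ∀ k, (Fin k → ι) → Prop) (k : ℕ) :
    |wterm s r g P k| ≤ wterm (fun _ _ => 1) r g P k := by
  rw [wterm_one, wterm, abs_mul, abs_of_nonneg (by positivity : 0 ≤ g ^ k / k.factorial)]
  refine mul_le_mul_of_nonneg_left ?_ (by positivity)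
  refine (Finset.abs_sum_le_sum_abs _ _).trans (Finset.sum_le_sum fun w _ => ?_)
  split_ifs
  · exact (abs_wsgn hs r w).le
  · simp

lemma abs_Ww_le {s : ι → ι → ℝ} (hs : ∀ e f, |s e f| = 1) (r : ι ≃ Fin M) {g : ℝ} (hg : 0 ≤ g)
    (E : Finset ι) : |Ww s r g E| ≤ (Real.cosh g - 1) ^ E.card := by
  rw [← Ww_one r g E]
  exact tsum_of_norm_bounded (f := wterm s r g _) (summable_wterm (s := fun _ _ => 1)
    (by intros; simp) r g (fun _ w => Finset.univ.image w = E)).hasSum fun k => abs_wterm_le_one hs r hg _ k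

/-- The contribution to `Ww` of one word length differs from the full series by at most the
corresponding difference for trivial signs. -/
lemma abs_Ww_sub_wterm_le {s : ι → ι → ℝ} (hs : ∀ e f, |s e f| = 1) (r : ι ≃ Fin M) {g : ℝ}
    (hg : 0 ≤ g) (E : Finset ι) (k : ℕ) :
    |Ww s r g E - wterm s r g (fun _ w => Finset.univ.image w = E) k| ≤
      (Real.cosh g - 1) ^ E.card -
        wterm (fun _ _ => 1) r g (fun _ w => Finset.univ.image w = E) k := by
  rw [← Ww_one r g E]
  unfold Ww
  rw [(summable_wterm hs r g _).tsum_eq_add_tsum_ite k,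
    (summable_wterm (s := fun _ _ => 1) (by simp) r g _).tsum_eq_add_tsum_ite k, add_sub_cancel_left,
    add_sub_cancel_left]
  have hsum := (summable_wterm (s := fun _ _ => 1) (by simp) r g
    (fun _ w => Finset.univ.image w = E))
  have h0 : ∀ j, 0 ≤ wterm (fun _ _ => 1) r g (fun _ w => Finset.univ.image w = E) j := fun j =>
    (abs_nonneg _).trans (abs_wterm_le_one hs r hg _ j)
  rw [← Real.norm_eq_abs]
  refine tsum_of_norm_bounded (Summable.hasSum ?_) fun j => ?_
  · refine Summable.of_nonneg_of_le (fun j => ?_) (fun j => ?_) hsum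
    · split_ifs
      · exact le_rfl
      · exact h0 j
    · split_ifs
      · exact h0 j
      · exact le_rfl
  · split_ifs
    · simp
    · exact abs_wterm_le_one hs r hg _ j

lemma Ww_map {R : Type*} [NormedRing R] [NormedAlgebra ℝ R] [Nontrivial R] {A : ι → R}
    {s : ι → ι → ℝ} (hA : ∀ e f, A e * A f = s e f • (A f * A e))
    (hA2 : ∀ e, A e * A e = 1) (r : ι ≃ Fin M) (g : ℝ) (φ : ι ≃ ι)
    (hφ : ∀ e f, s (φ e) (φ f) = s e f) (E : Finset ι) :
    Ww s r g (E.map φ.toEmbedding) = Ww s r g E := by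
  unfold Ww
  refine tsum_congr fun k => ?_
  unfold wterm
  congr 1
  rw [← (Equiv.arrowCongr (Equiv.refl (Fin k)) φ).sum_comp]
  refine Finset.sum_congr rfl fun w _ => ?_
  have h1 : (Equiv.arrowCongr (Equiv.refl (Fin k)) φ) w = fun i => φ (w i) := rfl
  have h2 : EvenWord (fun i => φ (w i)) ↔ EvenWord w := by
    have : ∀ e, wcount (fun i => φ (w i)) (φ e) = wcount w e := by
      intro e; simp [wcount]
    constructor
    · intro h e; rw [← this]; exact h _
    · intro h e; rw [← φ.apply_symm_apply e, this]; exact h _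
  have h3 : Finset.univ.image (fun i => φ (w i)) = E.map φ.toEmbedding ↔ Finset.univ.image w = E := by
    rw [show Finset.univ.image (fun i => φ (w i)) = (Finset.univ.image w).map φ.toEmbedding by
      rw [Finset.map_eq_image, Finset.image_image]; rfl, Finset.map_inj]
  rw [h1]
  by_cases h : EvenWord w ∧ Finset.univ.image w = E
  · rw [if_pos h, if_pos ⟨h2.2 h.1, h3.2 h.2⟩, wsgn_comp s r hφ, wsgn_order_indep hA hA2 _ r h.1]
  · rw [if_neg h, if_neg fun h' => h ⟨h2.1 h'.1, h3.1 h'.2⟩]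

end Bounds

section Chords

variable {ι T : Type*} [Fintype T] {M : ℕ}

/-- The crossing sign of labelled points on the line: the product of `s` over the inverted pairs. -/
def chordSgn (s : ι → ι → ℝ) (r : ι ≃ Fin M) (p : T → ι) (x : T → ℝ) : ℝ :=
  ∏ a, ∏ b, if x a < x b ∧ r (p b) < r (p a) then s (p a) (p b) else 1

lemma exists_rank {x : T → ℝ} (hx : Function.Injective x) {k : ℕ} (hk : Fintype.card T = k) :
    ∃ σ : T ≃ Fin k, ∀ a b, x a < x b ↔ σ a < σ b := by
  have hc : (Finset.univ.image x).card = k := by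
    rw [Finset.card_image_of_injective _ hx, Finset.card_univ, hk]
  let o := (Finset.univ.image x).orderIsoOfFin hc
  let f : T → Finset.univ.image x := fun t => ⟨x t, Finset.mem_image_of_mem _ (Finset.mem_univ t)⟩
  have hf : Function.Bijective f := by
    refine ⟨fun a b h => hx (congrArg Subtype.val h), ?_⟩
    rintro ⟨y, hy⟩
    obtain ⟨t, -, rfl⟩ := Finset.mem_image.1 hy
    exact ⟨t, rfl⟩
  refine ⟨(Equiv.ofBijective f hf).trans o.symm.toEquiv, fun a b => ?_⟩
  exact (o.symm.lt_iff_lt (x := f a) (y := f b)).symm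

lemma sum_chordSgn (s : ι → ι → ℝ) (r : ι ≃ Fin M) (p : T → ι) {x : T → ℝ}
    (hx : Function.Injective x) {k : ℕ} (hk : Fintype.card T = k) :
    ∑ π : Equiv.Perm T, chordSgn s r p (fun t => x (π t)) =
      ∑ σ : Fin k ≃ T, wsgn s r (fun i => p (σ i)) := by
  obtain ⟨σ₀, h⟩ := exists_rank hx hk
  refine Fintype.sum_equiv
    ⟨fun π => (π.trans σ₀).symm, fun σ => σ.symm.trans σ₀.symm, fun π => by ext; simp,
      fun σ => by ext; simp⟩ _ _ fun π => ?_
  unfold chordSgn wsgn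
  refine Fintype.prod_equiv (π.trans σ₀) _ _ fun a => Fintype.prod_equiv (π.trans σ₀) _ _ fun b => ?_
  simp [h]

lemma wcount_eq_card {k : ℕ} (w : Fin k → ι) (e : ι) :
    wcount w e = (Finset.univ.filter fun i => w i = e).card := by
  rw [wcount, Finset.card_filter]

lemma card_equiv_lift {k : ℕ} (w : Fin k → ι) (p : T → ι) (σ₀ : Fin k ≃ T)
    (h : ∀ i, p (σ₀ i) = w i) {κ : Type*} [Fintype κ] (v : Fin k → κ) (j : κ → ι)
    (hj : Function.Injective j) (hv : ∀ i, j (v i) = w i) :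
    (Finset.univ.filter fun σ : Fin k ≃ T => (fun i => p (σ i)) = w).card =
      ∏ e : κ, (wcount w (j e)).factorial := by
  have h1 := DomMulAct.stabilizer_card v
  have h2 : ∀ e : κ, Fintype.card {a // v a = e} = wcount w (j e) := by
    intro e
    rw [wcount_eq_card, Fintype.card_subtype]
    congr 1
    ext i
    simp only [Finset.mem_filter, Finset.mem_univ, true_and, ← hv, hj.eq_iff]
  simp_rw [h2] at h1
  rw [← h1, ← Fintype.card_subtype]
  refine Fintype.card_congr
    ⟨fun σ => ⟨σ.1.trans σ₀.symm, ?_⟩, fun τ => ⟨τ.1.trans σ₀, ?_⟩, fun σ => ?_, fun τ => ?_⟩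
  · funext i
    apply hj
    have := congrFun σ.2 i
    simp only [Function.comp_apply, Equiv.trans_apply, hv]
    rw [← h]
    simpa using this
  · funext i
    have := congrFun τ.2 i
    simp only [Equiv.trans_apply, h]
    rw [← hv, ← hv]
    exact congrArg j this
  · ext; simp
  · ext; simp

/-- The label of a chord endpoint. -/
def lab (E : Finset ι) : E ⊕ E → ι := Sum.elim Subtype.val Subtype.val

lemma wcount_eq_of_lift {E : Finset ι} {k : ℕ} (σ : Fin k ≃ E ⊕ E) (e : ι) :
    wcount (fun i => lab E (σ i)) e = if e ∈ E then 2 else 0 := by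
  unfold wcount
  rw [σ.sum_comp (fun t => if lab E t = e then 1 else 0), Fintype.sum_sum_type]
  have : ∑ a : E, (if (a : ι) = e then 1 else 0) = if e ∈ E then 1 else 0 := by
    rw [Finset.sum_coe_sort E (fun a => if a = e then 1 else 0), Finset.sum_ite_eq']
  change (∑ a : E, if (a : ι) = e then 1 else 0) + (∑ a : E, if (a : ι) = e then 1 else 0) = _
  rw [this]
  split_ifs <;> rfl

lemma wcount_eq_two {E : Finset ι} {w : Fin (2 * E.card) → ι} (hw : EvenWord w)
    (hE : Finset.univ.image w = E) (e : ι) (he : e ∈ E) : wcount w e = 2 := by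
  have h2 : ∀ e ∈ E, 2 ≤ wcount w e := by
    intro e he
    rw [← hE] at he
    obtain ⟨i, -, hi⟩ := Finset.mem_image.1 he
    have h1 : 0 < wcount w e := by
      rw [wcount_eq_card]
      exact Finset.card_pos.2 ⟨i, by simp [hi]⟩
    obtain ⟨c, hc⟩ := hw e
    omega
  have hs : ∑ e ∈ E, wcount w e = ∑ e ∈ E, 2 := by
    simp_rw [wcount_eq_card]
    rw [Finset.sum_const, smul_eq_mul]
    have := Finset.card_eq_sum_card_fiberwise (s := Finset.univ) (t := E) (f := w)
      fun i _ => by simp [← hE]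
    refine Eq.trans ?_ ((this.symm.trans (Finset.card_univ.trans (Fintype.card_fin _))).trans
      (mul_comm _ _))
    refine Finset.sum_congr rfl fun e _ => congrArg _ (Finset.ext fun i => ?_)
    simp only [Finset.mem_filter, Finset.mem_univ, true_and]
  exact ((Finset.sum_eq_sum_iff_of_le h2).1 hs.symm e he).symm

lemma exists_lift {E : Finset ι} {w : Fin (2 * E.card) → ι} (hw : EvenWord w)
    (hE : Finset.univ.image w = E) :
    ∃ σ : Fin (2 * E.card) ≃ E ⊕ E, ∀ i, lab E (σ i) = w i := by
  let v : Fin (2 * E.card) → E := fun i => ⟨w i, by rw [← hE]; simp⟩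
  have hc : ∀ e : E, Nonempty ({i // v i = e} ≃ Bool) := by
    intro e
    refine ⟨Fintype.equivOfCardEq ?_⟩
    rw [Fintype.card_subtype, Fintype.card_bool]
    refine Eq.trans ?_ (wcount_eq_two hw hE e e.2)
    rw [wcount_eq_card]
    congr 1
    ext i
    simp [v, Subtype.ext_iff]
  let f := fun e => (hc e).some
  refine ⟨(Equiv.sigmaFiberEquiv v).symm.trans ((Equiv.sigmaCongrRight f).trans
    ((Equiv.sigmaEquivProd _ _).trans ((Equiv.prodComm _ _).trans (Equiv.boolProdEquivSum _)))),
    fun i => ?_⟩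
  change lab E (Equiv.boolProdEquivSum _ (f (v i) ⟨i, rfl⟩, v i)) = w i
  cases f (v i) ⟨i, rfl⟩ <;> rfl

lemma sum_lift [Fintype ι] (E : Finset ι) (h : (Fin (2 * E.card) → ι) → ℝ) :
    ∑ σ : Fin (2 * E.card) ≃ E ⊕ E, h (fun i => lab E (σ i)) =
      2 ^ E.card * ∑ w, if EvenWord w ∧ Finset.univ.image w = E then h w else 0 := by
  rw [← Finset.sum_fiberwise Finset.univ
    (fun σ : Fin (2 * E.card) ≃ E ⊕ E => fun i => lab E (σ i)), Finset.mul_sum]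
  refine Finset.sum_congr rfl fun w _ => ?_
  have h1 : ∑ σ : Fin (2 * E.card) ≃ E ⊕ E with (fun i => lab E (σ i)) = w, h (fun i => lab E (σ i)) =
      ∑ σ : Fin (2 * E.card) ≃ E ⊕ E with (fun i => lab E (σ i)) = w, h w :=
    Finset.sum_congr rfl fun σ hσ => by rw [(Finset.mem_filter.1 hσ).2]
  rw [h1, Finset.sum_const, nsmul_eq_mul]
  split_ifs with hw
  · obtain ⟨σ₀, h0⟩ := exists_lift hw.1 hw.2
    have hc := card_equiv_lift w (lab E) σ₀ h0 (fun i => (⟨w i, by rw [← hw.2]; simp⟩ : E))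
      Subtype.val Subtype.val_injective fun _ => rfl
    rw [Finset.prod_congr rfl fun (e : E) _ => by rw [wcount_eq_two hw.1 hw.2 e e.2]] at hc
    congr 1
    trans ((2 ^ E.card : ℕ) : ℝ)
    · refine congrArg Nat.cast (((congrArg Finset.card (Finset.ext fun σ => ?_)).trans hc).trans ?_)
      · simp only [Finset.mem_filter, Finset.mem_univ, true_and]
      · simp
    · simp
  · rw [Finset.card_eq_zero.2, Nat.cast_zero, zero_mul, mul_zero]
    refine Finset.filter_eq_empty_iff.2 fun σ _ hσ => hw ?_
    subst hσ
    constructor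
    · intro e
      rw [wcount_eq_of_lift]
      split_ifs <;> simp
    · ext e
      rw [Finset.mem_image]
      constructor
      · rintro ⟨i, -, rfl⟩
        cases σ i <;> simp [lab]
      · intro he
        exact ⟨σ.symm (Sum.inl ⟨e, he⟩), Finset.mem_univ _, by simp [lab]⟩

lemma wterm_eq_sum_lift [Fintype ι] (s : ι → ι → ℝ) (r : ι ≃ Fin M) (g : ℝ) (E : Finset ι) :
    wterm s r g (fun _ w => Finset.univ.image w = E) (2 * E.card) =
      (g ^ 2 / 2) ^ E.card * (((2 * E.card).factorial : ℝ)⁻¹ *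
        ∑ σ : Fin (2 * E.card) ≃ E ⊕ E, wsgn s r fun i => lab E (σ i)) := by
  rw [wterm, sum_lift E (fun w => wsgn s r w), div_pow, pow_mul]
  field_simp
  congr! 4

lemma wterm_one_lift [Fintype ι] (r : ι ≃ Fin M) (g : ℝ) (E : Finset ι) :
    wterm (fun _ _ => 1) r g (fun _ w => Finset.univ.image w = E) (2 * E.card) =
      (g ^ 2 / 2) ^ E.card := by
  rw [wterm_eq_sum_lift]
  simp only [wsgn_one, Finset.sum_const, Finset.card_univ, nsmul_eq_mul, mul_one]
  have : Fintype.card (Fin (2 * E.card) ≃ E ⊕ E) = (2 * E.card).factorial := by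
    rw [Fintype.card_equiv (Fintype.equivOfCardEq (by simp [two_mul])), Fintype.card_fin]
  rw [this, inv_mul_cancel₀ (by positivity), mul_one]

end Chords

section ChordIntegral

lemma K_minmax {a b c d : ℝ} (h1 : a ≠ c) (h2 : a ≠ d) (h3 : b ≠ c) (h4 : b ≠ d) :
    K (min a b, max a b) (min c d, max c d) =
      ((if a < c then -1 else 1) * (if a < d then -1 else 1)) *
        ((if b < c then -1 else 1) * (if b < d then -1 else 1)) := by
  wlog hab : a ≤ b generalizing a b
  · rw [min_comm, max_comm, this h3 h4 h1 h2 (le_of_not_ge hab), mul_comm]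
  wlog hcd : c ≤ d generalizing c d
  · rw [min_comm c, max_comm c, this h2 h1 h4 h3 (le_of_not_ge hcd)]
    ring
  rw [min_eq_left hab, max_eq_right hab, min_eq_left hcd, max_eq_right hcd]
  unfold K
  rcases lt_or_gt_of_ne h1 with g1 | g1 <;> rcases lt_or_gt_of_ne h2 with g2 | g2 <;>
    rcases lt_or_gt_of_ne h3 with g3 | g3 <;> rcases lt_or_gt_of_ne h4 with g4 | g4 <;>
    simp [g1, g2, g3, g4, g1.not_gt, g2.not_gt, g3.not_gt, g4.not_gt] <;> linarith

lemma prod_sym2_offDiag {ι : Type*} {M : ℕ} (r : ι ≃ Fin M) (E : Finset ι) (F : Sym2 ι → ℝ) :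
    ∏ p ∈ E.sym2.filter (fun p => ¬ p.IsDiag), F p =
      ∏ e ∈ E, ∏ f ∈ E, if r f < r e then F s(e, f) else 1 := by
  rw [← Finset.prod_product' (f := fun e f => if r f < r e then F s(e, f) else 1),
    ← Finset.prod_filter]
  symm
  refine Finset.prod_bij (fun p _ => s(p.1, p.2)) ?_ ?_ ?_ fun _ _ => rfl
  · rintro ⟨e, f⟩ h
    simp only [Finset.mem_filter, Finset.mem_product] at h
    simp only [Finset.mem_filter, Finset.mk_mem_sym2_iff, Sym2.mk_isDiag_iff]
    exact ⟨h.1, fun hef => by simp [hef] at h⟩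
  · rintro ⟨e, f⟩ h ⟨e', f'⟩ h' hp
    simp only [Finset.mem_filter] at h h'
    rcases Sym2.eq_iff.1 hp with ⟨h1, h2⟩ | ⟨h1, h2⟩
    · simp only at h1 h2; rw [h1, h2]
    · simp only at h1 h2
      subst h1 h2
      exact absurd h.2 h'.2.not_gt
  · intro p hp
    induction p using Sym2.ind with
    | _ e f =>
      simp only [Finset.mem_filter, Finset.mk_mem_sym2_iff, Sym2.mk_isDiag_iff] at hp
      have hne : r e ≠ r f := fun h => hp.2 (r.injective h)
      rcases lt_or_gt_of_ne hne with h | h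
      · exact ⟨(f, e), by simp [hp.1, h], Sym2.eq_swap⟩
      · exact ⟨(e, f), by simp [hp.1, h], rfl⟩

variable {N M : ℕ}

lemma chordSgn_eq_BE {s : Finset (Fin N) → Finset (Fin N) → ℝ} {E : Finset (Finset (Fin N))}
    (hs : ∀ e ∈ E, ∀ f ∈ E, e ≠ f → s e f = if Odd (e ∩ f).card then -1 else 1)
    (r : Finset (Fin N) ≃ Fin M) {x : E ⊕ E → ℝ} (hx : Function.Injective x)
    {X : Finset (Fin N) → ℝ × ℝ}
    (hX : ∀ e : E, X e = (min (x (.inl e)) (x (.inr e)), max (x (.inl e)) (x (.inr e)))) :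
    chordSgn s r (lab E) x = BE E X := by
  unfold BE chordSgn
  refine Eq.trans ?_ ((prod_sym2_offDiag r E (pairSign X)).symm.trans
    (Finset.prod_congr (Finset.ext fun p => ?_) fun _ _ => rfl))
  swap
  · simp only [Finset.mem_filter, Finset.mem_sym2_iff]
  simp_rw [Fintype.prod_sum_type]
  rw [← Finset.prod_mul_distrib, ← Finset.prod_coe_sort E]
  refine Finset.prod_congr rfl fun e _ => ?_
  rw [← Finset.prod_coe_sort E, ← Finset.prod_mul_distrib, ← Finset.prod_mul_distrib,
    ← Finset.prod_mul_distrib]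
  refine Finset.prod_congr rfl fun f _ => ?_
  simp only [lab, Sum.elim_inl, Sum.elim_inr, pairSign, Sym2.lift_mk]
  by_cases h : r (f : Finset (Fin N)) < r e
  · have hne : (e : Finset (Fin N)) ≠ f := by rintro h'; simp [h'] at h
    have hne' : e ≠ f := fun h' => hne (by rw [h'])
    simp only [h, and_true, if_true, hs e e.2 f f.2 hne]
    by_cases ho : Odd ((e : Finset (Fin N)) ∩ f).card
    · simp only [if_pos ho]
      rw [hX, hX, K_minmax (hx.ne (by simpa using hne')) (hx.ne (by simp)) (hx.ne (by simp))
        (hx.ne (by simpa using hne'))]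
    · simp only [if_neg ho, ite_self, mul_one]
  · simp [h]

abbrev unitM : Measure ℝ := volume.restrict (Set.Icc (0 : ℝ) 1)

instance : IsProbabilityMeasure unitM := ⟨by simp [unitM]⟩

lemma ae_injective_pi (T : Type*) [Fintype T] :
    ∀ᵐ x ∂(Measure.pi fun _ : T => unitM), Function.Injective x := by
  have h1 : (Measure.pi fun _ : T => unitM) =
      (Measure.pi fun _ : T => (volume : Measure ℝ)).restrict
        (Set.univ.pi fun _ => Set.Icc (0 : ℝ) 1) :=
    (Measure.restrict_pi_pi _ _).symm
  rw [h1]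
  refine ae_restrict_of_ae ?_
  have h2 : ∀ a b : T, a ≠ b → ∀ᵐ x : T → ℝ, x a ≠ x b := by
    intro a b hab
    let V : Submodule ℝ (T → ℝ) := LinearMap.ker (LinearMap.proj (φ := fun _ : T => ℝ) (R := ℝ) a -
      LinearMap.proj (φ := fun _ : T => ℝ) b)
    have hV : V ≠ ⊤ := by
      intro h
      have : (Pi.single a 1 : T → ℝ) ∈ V := h ▸ Submodule.mem_top
      simp [V, LinearMap.mem_ker, hab.symm] at this
    have := Measure.addHaar_submodule (volume : Measure (T → ℝ)) V hV
    refine measure_mono_null (fun x hx => ?_) this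
    simp only [Set.mem_compl_iff, Set.mem_ofPred_eq, not_not] at hx
    change x a - x b = 0
    rw [hx, sub_self]
  have h3 : ∀ᵐ x : T → ℝ, ∀ a b : T, a ≠ b → x a ≠ x b := by
    rw [ae_all_iff]
    intro a
    rw [ae_all_iff]
    intro b
    by_cases hab : a = b
    · exact Eventually.of_forall fun x h => absurd hab h
    · filter_upwards [h2 a b hab] with x hx _ using hx
  filter_upwards [h3] with x hx a b h
  by_contra hab
  exact hx a b hab h

lemma measurePreserving_chords (κ : Type*) [Fintype κ] :
    MeasurePreserving (fun (x : κ ⊕ κ → ℝ) (e : κ) =>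
      (min (x (.inl e)) (x (.inr e)), max (x (.inl e)) (x (.inr e))))
      (Measure.pi fun _ => unitM) (nuPi κ) := by
  have h1 := measurePreserving_sumPiEquivProdPi (fun _ : κ ⊕ κ => unitM)
  have h2 := (measurePreserving_arrowProdEquivProdArrow ℝ ℝ κ (fun _ => unitM) (fun _ => unitM)).symm
  have h3 : MeasurePreserving (fun p : ℝ × ℝ => (min p.1 p.2, max p.1 p.2)) (unitM.prod unitM) nu := by
    refine ⟨measurable_minmax, ?_⟩
    rw [nu, Measure.volume_eq_prod, ← Measure.prod_restrict]
  have h4 := measurePreserving_pi (fun _ : κ => unitM.prod unitM) (fun _ => nu) fun _ => h3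
  exact h4.comp (h2.comp h1)

lemma measurePreserving_perm {T : Type*} [Fintype T] (π : Equiv.Perm T) :
    MeasurePreserving (fun (x : T → ℝ) (t : T) => x (π t))
      (Measure.pi fun _ => unitM) (Measure.pi fun _ => unitM) := by
  exact measurePreserving_arrowCongr' (fun _ : T => unitM) (fun _ : T => unitM) π.symm
    (MeasurableEquiv.refl ℝ) fun _ => MeasurePreserving.id _

lemma MeasurePreserving.integral_comp_of_measurable {α β : Type*} [MeasurableSpace α]
    [MeasurableSpace β] {μ : Measure α} {ν : Measure β} {f : α → β} (hf : MeasurePreserving f μ ν)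
    {g : β → ℝ} (hg : Measurable g) : ∫ x, g (f x) ∂μ = ∫ y, g y ∂ν := by
  rw [← hf.map_eq, integral_map hf.measurable.aemeasurable hg.aestronglyMeasurable]

/-- The extension of a family of chords by a constant chord. -/
def extendChords (E : Finset (Finset (Fin N))) (Y : E → ℝ × ℝ) (e : Finset (Fin N)) : ℝ × ℝ :=
  if h : e ∈ E then Y ⟨e, h⟩ else (0, 0)

lemma measurable_BE_extend (E : Finset (Finset (Fin N))) :
    Measurable fun Y : E → ℝ × ℝ => BE E (extendChords E Y) := by
  refine measurable_BE (fun e => ?_) E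
  unfold extendChords
  split_ifs with h
  · exact measurable_pi_apply _
  · exact measurable_const

lemma bT_eq_integral (E : Finset (Finset (Fin N))) :
    bT E = ∫ Y, BE E (extendChords E Y) ∂nuPi E := by
  rw [← MeasurePreserving.integral_comp_of_measurable
    (measurePreserving_comp_injective (Subtype.val_injective (p := fun e => e ∈ E)))
    (measurable_BE_extend E)]
  refine integral_congr_ae (Eventually.of_forall fun X => BE_congr fun e he => ?_)
  simp [extendChords, he]

lemma bT_eq_sum_wsgn {s : Finset (Fin N) → Finset (Fin N) → ℝ} {E : Finset (Finset (Fin N))}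
    (hs : ∀ e ∈ E, ∀ f ∈ E, e ≠ f → s e f = if Odd (e ∩ f).card then -1 else 1)
    (r : Finset (Fin N) ≃ Fin M) :
    bT E = ((2 * E.card).factorial : ℝ)⁻¹ *
        ∑ σ : Fin (2 * E.card) ≃ E ⊕ E, wsgn s r fun i => lab E (σ i) := by
  let lam : Measure (E ⊕ E → ℝ) := Measure.pi fun _ => unitM
  let ch : (E ⊕ E → ℝ) → E → ℝ × ℝ := fun x e =>
      (min (x (.inl e)) (x (.inr e)), max (x (.inl e)) (x (.inr e)))
  let F : (E ⊕ E → ℝ) → ℝ := fun x => BE E (extendChords E (ch x))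
  have hch : MeasurePreserving ch lam (nuPi E) := measurePreserving_chords E
  have hF : Measurable F := (measurable_BE_extend E).comp hch.measurable
  have hFx : ∀ x, Function.Injective x → F x = chordSgn s r (lab E) x := by
    intro x hx
    rw [chordSgn_eq_BE hs r hx (X := extendChords E (ch x))]
    intro e
    simp [extendChords, ch]
  have h1 : bT E = ∫ x, F x ∂lam := by
    rw [bT_eq_integral, ← MeasurePreserving.integral_comp_of_measurable hch (measurable_BE_extend E)]
  have hcard : Fintype.card (E ⊕ E) = 2 * E.card := by simp [two_mul]
  have hcp : Fintype.card (Equiv.Perm (E ⊕ E)) = (2 * E.card).factorial := by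
    rw [Fintype.card_perm, hcard]
  have h2 : ((2 * E.card).factorial : ℝ) * bT E =
      ∑ π : Equiv.Perm (E ⊕ E), ∫ x, F (fun t => x (π t)) ∂lam := by
    rw [Finset.sum_congr rfl fun π _ =>
      MeasurePreserving.integral_comp_of_measurable (measurePreserving_perm π) hF]
    rw [Finset.sum_const, Finset.card_univ, hcp, nsmul_eq_mul, h1]
  have h3 : ∑ π : Equiv.Perm (E ⊕ E), ∫ x, F (fun t => x (π t)) ∂lam =
      ∑ σ : Fin (2 * E.card) ≃ E ⊕ E, wsgn s r fun i => lab E (σ i) := by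
    rw [← integral_finsetSum]
    · trans ∫ x, (∑ σ : Fin (2 * E.card) ≃ E ⊕ E, wsgn s r fun i => lab E (σ i)) ∂lam
      · refine integral_congr_ae ?_
        filter_upwards [ae_injective_pi (E ⊕ E)] with x hx
        refine Eq.trans ?_ ((sum_chordSgn s r (lab E) hx hcard).trans ?_)
        · refine Finset.sum_congr ?_ fun π _ => hFx _ (hx.comp π.injective)
          ext; simp only [Finset.mem_univ]
        · refine Finset.sum_congr ?_ fun π _ => rfl
          ext; simp only [Finset.mem_univ]
      · simp
    · intro π _
      refine Integrable.of_bound (hF.comp (measurePreserving_perm π).measurable).aestronglyMeasurable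
        1 (Eventually.of_forall fun x => ?_)
      exact (abs_BE _ _).le
  rw [← h3, ← h2, inv_mul_cancel_left₀ (by positivity)]

/-- The leading coefficient of the connected weight is the chord expectation. -/
lemma wterm_eq_bT {s : Finset (Fin N) → Finset (Fin N) → ℝ} {E : Finset (Finset (Fin N))}
    (hs : ∀ e ∈ E, ∀ f ∈ E, e ≠ f → s e f = if Odd (e ∩ f).card then -1 else 1)
    (r : Finset (Fin N) ≃ Fin M) (g : ℝ) :
    wterm s r g (fun _ w => Finset.univ.image w = E) (2 * E.card) = (g ^ 2 / 2) ^ E.card * bT E := by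
  rw [bT_eq_sum_wsgn hs r]
  refine Eq.trans ?_ ((wterm_eq_sum_lift s r g E).trans ?_)
  · unfold wterm
    congr!
  · congr!

lemma abs_Ww_sub_bT_le {s : Finset (Fin N) → Finset (Fin N) → ℝ} {E : Finset (Finset (Fin N))}
    (hs1 : ∀ e f, |s e f| = 1)
    (hs : ∀ e ∈ E, ∀ f ∈ E, e ≠ f → s e f = if Odd (e ∩ f).card then -1 else 1)
    (r : Finset (Fin N) ≃ Fin M) {g : ℝ} (hg : 0 ≤ g) :
    |Ww s r g E - (g ^ 2 / 2) ^ E.card * bT E| ≤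
      (Real.cosh g - 1) ^ E.card - (g ^ 2 / 2) ^ E.card := by
  have h1 := abs_Ww_sub_wterm_le hs1 r hg E (2 * E.card)
  rw [wterm_one_lift] at h1
  rw [← wterm_eq_bT hs r]
  convert h1

end ChordIntegral

section Majorana

/-- Matrix of a tensor product of `2 × 2` matrices. -/
def tens {m : ℕ} (P : Fin m → Matrix (Fin 2) (Fin 2) ℂ) : Matrix (Fin m → Fin 2) (Fin m → Fin 2) ℂ :=
  fun a b => ∏ k, P k (a k) (b k)

lemma tens_mul {m : ℕ} (P Q : Fin m → Matrix (Fin 2) (Fin 2) ℂ) :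
    tens P * tens Q = tens fun k => P k * Q k := by
  ext a b
  simp only [Matrix.mul_apply, tens, Finset.prod_univ_sum, Fintype.piFinset_univ,
    Finset.prod_mul_distrib]

lemma tens_one {m : ℕ} : tens (fun _ : Fin m => (1 : Matrix (Fin 2) (Fin 2) ℂ)) = 1 := by
  ext a b
  rw [tens, Matrix.one_apply]
  split_ifs with h
  · exact Finset.prod_eq_one fun k _ => by rw [h]; exact Matrix.one_apply_eq _
  · obtain ⟨k, hk⟩ := Function.ne_iff.1 h
    exact Finset.prod_eq_zero (Finset.mem_univ k) (Matrix.one_apply_ne hk)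

lemma tens_smul {m : ℕ} (c : Fin m → ℂ) (P : Fin m → Matrix (Fin 2) (Fin 2) ℂ) :
    tens (fun k => c k • P k) = (∏ k, c k) • tens P := by
  ext a b
  simp [tens, Finset.prod_mul_distrib]

/-- The tensor factors of a Majorana matrix. -/
def majFactor (m : ℕ) (i : Fin (2 * m)) (k : Fin m) : Matrix (Fin 2) (Fin 2) ℂ :=
  if (k : ℕ) < (i : ℕ) / 2 then pZ
  else if (k : ℕ) = (i : ℕ) / 2 then (if (i : ℕ) % 2 = 0 then pX else pY)
  else 1

/-- The Majorana matrices normalized to be involutions. -/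
def maj (m : ℕ) (i : Fin (2 * m)) : Matrix (Fin m → Fin 2) (Fin m → Fin 2) ℂ := tens (majFactor m i)

lemma psiM_eq (m : ℕ) (i : Fin (2 * m)) : psiM m i = ((Real.sqrt 2 : ℝ) : ℂ)⁻¹ • maj m i := by
  ext a b
  simp only [psiM, maj, tens, majFactor, Matrix.smul_apply, smul_eq_mul]
  congr 1
  refine Finset.prod_congr rfl fun k _ => ?_
  split_ifs <;> simp_all [Matrix.one_apply]

lemma pX_sq : pX * pX = 1 := by ext i j; fin_cases i <;> fin_cases j <;> simp [pX]
lemma pY_sq : pY * pY = 1 := by ext i j; fin_cases i <;> fin_cases j <;> simp [pY]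
lemma pZ_sq : pZ * pZ = 1 := by ext i j; fin_cases i <;> fin_cases j <;> simp [pZ]
lemma pX_pY : pX * pY = -(pY * pX) := by
  ext i j; fin_cases i <;> fin_cases j <;> simp [pX, pY]
lemma pX_pZ : pX * pZ = -(pZ * pX) := by
  ext i j; fin_cases i <;> fin_cases j <;> simp [pX, pZ]
lemma pY_pZ : pY * pZ = -(pZ * pY) := by
  ext i j; fin_cases i <;> fin_cases j <;> simp [pY, pZ]

lemma maj_sq (m : ℕ) (i : Fin (2 * m)) : maj m i * maj m i = 1 := by
  rw [maj, tens_mul, ← tens_one]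
  congr 1
  funext k
  unfold majFactor
  split_ifs <;> simp [pX_sq, pY_sq, pZ_sq]

lemma maj_anticomm_of_lt {m : ℕ} {i j : Fin (2 * m)} (h : i < j) :
    maj m i * maj m j = -(maj m j * maj m i) := by
  have hi : (i : ℕ) / 2 < m := by have := i.2; omega
  have h' : (i : ℕ) < j := h
  rw [maj, maj, tens_mul, tens_mul]
  have : (fun k => majFactor m i k * majFactor m j k) =
      fun k => (if k = ⟨(i : ℕ) / 2, hi⟩ then (-1 : ℂ) else 1) • (majFactor m j k * majFactor m i k) := by
    funext k
    have hk : (k = ⟨(i : ℕ) / 2, hi⟩) ↔ (k : ℕ) = (i : ℕ) / 2 := Fin.ext_iff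
    simp only [hk]
    unfold majFactor
    rcases lt_trichotomy (k : ℕ) ((i : ℕ) / 2) with h1 | h1 | h1
    · have h2 : (k : ℕ) < (j : ℕ) / 2 := by omega
      simp [h1, h2, h1.ne]
    · have h0 : ¬ (k : ℕ) < (i : ℕ) / 2 := by omega
      rcases lt_or_ge (k : ℕ) ((j : ℕ) / 2) with h2 | h2
      · simp only [h1.symm, h2, if_true, lt_irrefl, if_false]
        split_ifs <;> simp [pX_pZ, pY_pZ]
      · have h3 : (k : ℕ) = (j : ℕ) / 2 := by omega
        have h4 : ¬ (k : ℕ) < (j : ℕ) / 2 := by omega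
        have h5 : (i : ℕ) % 2 = 0 := by omega
        have h6 : ¬ (j : ℕ) % 2 = 0 := by omega
        simp only [h1.symm, lt_irrefl, h3.symm, h5, h6, if_true, if_false]
        simp [pX_pY]
    · have h0 : ¬ (k : ℕ) < (i : ℕ) / 2 := by omega
      simp only [h0, h1.ne', if_false]
      simp
  rw [this, tens_smul, Finset.prod_ite_eq']
  simp

lemma maj_comm (m : ℕ) (i j : Fin (2 * m)) :
    maj m i * maj m j = (-(if i = j then -1 else 1) : ℝ) • (maj m j * maj m i) := by
  rcases lt_trichotomy i j with h | h | h
  · rw [maj_anticomm_of_lt h, if_neg h.ne]; simp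
  · subst h; simp
  · rw [maj_anticomm_of_lt h, if_neg h.ne']; simp

section Words

variable {R κ : Type*} [Ring R] [Algebra ℝ R]

lemma mul_list_prod_comm {x : κ → R} {c : κ → κ → ℝ} (h : ∀ i j, x i * x j = c i j • (x j * x i))
    (i : κ) (l : List κ) :
    x i * (l.map x).prod = (l.map (c i)).prod • ((l.map x).prod * x i) := by
  induction l with
  | nil => simp
  | cons j l ih =>
    simp only [List.map_cons, List.prod_cons]
    rw [← mul_assoc, h, smul_mul_assoc, mul_assoc, ih, mul_smul_comm, smul_smul, mul_assoc]

lemma list_prod_comm {x : κ → R} {c : κ → κ → ℝ} (h : ∀ i j, x i * x j = c i j • (x j * x i))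
    (l l' : List κ) :
    (l.map x).prod * (l'.map x).prod =
      (l.map fun i => (l'.map (c i)).prod).prod • ((l'.map x).prod * (l.map x).prod) := by
  induction l with
  | nil => simp
  | cons j l ih =>
    simp only [List.map_cons, List.prod_cons]
    rw [mul_assoc, ih, mul_smul_comm, ← mul_assoc, mul_list_prod_comm h, smul_mul_assoc, smul_smul,
      mul_comm, mul_assoc]

lemma list_prod_sq {x : κ → R} (h : ∀ i j, x i * x j = (-(if i = j then -1 else 1) : ℝ) • (x j * x i))
    (h2 : ∀ i, x i * x i = 1) (l : List κ) (hl : l.Nodup) :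
    (l.map x).prod * (l.map x).prod = ((-1 : ℝ) ^ l.length.choose 2) • (1 : R) := by
  induction l with
  | nil => simp
  | cons j l ih =>
    rw [List.nodup_cons] at hl
    have h1 := mul_list_prod_comm h j l
    have h3 : (l.map fun i => (-(if j = i then -1 else 1) : ℝ)).prod = (-1) ^ l.length := by
      rw [List.map_congr_left (g := fun _ => (-1 : ℝ))]
      · simp
      · intro i hi
        rw [if_neg (by rintro rfl; exact hl.1 hi)]
    rw [h3] at h1
    simp only [List.map_cons, List.prod_cons, List.length_cons]
    calc x j * (l.map x).prod * (x j * (l.map x).prod)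
        = x j * ((l.map x).prod * x j) * (l.map x).prod := by simp only [mul_assoc]
      _ = (-1 : ℝ) ^ l.length • (x j * x j * ((l.map x).prod * (l.map x).prod)) := by
          have h4 : (l.map x).prod * x j = (-1 : ℝ) ^ l.length • (x j * (l.map x).prod) := by
            rw [h1, smul_smul, ← mul_pow]; simp
          rw [h4]
          simp only [mul_smul_comm, smul_mul_assoc, mul_assoc]
      _ = _ := by
          rw [h2, one_mul, ih hl.2, smul_smul, ← pow_add, Nat.choose_succ_succ' l.length 1,
            Nat.choose_one_right]

end Words

lemma neg_one_pow_choose_two {R : Type*} [Monoid R] [HasDistribNeg R] (p : ℕ) :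
    (-1 : R) ^ (2 * p).choose 2 = (-1) ^ p := by
  induction p with
  | zero => simp
  | succ p ih =>
    have : (2 * (p + 1)).choose 2 = (2 * p).choose 2 + 2 * (2 * p) + 1 := by
      rw [show 2 * (p + 1) = 2 * p + 1 + 1 by ring, Nat.choose_succ_succ' (2 * p + 1) 1,
        Nat.choose_succ_succ' (2 * p) 1, Nat.choose_one_right, Nat.choose_one_right]
      ring
    rw [this, pow_succ, pow_add, ih, pow_mul]
    simp [pow_succ]

/-- The commutation signs of the interaction terms. -/
def comSgn {N : ℕ} (q : ℕ) (e f : Finset (Fin N)) : ℝ :=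
  if e.card = q ∧ f.card = q ∧ Odd (e ∩ f).card then -1 else 1

/-- The interaction terms, normalized to be involutions. -/
def interM (m q : ℕ) (e : Finset (Fin (2 * m))) : Matrix (Fin m → Fin 2) (Fin m → Fin 2) ℂ :=
  if e.card = q then Complex.I ^ (q / 2) • ((e.sort (· ≤ ·)).map (maj m)).prod else 1

lemma prod_map_smul {m : ℕ} (c : ℂ) (l : List (Fin (2 * m))) :
    (l.map fun i => c • maj m i).prod = c ^ l.length • (l.map (maj m)).prod := by
  induction l with
  | nil => simp
  | cons i l ih =>
    simp only [List.map_cons, List.prod_cons, List.length_cons, ih]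
    rw [smul_mul_smul_comm, pow_succ']

lemma psiMSet_eq {m q : ℕ} (hq : Even q) {e : Finset (Fin (2 * m))} (he : e.card = q) :
    psiMSet m q e = (((2 : ℝ) ^ (q / 2))⁻¹ : ℝ) • interM m q e := by
  rw [psiMSet, interM, if_pos he]
  have h1 : psiM m = fun i => ((Real.sqrt 2 : ℝ) : ℂ)⁻¹ • maj m i := funext (psiM_eq m)
  rw [h1, prod_map_smul, Finset.length_sort, he, smul_comm]
  obtain ⟨p, rfl⟩ := hq
  have h2 : (((Real.sqrt 2 : ℝ) : ℂ)⁻¹) ^ (p + p) = (((2 : ℝ) ^ ((p + p) / 2))⁻¹ : ℝ) := by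
    rw [← two_mul, pow_mul, Nat.mul_div_cancel_left p two_pos, ← Complex.ofReal_inv,
      ← Complex.ofReal_pow, ← Complex.ofReal_pow, inv_pow, inv_pow, Real.sq_sqrt two_pos.le]
  rw [h2]
  ext a b
  simp

lemma interM_sq {m q : ℕ} (hq : Even q) (e : Finset (Fin (2 * m))) :
    interM m q e * interM m q e = 1 := by
  unfold interM
  split_ifs with he
  · rw [smul_mul_smul_comm, list_prod_sq (fun i j => by convert maj_comm m i j) (maj_sq m) _ (Finset.sort_nodup _ _),
      Finset.length_sort, he]
    obtain ⟨p, rfl⟩ := hq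
    rw [← two_mul, neg_one_pow_choose_two, Nat.mul_div_cancel_left p two_pos, ← mul_pow, Complex.I_mul_I]
    ext a b
    simp only [Matrix.smul_apply, smul_eq_mul, Complex.real_smul]
    push_cast
    rw [← mul_assoc, ← mul_pow]
    simp
  · simp

lemma prod_commutation {N q : ℕ} (hq : Even q) {e f : Finset (Fin N)} (hf : f.card = q) :
    ∏ i ∈ e, ∏ j ∈ f, (-(if i = j then -1 else 1) : ℝ) = if Odd (e ∩ f).card then -1 else 1 := by
  have h1 : ∀ i ∈ e, ∏ j ∈ f, (-(if i = j then -1 else 1) : ℝ) = if i ∈ f then -1 else 1 := by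
    intro i _
    rw [Finset.prod_neg, hf, hq.neg_one_pow, one_mul, Finset.prod_ite_eq]
  rw [Finset.prod_congr rfl h1, Finset.prod_ite_mem, Finset.prod_const]
  split_ifs with h
  · exact h.neg_one_pow
  · exact (Nat.not_odd_iff_even.1 h).neg_one_pow

lemma interM_comm {m q : ℕ} (hq : Even q) (e f : Finset (Fin (2 * m))) :
    interM m q e * interM m q f = comSgn q e f • (interM m q f * interM m q e) := by
  unfold interM comSgn
  by_cases he : e.card = q
  · by_cases hf : f.card = q
    · rw [if_pos he, if_pos hf, smul_mul_smul_comm, list_prod_comm (maj_comm m), smul_mul_smul_comm,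
        smul_comm]
      congr 1
      have h1 : ∀ (g : Fin (2 * m) → ℝ) (e : Finset (Fin (2 * m))),
          ((e.sort (· ≤ ·)).map g).prod = ∏ i ∈ e, g i := by
        intro g e
        rw [← List.prod_toFinset g (Finset.sort_nodup e _), Finset.sort_toFinset]
      simp only [h1, prod_commutation hq hf, he, hf, true_and]
    · simp [hf]
  · simp [he]

end Majorana

section Partition

/-- All possible interaction sets. -/
def edges (q N : ℕ) : Finset (Finset (Fin N)) := Finset.univ.filter fun e => e.card = q

/-- The coupling constant of the normalized interaction terms. -/
def coupling (q : ℕ) (β : ℝ) (n : ℕ) : ℝ := |β| * sigma q n * ((2 : ℝ) ^ (q / 2))⁻¹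

lemma coupling_nonneg (q : ℕ) (β : ℝ) (n : ℕ) : 0 ≤ coupling q β n := by
  unfold coupling sigma; positivity

attribute [local instance] Matrix.linftyOpNormedRing Matrix.linftyOpNormedAlgebra

lemma smul_Hsyk_eq {m q : ℕ} (hq : Even q) (β : ℝ) (ε : Finset (Fin (2 * m)) → Bool) :
    (β : ℂ) • Hsyk m q (fun I => ε I.1) =
      (β * sigma q (2 * m) * ((2 : ℝ) ^ (q / 2))⁻¹) • ham (interM m q) (edges q (2 * m)) ε := by
  have h1 : ham (interM m q) (edges q (2 * m)) ε = ∑ e ∈ edges q (2 * m), eps (ε e) • interM m q e :=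
    (Finset.sum_subset (Finset.subset_univ (edges q (2 * m))) fun e _ he => by simp [he]).symm.trans
      (Finset.sum_congr rfl fun e he => by rw [if_pos he])
  unfold Hsyk
  rw [h1, Finset.smul_sum, Finset.smul_sum,
    Finset.sum_subtype (F := Subtype.fintype _) (edges q (2 * m)) (p := fun I => I.card = q) (by simp [edges])]
  refine Finset.sum_congr (by ext; simp) fun I _ => ?_
  rw [psiMSet_eq hq I.2]
  ext a b
  simp only [Matrix.smul_apply, smul_eq_mul, Complex.real_smul, eps]
  push_cast
  ring

lemma sum_restrict {α : Type*} [Fintype α] {M : Type*} [AddCommMonoid M] [Module ℂ M] (p : α → Prop)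
    (F : ({a // p a} → Bool) → M) :
    ∑ ε : α → Bool, F (fun a => ε a.1) = (2 : ℂ) ^ (Fintype.card {a // ¬ p a}) • ∑ s, F s := by
  rw [← (Equiv.piEquivPiSubtypeProd p fun _ => Bool).symm.sum_comp, Fintype.sum_prod_type]
  have h1 : ∀ (x : {a // p a} → Bool) (y : {a // ¬ p a} → Bool),
      F (fun a => (Equiv.piEquivPiSubtypeProd p fun _ => Bool).symm (x, y) a.1) = F x := by
    intro x y
    congr 1
    funext a
    simp [Equiv.piEquivPiSubtypeProd, a.2]
  simp only [h1]
  simp only [Finset.sum_const, Finset.card_univ, Fintype.card_fun, Fintype.card_bool, Finset.smul_sum]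
  refine Finset.sum_congr rfl fun s _ => ?_
  rw [← Nat.cast_smul_eq_nsmul ℂ]
  push_cast
  rfl

lemma abs_comSgn {N : ℕ} (q : ℕ) (e f : Finset (Fin N)) : |comSgn q e f| = 1 := by
  unfold comSgn; split_ifs <;> simp

lemma expM_eq_exp {m : ℕ} (A : Matrix (Fin m → Fin 2) (Fin m → Fin 2) ℂ) :
    expM A = NormedSpace.exp A := by
  rw [NormedSpace.exp_eq_tsum ℂ]
  rfl

lemma sum_exp_abs {m q : ℕ} (β g : ℝ) (E) :
    ∑ ε : Finset (Fin (2 * m)) → Bool, NormedSpace.exp ((β * g) • ham (interM m q) E ε) =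
      ∑ ε : Finset (Fin (2 * m)) → Bool, NormedSpace.exp ((|β| * g) • ham (interM m q) E ε) := by
  rcases le_total 0 β with h | h
  · rw [abs_of_nonneg h]
  · rw [abs_of_nonpos h]
    have hinv : Function.Involutive
        (fun (ε : Finset (Fin (2 * m)) → Bool) => fun e => !(ε e)) := fun ε => by funext e; simp
    rw [← Equiv.sum_comp (hinv.toPerm _)]
    refine Finset.sum_congr rfl fun ε _ => ?_
    congr 1
    rw [neg_mul, neg_smul, ← smul_neg]
    congr 1
    unfold ham
    rw [← Finset.sum_neg_distrib]
    refine Finset.sum_congr rfl fun e _ => ?_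
    rw [← neg_smul]
    congr 1
    have : (hinv.toPerm _ ε) e = !(ε e) := rfl
    rw [this]
    split_ifs
    · cases ε e <;> simp [eps]
    · simp

lemma EZ_eq {m q : ℕ} (hq : Even q) (β : ℝ) {M : ℕ} (r : Finset (Fin (2 * m)) ≃ Fin M) :
    EZ m q β = (Fw (comSgn q) r (coupling q β (2 * m)) (edges q (2 * m)) : ℝ) := by
  have h1 := sum_exp_ham (R := Matrix (Fin m → Fin 2) (Fin m → Fin 2) ℂ) (abs_comSgn q)
    (interM_comm (m := m) hq) (interM_sq hq) r (coupling q β (2 * m)) (edges q (2 * m))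
  unfold coupling at h1
  rw [mul_assoc] at h1
  replace h1 := (sum_exp_abs β _ _).trans (Eq.trans (Finset.sum_congr (by ext; simp) fun _ _ => rfl) h1)
  simp only [← mul_assoc, ← smul_Hsyk_eq hq β, ← expM_eq_exp] at h1
  have h2 := sum_restrict (fun I : Finset (Fin (2 * m)) => I.card = q)
    (fun s => expM ((β : ℂ) • Hsyk m q s))
  replace h1 := h2.symm.trans (Eq.trans (Finset.sum_congr (by ext; simp) fun _ _ => rfl) h1)
  have h3 := congrArg Matrix.trace h1
  rw [Matrix.trace_smul, Matrix.trace_smul, Matrix.trace_one, Matrix.trace_sum] at h3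
  unfold EZ coupling
  rw [← Finset.mul_sum]
  have h4 : Fintype.card (Finset (Fin (2 * m))) =
      Fintype.card {I : Finset (Fin (2 * m)) // ¬ I.card = q} +
        Fintype.card {I : Finset (Fin (2 * m)) // I.card = q} := by
    rw [add_comm]
    convert (Fintype.card_congr (Equiv.sumCompl fun I : Finset (Fin (2 * m)) => I.card = q)).symm using 1
    rw [Fintype.card_sum]
  rw [h4, pow_add] at h3
  simp only [Fintype.card_fun, Fintype.card_fin, smul_eq_mul, Complex.real_smul] at h3
  push_cast at h3 ⊢
  rw [div_eq_iff (pow_ne_zero _ two_ne_zero), inv_mul_eq_iff_eq_mul₀ (pow_ne_zero _ two_ne_zero)]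
  refine mul_left_cancel₀ (pow_ne_zero (Fintype.card {I : Finset (Fin (2 * m)) // ¬ I.card = q})
    (two_ne_zero : (2 : ℂ) ≠ 0)) ?_
  refine Eq.trans ?_ (h3.trans ?_)
  · congr!
  · ring_nf

end Partition

section Weights

/-- The contribution of a hypergraph to the partition function. -/
def Wn (q N : ℕ) (g : ℝ) (E : Finset (Finset (Fin N))) : ℝ :=
  Ww (comSgn q) (Fintype.equivFin (Finset (Fin N))) g E

lemma EZ_re {m q : ℕ} (hq : Even q) (β : ℝ) :
    (EZ m q β).re = ∑ E ∈ (edges q (2 * m)).powerset, Wn q (2 * m) (coupling q β (2 * m)) E := by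
  rw [EZ_eq hq β (Fintype.equivFin (Finset (Fin (2 * m)))), Complex.ofReal_re,
    Fw_eq_sum_Ww (abs_comSgn q)]
  rfl

lemma abs_Wn_le {q N : ℕ} {g : ℝ} (hg : 0 ≤ g) (E : Finset (Finset (Fin N))) :
    |Wn q N g E| ≤ (Real.cosh g - 1) ^ E.card := abs_Ww_le (abs_comSgn q) _ hg E

lemma abs_Wn_sub_le {q N : ℕ} {g : ℝ} (hg : 0 ≤ g) {E : Finset (Finset (Fin N))}
    (hE : ∀ e ∈ E, e.card = q) :
    |Wn q N g E - (g ^ 2 / 2) ^ E.card * bT E| ≤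
      (Real.cosh g - 1) ^ E.card - (g ^ 2 / 2) ^ E.card :=
  abs_Ww_sub_bT_le (abs_comSgn q)
    (fun e he f hf _ => by simp only [comSgn, hE e he, hE f hf, true_and]) _ hg

lemma Wn_empty {q N : ℕ} {g : ℝ} (hg : 0 ≤ g) : Wn q N g ∅ = 1 := by
  have h1 := abs_Wn_sub_le (q := q) (N := N) hg (E := ∅) (by simp)
  have h2 : bT (∅ : Finset (Finset (Fin N))) = 1 := by
    simp [bT, BE]
  rw [h2] at h1
  simpa [sub_eq_zero] using h1

attribute [local instance] Matrix.linftyOpNormedRing Matrix.linftyOpNormedAlgebra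

lemma Wn_union {m q : ℕ} (hq : Even q) (g : ℝ) {D E : Finset (Finset (Fin (2 * m)))}
    (hDE : Disjoint D E) (h : ∀ e ∈ D, ∀ f ∈ E, Disjoint e f) :
    Wn q (2 * m) g (D ∪ E) = Wn q (2 * m) g D * Wn q (2 * m) g E := by
  let _ : NormedAlgebra ℚ (Matrix (Fin m → Fin 2) (Fin m → Fin 2) ℂ) :=
    NormedAlgebra.restrictScalars ℚ ℝ _
  have h1 := Ww_union (R := Matrix (Fin m → Fin 2) (Fin m → Fin 2) ℂ) (abs_comSgn q)
    (interM_comm (m := m) hq) (interM_sq hq) (Fintype.equivFin (Finset (Fin (2 * m)))) g hDE fun e he f hf => by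
      rw [comSgn, Finset.disjoint_iff_inter_eq_empty.1 (h e he f hf)]
      simp
  unfold Wn
  convert h1

lemma Wn_map {m q : ℕ} (hq : Even q) (g : ℝ) (π : Equiv.Perm (Fin (2 * m)))
    (E : Finset (Finset (Fin (2 * m)))) :
    Wn q (2 * m) g (E.map (Equiv.finsetCongr π).toEmbedding) = Wn q (2 * m) g E := by
  refine Ww_map (R := Matrix (Fin m → Fin 2) (Fin m → Fin 2) ℂ)
    (interM_comm (m := m) hq) (interM_sq hq) _ g (Equiv.finsetCongr π) (fun e f => ?_) E
  unfold comSgn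
  rw [Equiv.finsetCongr_apply, Equiv.finsetCongr_apply, Finset.card_map, Finset.card_map,
    ← Finset.map_inter, Finset.card_map]

end Weights

section Clusters

variable {N : ℕ}

/-- The possible interactions inside `V`. -/
def edgesIn (q : ℕ) (V : Finset (Fin N)) : Finset (Finset (Fin N)) := V.powersetCard q

lemma mem_edgesIn {q : ℕ} {V e : Finset (Fin N)} : e ∈ edgesIn q V ↔ e.card = q ∧ e ⊆ V := by
  simp [edgesIn, and_comm]

/-- The connected hypergraphs on `V`. -/
def CE (q : ℕ) (V : Finset (Fin N)) : Finset (Finset (Finset (Fin N))) :=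
  (edgesIn q V).powerset.filter fun E => ∀ a ∈ V, ∀ b ∈ V, Relation.ReflTransGen (edgeRel E) a b

lemma mem_CE {q : ℕ} {V : Finset (Fin N)} {E : Finset (Finset (Fin N))} :
    E ∈ CE q V ↔ E ⊆ edgesIn q V ∧ ∀ a ∈ V, ∀ b ∈ V, Relation.ReflTransGen (edgeRel E) a b := by
  simp [CE]

lemma CE_eq_RE {q : ℕ} {V : Finset (Fin N)} {x : Fin N} (hx : x ∈ V) :
    CE q V = RE q {x} (V.erase x) := by
  ext E
  have hV : {x} ∪ V.erase x = V := by
    rw [← Finset.insert_eq, Finset.insert_erase hx]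
  rw [mem_CE, mem_RE, hV]
  refine and_congr ⟨fun h e he => mem_edgesIn.1 (h he), fun h e he => mem_edgesIn.2 (h e he)⟩ ?_
  constructor
  · exact fun h v hv => ⟨x, Finset.mem_singleton_self x, h x hx v (Finset.mem_of_mem_erase hv)⟩
  · intro h
    have h1 : ∀ a ∈ V, Relation.ReflTransGen (edgeRel E) x a := by
      intro a ha
      by_cases hax : a = x
      · rw [hax]
      · obtain ⟨s, hs, h2⟩ := h a (Finset.mem_erase.2 ⟨hax, ha⟩)
        rwa [Finset.mem_singleton.1 hs] at h2
    exact fun a ha b hb => (edgeRel_symm (h1 a ha)).trans (h1 b hb)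

/-- The connected component of `x`. -/
def comp (E : Finset (Finset (Fin N))) (x : Fin N) : Finset (Fin N) :=
  Finset.univ.filter fun v => Relation.ReflTransGen (edgeRel E) x v

lemma mem_comp {E : Finset (Finset (Fin N))} {x v : Fin N} :
    v ∈ comp E x ↔ Relation.ReflTransGen (edgeRel E) x v := by simp [comp]

lemma self_mem_comp (E : Finset (Finset (Fin N))) (x : Fin N) : x ∈ comp E x :=
  mem_comp.2 .refl

lemma comp_subset {E : Finset (Finset (Fin N))} {x : Fin N} {C : Finset (Fin N)} (hx : x ∈ C)
    (h : ∀ e ∈ E, ∀ a ∈ e, a ∈ C → e ⊆ C) : comp E x ⊆ C := by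
  intro v hv
  rw [mem_comp] at hv
  induction hv with
  | refl => exact hx
  | tail _ h2 ih =>
    obtain ⟨e, he, ha, hb⟩ := h2
    exact h e he _ ha ih hb

lemma subset_comp_of_mem {E : Finset (Finset (Fin N))} {x a : Fin N} {e : Finset (Fin N)} (he : e ∈ E)
    (hae : a ∈ e) (ha : a ∈ comp E x) : e ⊆ comp E x := fun _ hb =>
  mem_comp.2 ((mem_comp.1 ha).tail ⟨e, he, hae, hb⟩)

lemma reach_filter {E : Finset (Finset (Fin N))} {x v : Fin N}
    (h : Relation.ReflTransGen (edgeRel E) x v) :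
    Relation.ReflTransGen (edgeRel (E.filter (· ⊆ comp E x))) x v := by
  induction h with
  | refl => exact .refl
  | tail h1 h2 ih =>
    obtain ⟨e, he, ha, hb⟩ := h2
    exact ih.tail ⟨e, Finset.mem_filter.2 ⟨he, subset_comp_of_mem he ha (mem_comp.2 h1)⟩, ha, hb⟩

lemma disjoint_of_not_subset_comp {E : Finset (Finset (Fin N))} {x : Fin N} {e : Finset (Fin N)} (he : e ∈ E)
    (h : ¬ e ⊆ comp E x) : Disjoint e (comp E x) :=
  Finset.disjoint_left.2 fun _ ha hc => h (subset_comp_of_mem he ha hc)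

lemma sum_fiber_comp {q : ℕ} (hq : 1 ≤ q) {w : Finset (Finset (Fin N)) → ℝ}
    (hw : ∀ D E, Disjoint D E → (∀ e ∈ D, ∀ f ∈ E, Disjoint e f) → w (D ∪ E) = w D * w E)
    {V C : Finset (Fin N)} {x : Fin N} (hC : C ⊆ V) (hx : x ∈ C) :
    ∑ E ∈ (edgesIn q V).powerset.filter (fun E => comp E x = C), w E =
      (∑ E ∈ CE q C, w E) * ∑ E ∈ (edgesIn q (V \ C)).powerset, w E := by
  rw [Finset.sum_mul_sum, ← Finset.sum_product']
  have hne : ∀ {e : Finset (Fin N)}, e.card = q → e.Nonempty := fun h =>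
    Finset.card_pos.1 (by omega)
  have hnot : ∀ {E : Finset (Finset (Fin N))}, E ⊆ edgesIn q (V \ C) → ∀ e ∈ E, Disjoint e C := by
    intro E hE e he
    exact Finset.disjoint_of_subset_left (mem_edgesIn.1 (hE he)).2 Finset.sdiff_disjoint
  have hnot' : ∀ {E : Finset (Finset (Fin N))}, E ⊆ edgesIn q (V \ C) → ∀ e ∈ E, ¬ e ⊆ C := by
    intro E hE e he h
    obtain ⟨a, ha⟩ := hne (mem_edgesIn.1 (hE he)).1
    exact Finset.disjoint_left.1 (hnot hE e he) ha (h ha)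
  have hin : ∀ {E : Finset (Finset (Fin N))}, E ∈ CE q C → ∀ e ∈ E, e ⊆ C := fun hE e he =>
    (mem_edgesIn.1 ((mem_CE.1 hE).1 he)).2
  refine Finset.sum_bij' (fun E _ => (E.filter (· ⊆ C), E.filter fun e => ¬ e ⊆ C))
    (fun p _ => p.1 ∪ p.2) ?_ ?_ ?_ ?_ ?_
  · intro E hE
    obtain ⟨h1, h2⟩ := Finset.mem_filter.1 hE
    rw [Finset.mem_powerset] at h1
    refine Finset.mem_product.2 ⟨mem_CE.2 ⟨fun e he => ?_, ?_⟩, Finset.mem_powerset.2 fun e he => ?_⟩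
    · obtain ⟨h3, h4⟩ := Finset.mem_filter.1 he
      exact mem_edgesIn.2 ⟨(mem_edgesIn.1 (h1 h3)).1, h4⟩
    · have h3 : ∀ a ∈ C, Relation.ReflTransGen (edgeRel (E.filter (· ⊆ C))) x a := by
        intro a ha
        subst h2
        exact reach_filter (mem_comp.1 ha)
      exact fun a ha b hb => (edgeRel_symm (h3 a ha)).trans (h3 b hb)
    · obtain ⟨h3, h4⟩ := Finset.mem_filter.1 he
      obtain ⟨h5, h6⟩ := mem_edgesIn.1 (h1 h3)
      subst h2
      exact mem_edgesIn.2 ⟨h5, Finset.subset_sdiff.2 ⟨h6, disjoint_of_not_subset_comp h3 h4⟩⟩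
  · rintro ⟨D, E⟩ hDE
    obtain ⟨h1, h2⟩ := Finset.mem_product.1 hDE
    rw [Finset.mem_powerset] at h2
    simp only at h1 h2
    refine Finset.mem_filter.2 ⟨Finset.mem_powerset.2 (Finset.union_subset ?_ ?_), ?_⟩
    · intro e he
      have := mem_edgesIn.1 ((mem_CE.1 h1).1 he)
      exact mem_edgesIn.2 ⟨this.1, this.2.trans hC⟩
    · intro e he
      have := mem_edgesIn.1 (h2 he)
      exact mem_edgesIn.2 ⟨this.1, this.2.trans Finset.sdiff_subset⟩
    · apply Finset.Subset.antisymm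
      · refine comp_subset hx fun e he a hae haC => ?_
        rcases Finset.mem_union.1 he with h | h
        · exact hin h1 e h
        · exact absurd haC (Finset.disjoint_left.1 (hnot h2 e h) hae)
      · intro v hv
        exact mem_comp.2 (edgeRel_mono Finset.subset_union_left ((mem_CE.1 h1).2 x hx v hv))
  · intro E _
    exact Finset.filter_union_filter_not_eq _ _
  · rintro ⟨D, E⟩ hDE
    obtain ⟨h1, h2⟩ := Finset.mem_product.1 hDE
    rw [Finset.mem_powerset] at h2
    simp only at h1 h2
    simp only [Finset.filter_union]
    rw [Finset.filter_true_of_mem (hin h1), Finset.filter_false_of_mem (hnot' h2),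
      Finset.filter_false_of_mem (fun e he h => h (hin h1 e he)), Finset.filter_true_of_mem (hnot' h2)]
    simp
  · intro E hE
    obtain ⟨h1, h2⟩ := Finset.mem_filter.1 hE
    rw [← hw, Finset.filter_union_filter_not_eq]
    · exact Finset.disjoint_filter_filter_not _ _ _
    · intro e he f hf
      subst h2
      exact (Finset.disjoint_of_subset_right (Finset.mem_filter.1 he).2
        (disjoint_of_not_subset_comp (Finset.mem_filter.1 hf).1 (Finset.mem_filter.1 hf).2)).symm

lemma sum_powerset_edgesIn {q : ℕ} (hq : 1 ≤ q) {w : Finset (Finset (Fin N)) → ℝ}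
    (hw : ∀ D E, Disjoint D E → (∀ e ∈ D, ∀ f ∈ E, Disjoint e f) → w (D ∪ E) = w D * w E)
    {V : Finset (Fin N)} {x : Fin N} (hx : x ∈ V) :
    ∑ E ∈ (edgesIn q V).powerset, w E = ∑ U ∈ (V.erase x).powerset,
      (∑ E ∈ CE q (insert x U), w E) * ∑ E ∈ (edgesIn q (V \ insert x U)).powerset, w E := by
  rw [← Finset.sum_fiberwise_of_maps_to (s := (edgesIn q V).powerset) (t := (V.erase x).powerset)
    (g := fun E => (comp E x).erase x)]
  · refine Finset.sum_congr rfl fun U hU => ?_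
    have hU' := Finset.mem_powerset.1 hU
    have hxU : x ∉ U := fun h => (Finset.mem_erase.1 (hU' h)).1 rfl
    rw [← sum_fiber_comp hq hw (Finset.insert_subset hx (hU'.trans (Finset.erase_subset _ _)))
      (Finset.mem_insert_self x U)]
    refine Finset.sum_congr (Finset.filter_congr fun E _ => ?_) fun _ _ => rfl
    constructor
    · rintro rfl
      rw [Finset.insert_erase (self_mem_comp E x)]
    · intro h
      rw [h, Finset.erase_insert hxU]
  · intro E hE
    refine Finset.mem_powerset.2 (Finset.erase_subset_erase _ (comp_subset hx fun e he _ _ _ => ?_))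
    exact (mem_edgesIn.1 (Finset.mem_powerset.1 hE he)).2

end Clusters

section Symmetry

variable {N : ℕ}

lemma exists_perm_map_eq {α : Type*} [Fintype α] {V V' : Finset α} (h : V.card = V'.card) :
    ∃ π : Equiv.Perm α, V.map π.toEmbedding = V' := by
  have e : {x // x ∈ V} ≃ {x // x ∈ V'} := Fintype.equivOfCardEq (by simp [h])
  refine ⟨e.extendSubtype, Finset.eq_of_subset_of_card_le ?_ (by rw [Finset.card_map, h])⟩
  intro v hv
  obtain ⟨a, ha, rfl⟩ := Finset.mem_map.1 hv
  exact e.extendSubtype_mem a ha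

lemma mem_map_finsetCongr {π : Equiv.Perm (Fin N)} {E : Finset (Finset (Fin N))} {e : Finset (Fin N)} :
    e.map π.toEmbedding ∈ E.map (Equiv.finsetCongr π).toEmbedding ↔ e ∈ E :=
  Finset.mem_map' (f := (Equiv.finsetCongr π).toEmbedding)

lemma map_subset_edgesIn {q : ℕ} {π : Equiv.Perm (Fin N)} {V : Finset (Fin N)} {E : Finset (Finset (Fin N))}
    : E.map (Equiv.finsetCongr π).toEmbedding ⊆ edgesIn q (V.map π.toEmbedding) ↔ E ⊆ edgesIn q V := by
  constructor
  · intro h e he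
    have := mem_edgesIn.1 (h (mem_map_finsetCongr.2 he))
    rw [Finset.card_map, Finset.map_subset_map] at this
    exact mem_edgesIn.2 this
  · intro h e he
    obtain ⟨f, hf, rfl⟩ := Finset.mem_map.1 he
    have := mem_edgesIn.1 (h hf)
    refine mem_edgesIn.2 ?_
    simpa [Function.onFun] using this

lemma edgeRel_map {π : Equiv.Perm (Fin N)} {E : Finset (Finset (Fin N))} {a b : Fin N} :
    edgeRel (E.map (Equiv.finsetCongr π).toEmbedding) (π a) (π b) ↔ edgeRel E a b := by
  constructor
  · rintro ⟨e, he, h1, h2⟩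
    obtain ⟨f, hf, rfl⟩ := Finset.mem_map.1 he
    exact ⟨f, hf, (Finset.mem_map' (f := π.toEmbedding)).1 h1, (Finset.mem_map' (f := π.toEmbedding)).1 h2⟩
  · rintro ⟨e, he, h1, h2⟩
    exact ⟨_, mem_map_finsetCongr.2 he, Finset.mem_map_of_mem _ h1, Finset.mem_map_of_mem _ h2⟩

lemma reach_map {π : Equiv.Perm (Fin N)} {E : Finset (Finset (Fin N))} {a b : Fin N} :
    Relation.ReflTransGen (edgeRel (E.map (Equiv.finsetCongr π).toEmbedding)) (π a) (π b) ↔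
      Relation.ReflTransGen (edgeRel E) a b := by
  constructor
  · intro h
    have := Relation.ReflTransGen.lift (p := edgeRel E) (f := π.symm) (fun c d hcd => by
      have h1 := edgeRel_map (π := π) (E := E) (a := π.symm c) (b := π.symm d)
      rw [π.apply_symm_apply, π.apply_symm_apply] at h1
      exact h1.1 hcd) _ _ h
    simpa [Function.onFun] using this
  · exact fun h => Relation.ReflTransGen.lift (f := π) (fun c d hcd => edgeRel_map.2 hcd) _ _ h

lemma map_mem_CE {q : ℕ} {π : Equiv.Perm (Fin N)} {V : Finset (Fin N)} {E : Finset (Finset (Fin N))} :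
    E.map (Equiv.finsetCongr π).toEmbedding ∈ CE q (V.map π.toEmbedding) ↔ E ∈ CE q V := by
  rw [mem_CE, mem_CE, map_subset_edgesIn]
  refine and_congr_right fun _ => ?_
  constructor
  · exact fun h a ha b hb => reach_map.1 (h _ (Finset.mem_map_of_mem _ ha) _ (Finset.mem_map_of_mem _ hb))
  · intro h a ha b hb
    obtain ⟨a, ha', rfl⟩ := Finset.mem_map.1 ha
    obtain ⟨b, hb', rfl⟩ := Finset.mem_map.1 hb
    exact reach_map.2 (h a ha' b hb')

variable {w : Finset (Finset (Fin N)) → ℝ}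

lemma sum_CE_congr (q : ℕ)
    (hw : ∀ (π : Equiv.Perm (Fin N)) E, w (E.map (Equiv.finsetCongr π).toEmbedding) = w E)
    {V V' : Finset (Fin N)} (h : V.card = V'.card) : ∑ E ∈ CE q V, w E = ∑ E ∈ CE q V', w E := by
  obtain ⟨π, rfl⟩ := exists_perm_map_eq h
  exact Finset.sum_equiv (Equiv.finsetCongr (Equiv.finsetCongr π)) (fun E => map_mem_CE.symm)
    fun E _ => (hw π E).symm

lemma sum_edgesIn_congr (q : ℕ)
    (hw : ∀ (π : Equiv.Perm (Fin N)) E, w (E.map (Equiv.finsetCongr π).toEmbedding) = w E)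
    {V V' : Finset (Fin N)} (h : V.card = V'.card) :
    ∑ E ∈ (edgesIn q V).powerset, w E = ∑ E ∈ (edgesIn q V').powerset, w E := by
  obtain ⟨π, rfl⟩ := exists_perm_map_eq h
  exact Finset.sum_equiv (Equiv.finsetCongr (Equiv.finsetCongr π))
    (fun E => by
      rw [Finset.mem_powerset, Finset.mem_powerset]
      exact map_subset_edgesIn.symm)
    fun E _ => (hw π E).symm

/-- The first `k` vertices. -/
def initial (N k : ℕ) : Finset (Fin N) := Finset.univ.filter fun v => (v : ℕ) < k

lemma card_initial {N k : ℕ} (h : k ≤ N) : (initial N k).card = k := by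
  unfold initial
  rw [Fin.card_filter_val_lt, min_eq_right h]

/-- The partition function restricted to `k` vertices. -/
def apart (q : ℕ) (w : Finset (Finset (Fin N)) → ℝ) (k : ℕ) : ℝ :=
  ∑ E ∈ (edgesIn q (initial N k)).powerset, w E

/-- The cluster weight of `k` vertices. -/
def cpart (q : ℕ) (w : Finset (Finset (Fin N)) → ℝ) (k : ℕ) : ℝ := ∑ E ∈ CE q (initial N k), w E

lemma apart_succ {q : ℕ} (hq : 1 ≤ q)
    (hw : ∀ D E, Disjoint D E → (∀ e ∈ D, ∀ f ∈ E, Disjoint e f) → w (D ∪ E) = w D * w E)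
    (hw' : ∀ (π : Equiv.Perm (Fin N)) E, w (E.map (Equiv.finsetCongr π).toEmbedding) = w E)
    {k : ℕ} (hk : k < N) :
    apart q w (k + 1) = ∑ i ∈ Finset.range (k + 1), (k.choose i : ℝ) * cpart q w (i + 1) * apart q w (k - i) := by
  have hx : (⟨0, by omega⟩ : Fin N) ∈ initial N (k + 1) := by simp [initial]
  have hc : (initial N (k + 1)).card = k + 1 := card_initial (by omega)
  unfold apart
  rw [sum_powerset_edgesIn hq hw hx]
  set x : Fin N := ⟨0, by omega⟩
  have hce : ((initial N (k + 1)).erase x).card = k := by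
    rw [Finset.card_erase_of_mem hx, hc]; rfl
  have h1 : ∀ U ∈ ((initial N (k + 1)).erase x).powerset,
      (∑ E ∈ CE q (insert x U), w E) * ∑ E ∈ (edgesIn q (initial N (k + 1) \ insert x U)).powerset, w E =
        (fun j => cpart q w (j + 1) * apart q w (k - j)) U.card := by
    intro U hU
    have hU' := Finset.mem_powerset.1 hU
    have hxU : x ∉ U := fun h => (Finset.mem_erase.1 (hU' h)).1 rfl
    have hle : U.card ≤ k := hce ▸ Finset.card_le_card hU'
    have h2 : (insert x U).card = U.card + 1 := Finset.card_insert_of_notMem hxU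
    have h3 : insert x U ⊆ initial N (k + 1) :=
      Finset.insert_subset hx (hU'.trans (Finset.erase_subset _ _))
    simp only
    unfold cpart apart
    rw [sum_CE_congr q hw' (V := insert x U) (V' := initial N (U.card + 1))
      (by rw [h2, card_initial (by omega)]),
      sum_edgesIn_congr q hw' (V := initial N (k + 1) \ insert x U) (V' := initial N (k - U.card))
        (by rw [Finset.card_sdiff_of_subset h3, h2, hc, card_initial (by omega)]; omega)]
  rw [Finset.sum_congr rfl h1,
    Finset.sum_powerset_apply_card (fun j => cpart q w (j + 1) * apart q w (k - j)), hce]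
  refine Finset.sum_congr rfl fun i _ => ?_
  rw [nsmul_eq_mul]
  unfold apart
  ring

lemma apart_zero {q : ℕ} (hq : 1 ≤ q) (h1 : w ∅ = 1) : apart q w 0 = 1 := by
  have h2 : edgesIn q (initial N 0) = ∅ := by
    unfold edgesIn
    rw [Finset.powersetCard_eq_empty]
    rw [card_initial (Nat.zero_le _)]
    omega
  unfold apart
  rw [h2]
  simpa using h1

lemma cpart_one {q : ℕ} (hq : 2 ≤ q) (h1 : w ∅ = 1) (hN : 1 ≤ N) : cpart q w 1 = 1 := by
  have h2 : edgesIn q (initial N 1) = ∅ := by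
    unfold edgesIn
    rw [Finset.powersetCard_eq_empty, card_initial hN]
    omega
  have h3 : CE q (initial N 1) = {∅} := by
    ext E
    rw [mem_CE, h2, Finset.subset_empty, Finset.mem_singleton, and_iff_left_iff_imp]
    rintro rfl a ha b hb
    have hab : a = b := Finset.card_le_one.1 (card_initial hN).le a ha b hb
    rw [hab]
  unfold cpart
  rw [h3, Finset.sum_singleton, h1]

lemma apart_self {q : ℕ} : apart q w N = ∑ E ∈ (edges q N).powerset, w E := by
  have : edgesIn q (initial N N) = edges q N := by
    ext e
    rw [mem_edgesIn]
    simp [edges, initial, Finset.subset_iff]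
  rw [apart, this]

end Symmetry

section ClusterEstimates

variable {N : ℕ}

lemma card_CE_le (q : ℕ) (V : Finset (Fin N)) : (CE q V).card ≤ 2 ^ 2 ^ V.card := by
  have h : CE q V ⊆ V.powerset.powerset := by
    intro E hE
    rw [Finset.mem_powerset]
    intro e he
    exact Finset.mem_powerset.2 ((mem_edgesIn.1 ((mem_CE.1 hE).1 he)).2)
  simpa using Finset.card_le_card h

lemma pow_sub_pow_le_mul {a p : ℝ} (ha : 0 ≤ a) (hap : a ≤ p) (hp : p ≤ 1) (k : ℕ) :
    p ^ k - a ^ k ≤ k * (p - a) := by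
  induction k with
  | zero => simp
  | succ k ih =>
    have h1 : a ^ k ≤ 1 := pow_le_one₀ ha (hap.trans hp)
    have h2 : p * (p ^ k - a ^ k) ≤ 1 * (k * (p - a)) :=
      mul_le_mul hp ih (sub_nonneg.2 (pow_le_pow_left₀ ha hap k)) zero_le_one
    have h3 : a ^ k * (p - a) ≤ 1 * (p - a) := mul_le_mul_of_nonneg_right h1 (sub_nonneg.2 hap)
    push_cast
    calc p ^ (k + 1) - a ^ (k + 1) = p * (p ^ k - a ^ k) + a ^ k * (p - a) := by ring
      _ ≤ (k + 1) * (p - a) := by linarith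

lemma sum_FO_vertex {q : ℕ} (hq : 2 ≤ q) {x : Fin N} {U : Finset (Fin N)} (hx : x ∉ U) :
    ∑ E ∈ FO q {x} U, bT E = ∑ E ∈ trees q (U.card + 1), bT E := by
  have h := Rsum_eq_treeT hq (U.card + 1) [x] {x} U (by simp; omega) (by simp) (by simp)
    (by simpa using hx) (fun _ => (0, 0))
  rw [Rsum] at h
  simp only [RS_zero, mul_one] at h
  rw [sum_trees_vertex hq]
  exact h

lemma exists_mem_initial {v : ℕ} (hv : v + 1 ≤ N) : ∃ x : Fin N, x ∈ initial N (v + 1) :=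
  ⟨⟨0, by omega⟩, by simp [initial]⟩

lemma abs_cpart_le {q : ℕ} (hq : 1 ≤ q) {w : Finset (Finset (Fin N)) → ℝ} {p κ : ℝ} (hp : 0 ≤ p)
    (hκ : 0 < κ) (hκ1 : κ ≤ 1) (hpk : p * (N * (1 + κ⁻¹)) ^ (q - 1) ≤ Real.log 2)
    (hw : ∀ E, |w E| ≤ p ^ E.card) {v : ℕ} (hv : v + 1 ≤ N) :
    |cpart q w (v + 1)| ≤ v.factorial * (8 * κ * Real.exp 1 / N) ^ v * 4 := by
  obtain ⟨x, hx⟩ := exists_mem_initial hv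
  have hc : ((initial N (v + 1)).erase x).card = v := by
    rw [Finset.card_erase_of_mem hx, card_initial hv]; simp
  have hu : ({x} ∪ (initial N (v + 1)).erase x).card = v + 1 := by
    rw [Finset.singleton_union, Finset.insert_erase hx, card_initial hv]
  have h := sum_RE_le hq hp hκ hκ1 hpk (v + 1) {x} ((initial N (v + 1)).erase x)
    hu hv (by simp)
  rw [hc, Finset.card_singleton, pow_one] at h
  rw [cpart, CE_eq_RE hx]
  exact (Finset.abs_sum_le_sum_abs _ _).trans ((Finset.sum_le_sum fun E _ => hw E).trans h)

lemma abs_cpart_sub_le {q : ℕ} (hq : 2 ≤ q) {w : Finset (Finset (Fin N)) → ℝ} {p x ρ : ℝ}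
    (hρ : 0 ≤ ρ) (hx : x * (N : ℝ) ^ (q - 1) = ρ ^ (q - 1)) (hp : 0 ≤ p) (hxp : x ≤ p)
    (hp1 : p * (N : ℝ) ^ (q - 1) ≤ 1) (hw : ∀ E, |w E| ≤ p ^ E.card)
    (hw' : ∀ E : Finset (Finset (Fin N)), (∀ e ∈ E, e.card = q) →
      |w E - x ^ E.card * bT E| ≤ p ^ E.card - x ^ E.card) {i : ℕ} (hi : i + 1 ≤ N) :
    |(N : ℝ) ^ i * cpart q w (i + 1) - ρ ^ i * ∑ E ∈ trees q (i + 1), bT E| ≤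
      2 ^ 2 ^ (i + 1) * (i * (p * (N : ℝ) ^ (q - 1) - ρ ^ (q - 1)) + 1 / N) := by
  obtain ⟨x₀, hx₀⟩ := exists_mem_initial hi
  set U := (initial N (i + 1)).erase x₀ with hU
  have hc : U.card = i := by
    rw [hU, Finset.card_erase_of_mem hx₀, card_initial hi]; simp
  have hN : (0 : ℝ) < N := by exact_mod_cast (by omega : 0 < N)
  have hN1 : (1 : ℝ) ≤ N := by exact_mod_cast (by omega : 1 ≤ N)
  have hu : ({x₀} ∪ U).card = i + 1 := by
    rw [hU, Finset.singleton_union, Finset.insert_erase hx₀, card_initial hi]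
  set P := p * (N : ℝ) ^ (q - 1) with hP
  have hAP : ρ ^ (q - 1) ≤ P := by rw [← hx, hP]; gcongr
  have hA0 : 0 ≤ ρ ^ (q - 1) := by positivity
  have hP0 : 0 ≤ P := by positivity
  have hcard := card_CE_le q (initial N (i + 1))
  rw [card_initial hi] at hcard
  rw [← hc, ← sum_FO_vertex hq (Finset.notMem_erase x₀ _), hc, cpart, CE_eq_RE hx₀, FO,
    Finset.sum_filter, Finset.mul_sum, Finset.mul_sum, ← Finset.sum_sub_distrib]
  rw [CE_eq_RE hx₀] at hcard
  have hB : 0 ≤ (i : ℝ) * (P - ρ ^ (q - 1)) + 1 / N := by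
    have := sub_nonneg.2 hAP
    positivity
  have key : ∀ E ∈ RE q {x₀} U, |(N : ℝ) ^ i * w E -
      ρ ^ i * (if (q - 1) * E.card = U.card then bT E else 0)| ≤
      i * (P - ρ ^ (q - 1)) + 1 / N := by
    intro E hE
    have hle := card_le_of_mem_RE (by omega) (i + 1) {x₀} U hu (by simp [hU]) E hE
    rw [hc] at hle ⊢
    split_ifs with h
    · have h1 : (N : ℝ) ^ i * w E - ρ ^ i * bT E =
          ((N : ℝ) ^ (q - 1)) ^ E.card * (w E - x ^ E.card * bT E) := by
        rw [← h, pow_mul, pow_mul, ← hx, mul_pow]; ring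
      have h2 := hw' E (fun e he => ((mem_RE.1 hE).1 e he).1)
      have hk : E.card ≤ i := by
        rw [← h]; exact Nat.le_mul_of_pos_left _ (by omega)
      have hk' : (E.card : ℝ) ≤ i := by exact_mod_cast hk
      rw [h1, abs_mul, abs_of_nonneg (by positivity)]
      calc ((N : ℝ) ^ (q - 1)) ^ E.card * |w E - x ^ E.card * bT E|
          ≤ ((N : ℝ) ^ (q - 1)) ^ E.card * (p ^ E.card - x ^ E.card) := by gcongr
        _ = P ^ E.card - (ρ ^ (q - 1)) ^ E.card := by rw [hP, ← hx, mul_pow, mul_pow]; ring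
        _ ≤ E.card * (P - ρ ^ (q - 1)) := pow_sub_pow_le_mul hA0 hAP hp1 _
        _ ≤ i * (P - ρ ^ (q - 1)) := mul_le_mul_of_nonneg_right hk' (sub_nonneg.2 hAP)
        _ ≤ _ := le_add_of_nonneg_right (by positivity)
    · have h3 : i + 1 ≤ (q - 1) * E.card := by omega
      rw [mul_zero, sub_zero, abs_mul, abs_of_nonneg (by positivity)]
      calc (N : ℝ) ^ i * |w E| ≤ (N : ℝ) ^ i * p ^ E.card := by gcongr; exact hw E
        _ = (N : ℝ) ^ (i + 1) * p ^ E.card * (1 / N) := by rw [pow_succ]; field_simp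
        _ ≤ (N : ℝ) ^ ((q - 1) * E.card) * p ^ E.card * (1 / N) := by gcongr
        _ = P ^ E.card * (1 / N) := by rw [hP, mul_pow, pow_mul]; ring
        _ ≤ 1 * (1 / N) := by gcongr; exact pow_le_one₀ hP0 hp1
        _ ≤ _ := by
          rw [one_mul]
          exact le_add_of_nonneg_left (mul_nonneg (by positivity) (sub_nonneg.2 hAP))
  calc _ ≤ ∑ E ∈ RE q {x₀} U, |(N : ℝ) ^ i * w E -
      ρ ^ i * (if (q - 1) * E.card = U.card then bT E else 0)| := Finset.abs_sum_le_sum_abs _ _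
    _ ≤ ∑ E ∈ RE q {x₀} U, (i * (P - ρ ^ (q - 1)) + 1 / N) := Finset.sum_le_sum key
    _ = (RE q {x₀} U).card * (i * (P - ρ ^ (q - 1)) + 1 / N) := by rw [Finset.sum_const, nsmul_eq_mul]
    _ ≤ _ := by
      refine mul_le_mul_of_nonneg_right ?_ hB
      exact_mod_cast hcard

end ClusterEstimates

section CouplingEstimates

lemma sq_half_le_cosh_sub_one {g : ℝ} (hg : 0 ≤ g) : g ^ 2 / 2 ≤ Real.cosh g - 1 := by
  have h := Real.cosh_two_mul (g / 2)
  have h1 := Real.cosh_sq (g / 2)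
  have h2 : g / 2 ≤ Real.sinh (g / 2) := Real.self_le_sinh_iff.2 (by positivity)
  have h3 : (g / 2) ^ 2 ≤ Real.sinh (g / 2) ^ 2 := by gcongr
  rw [mul_div_cancel₀ g (two_ne_zero)] at h
  nlinarith

lemma cosh_sub_one_le {g : ℝ} (hg : g ^ 2 / 2 ≤ 1) :
    Real.cosh g - 1 ≤ g ^ 2 / 2 + (g ^ 2 / 2) ^ 2 := by
  have h1 := Real.cosh_le_exp_half_sq g
  have h0 : 0 ≤ g ^ 2 / 2 := by positivity
  have h2 := (abs_le.1 (Real.abs_exp_sub_one_sub_id_le (x := g ^ 2 / 2) (by rwa [abs_of_nonneg h0]))).2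
  linarith

/-- The scaled squared coupling, which does not depend on the number of vertices. -/
def area (q : ℕ) (β : ℝ) : ℝ := (q - 1).factorial * β ^ 2 / 2 ^ (q + 1)

lemma area_nonneg (q : ℕ) (β : ℝ) : 0 ≤ area q β := by unfold area; positivity

lemma rho_nonneg (q : ℕ) (β : ℝ) : 0 ≤ rho q β := by unfold rho; positivity

lemma rho_pow {q : ℕ} (hq : 2 ≤ q) (β : ℝ) : rho q β ^ (q - 1) = area q β := by
  have h : ((q : ℝ) - 1) = ((q - 1 : ℕ) : ℝ) := by
    rw [Nat.cast_sub (by omega)]; simp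
  rw [rho, h]
  exact Real.rpow_inv_natCast_pow (area_nonneg q β) (by omega)

lemma rho_ne_zero (q : ℕ) {β : ℝ} (hβ : β ≠ 0) : rho q β ≠ 0 := by
  unfold rho
  positivity

lemma coupling_sq_mul {q : ℕ} (hq : Even q) (β : ℝ) {n : ℕ} (hn : 1 ≤ n) :
    coupling q β n ^ 2 / 2 * (n : ℝ) ^ (q - 1) = area q β := by
  have hn' : (0 : ℝ) < n := by exact_mod_cast hn
  have h2 : ((2 : ℝ) ^ (q / 2)) ^ 2 = 2 ^ q := by
    rw [← pow_mul, Nat.div_mul_cancel hq.two_dvd]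
  rw [coupling, sigma, mul_pow, mul_pow, sq_abs, Real.sq_sqrt (by positivity), inv_pow, h2, area]
  field_simp
  ring

lemma cosh_coupling_le {q : ℕ} (hq : Even q) (hq2 : 2 ≤ q) {β : ℝ} (hβ : area q β ≤ 1) {n : ℕ} (hn : 1 ≤ n) :
    (Real.cosh (coupling q β n) - 1) * (n : ℝ) ^ (q - 1) ≤ area q β + 1 / n := by
  have hn0 : (0 : ℝ) < n := by exact_mod_cast hn
  have hn1 : (1 : ℝ) ≤ n := by exact_mod_cast hn
  have h0 := area_nonneg q β
  have hx := coupling_sq_mul hq β hn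
  set x := coupling q β n ^ 2 / 2 with hxd
  have hx0 : 0 ≤ x := by positivity
  have hM : (n : ℝ) ≤ (n : ℝ) ^ (q - 1) := le_self_pow₀ hn1 (by omega)
  have hxn : x * n ≤ 1 := (mul_le_mul_of_nonneg_left hM hx0).trans (hx.trans_le hβ)
  have hx1 : x ≤ 1 / n := by rwa [le_div_iff₀ hn0]
  have hx2 : x ≤ 1 := hx1.trans (by rw [div_le_one hn0]; exact hn1)
  calc _ ≤ (x + x ^ 2) * (n : ℝ) ^ (q - 1) := by gcongr; exact cosh_sub_one_le hx2
    _ = area q β + x * area q β := by rw [← hx]; ring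
    _ ≤ area q β + 1 / n * 1 := by gcongr
    _ = _ := by rw [mul_one]

lemma cosh_coupling_le_two_mul {q : ℕ} (hq : Even q) {β : ℝ} (hβ : area q β ≤ 1) {n : ℕ}
    (hn : 1 ≤ n) :
    (Real.cosh (coupling q β n) - 1) * (n : ℝ) ^ (q - 1) ≤ 2 * area q β := by
  have hn1 : (1 : ℝ) ≤ n := by exact_mod_cast hn
  have h0 := area_nonneg q β
  have hx := coupling_sq_mul hq β hn
  set x := coupling q β n ^ 2 / 2 with hxd
  have hx0 : 0 ≤ x := by positivity
  have hx2 : x ≤ 1 :=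
    (le_mul_of_one_le_right hx0 (one_le_pow₀ hn1)).trans (hx.trans_le hβ)
  calc _ ≤ (x + x ^ 2) * (n : ℝ) ^ (q - 1) := by gcongr; exact cosh_sub_one_le hx2
    _ = area q β + x * area q β := by rw [← hx]; ring
    _ ≤ area q β + 1 * area q β := by gcongr
    _ = _ := by ring

/-- The threshold on the scaled squared coupling below which the cluster estimates hold. -/
def threshold (q : ℕ) : ℝ := Real.log 2 / (2 * (1 + 1000000) ^ (q - 1))

lemma threshold_pos (q : ℕ) : 0 < threshold q := by
  unfold threshold; have := Real.log_pos one_lt_two; positivity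

lemma threshold_mul (q : ℕ) : 2 * threshold q * (1 + 1000000) ^ (q - 1) = Real.log 2 := by
  unfold threshold; field_simp

lemma two_mul_threshold_le (q : ℕ) : 2 * threshold q ≤ 1 := by
  have h1 := threshold_mul q
  have h2 : (1 : ℝ) ≤ (1 + 1000000) ^ (q - 1) := one_le_pow₀ (by norm_num)
  have h3 := le_mul_of_one_le_right (mul_nonneg zero_le_two (threshold_pos q).le) h2
  have h4 := Real.log_two_lt_d9
  linarith

lemma rho_le {q : ℕ} (hq : 2 ≤ q) {β : ℝ} (hβ : area q β ≤ threshold q) : rho q β ≤ 1 / 1000000 := by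
  have h1 : (rho q β * 1000000) ^ (q - 1) ≤ 1 := by
    rw [mul_pow, rho_pow hq]
    have h2 : (1000000 : ℝ) ^ (q - 1) ≤ (1 + 1000000) ^ (q - 1) := by gcongr; norm_num
    have h3 := mul_le_mul hβ h2 (by positivity) (threshold_pos q).le
    have h4 := threshold_mul q
    have h5 := Real.log_two_lt_d9
    linarith
  have h2 : rho q β * 1000000 ≤ 1 :=
    (pow_le_one_iff_of_nonneg (mul_nonneg (rho_nonneg q β) (by norm_num)) (by omega)).1 h1
  linarith

/-- The finite-size connected coefficients `μ_v` of the random model on `2m` vertices. -/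
def muN (q : ℕ) (β : ℝ) (m v : ℕ) : ℝ :=
  if v = 0 then 0
  else if v ≤ 2 * m then
    cpart q (Wn q (2 * m) (coupling q β (2 * m))) v / v.factorial * ((2 * m : ℕ) : ℝ) ^ (v - 1)
  else if v = 1 then 1 else 0

lemma four_mul_pow_le {i : ℕ} (hi : 1 ≤ i) :
    4 * (8 * (1 / 1000000) * Real.exp 1) ^ i * ((i + 1 : ℕ) : ℝ) ^ 3 * 2 ^ (i + 1) ≤ (1 / 4 : ℝ) ^ (i + 1) := by
  have he := Real.exp_one_lt_d9
  have h1 : 8 * (1 / 1000000) * Real.exp 1 ≤ (1 / 40000 : ℝ) := by linarith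
  have h2 : ((i + 1 : ℕ) : ℝ) ≤ 2 ^ i := by exact_mod_cast Nat.lt_two_pow_self
  calc _ ≤ 4 * (1 / 40000 : ℝ) ^ i * (2 ^ i) ^ 3 * 2 ^ (i + 1) := by gcongr
    _ = 32 * (16 / 40000 * 4 : ℝ) ^ i * (1 / 4) ^ (i + 1) := by
      have h3 : ((2 : ℝ) ^ i) ^ 3 * 2 ^ i = 16 ^ i := by
        rw [← pow_succ, ← pow_mul, mul_comm, pow_mul]; norm_num
      have h4 : (16 / 40000 * 4 : ℝ) ^ i * (1 / 4) ^ i = (16 / 40000) ^ i := by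
        rw [← mul_pow]; norm_num
      have h5 : (1 / 40000 : ℝ) ^ i * 16 ^ i = (16 / 40000) ^ i := by
        rw [← mul_pow]; norm_num
      rw [pow_succ, pow_succ]
      linear_combination 8 * (1 / 40000 : ℝ) ^ i * h3 + 8 * h5 - 8 * h4
    _ ≤ 32 * (16 / 40000 * 4 : ℝ) ^ 1 * (1 / 4) ^ (i + 1) := by
      have h6 := pow_le_pow_of_le_one (a := (16 / 40000 * 4 : ℝ)) (by norm_num) (by norm_num) hi
      gcongr
    _ ≤ 1 * (1 / 4) ^ (i + 1) := by gcongr; norm_num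
    _ = _ := one_mul _

lemma goodSeq_muN {q : ℕ} (hq : Even q) (hq2 : 2 ≤ q) {β : ℝ} (hβ : area q β ≤ threshold q) (m : ℕ) :
    GoodSeq (muN q β m) := by
  have hg := coupling_nonneg q β (2 * m)
  refine ⟨by simp [muN], ?_, ?_⟩
  · rw [muN, if_neg one_ne_zero]
    by_cases h : 1 ≤ 2 * m
    · rw [if_pos h, cpart_one hq2 (Wn_empty hg) h]; simp
    · rw [if_neg h, if_pos rfl]
  · intro v hv
    obtain ⟨i, rfl⟩ : ∃ i, v = i + 1 := ⟨v - 1, by omega⟩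
    rw [muN, if_neg (by omega)]
    split_ifs with h h'
    · have hn : 1 ≤ 2 * m := by omega
      have hn0 : (0 : ℝ) < ((2 * m : ℕ) : ℝ) := by exact_mod_cast hn
      have h2 := two_mul_threshold_le q
      have h3 := area_nonneg q β
      have hp : 0 ≤ Real.cosh (coupling q β (2 * m)) - 1 := sub_nonneg.2 (Real.one_le_cosh _)
      have hpk : (Real.cosh (coupling q β (2 * m)) - 1) *
          (((2 * m : ℕ) : ℝ) * (1 + (1 / 1000000 : ℝ)⁻¹)) ^ (q - 1) ≤ Real.log 2 := by
        rw [mul_pow, ← mul_assoc, ← threshold_mul q, one_div, inv_inv]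
        exact mul_le_mul_of_nonneg_right
          ((cosh_coupling_le_two_mul hq (by linarith) hn).trans (by linarith)) (by positivity)
      have hb := abs_cpart_le (by omega) hp (by norm_num) (by norm_num) hpk
        (fun E => abs_Wn_le (q := q) hg E) h
      refine le_trans ?_ (four_mul_pow_le (i := i) (by omega))
      gcongr
      rw [abs_mul, abs_div, Nat.abs_cast, abs_of_nonneg (by positivity : (0 : ℝ) ≤ ((2 * m : ℕ) : ℝ) ^ (i + 1 - 1)),
        Nat.add_sub_cancel]
      set lam : ℝ := 8 * (1 / 1000000) * Real.exp 1
      have hlam : 0 ≤ lam := by positivity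
      have hf : (0 : ℝ) < i.factorial := by exact_mod_cast i.factorial_pos
      calc _ ≤ (i.factorial : ℝ) * (lam / ((2 * m : ℕ) : ℝ)) ^ i * 4 / i.factorial * ((2 * m : ℕ) : ℝ) ^ i := by
            gcongr
            omega
        _ = 4 * lam ^ i := by rw [div_pow]; field_simp
    · omega
    · simp

end CouplingEstimates

section FreeEnergyLimit

/-- The limiting coefficients, extended by zero. -/
def muLim (q : ℕ) (β : ℝ) (v : ℕ) : ℝ := if v = 0 then 0 else mu q β v

lemma tendsto_muN {q : ℕ} (hq : Even q) (hq2 : 2 ≤ q) {β : ℝ} (hβ : area q β ≤ threshold q) (v : ℕ) :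
    Tendsto (fun m => muN q β m v) atTop (nhds (muLim q β v)) := by
  obtain rfl | ⟨i, rfl⟩ : v = 0 ∨ ∃ i, v = i + 1 := by
    cases v with
    | zero => exact Or.inl rfl
    | succ i => exact Or.inr ⟨i, rfl⟩
  · simp [muN, muLim]
  have hth := two_mul_threshold_le q
  have hA0 := area_nonneg q β
  have hdom : ∀ m, i + 1 ≤ m → |muN q β m (i + 1) - muLim q β (i + 1)| ≤
      ((i + 1).factorial : ℝ)⁻¹ * (2 ^ 2 ^ (i + 1) * ((i + 1) * (1 / (m : ℝ)))) := by
    intro m hm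
    have hn : 1 ≤ 2 * m := by omega
    have hm0 : (0 : ℝ) < m := by exact_mod_cast (by omega : 0 < m)
    have hg := coupling_nonneg q β (2 * m)
    have hx := coupling_sq_mul hq β hn
    rw [← rho_pow hq2] at hx
    have hp1 := (cosh_coupling_le_two_mul hq (by linarith) hn).trans
      ((mul_le_mul_of_nonneg_left hβ zero_le_two).trans hth)
    have h := abs_cpart_sub_le hq2 (rho_nonneg q β) hx (sub_nonneg.2 (Real.one_le_cosh _))
      (sq_half_le_cosh_sub_one hg) hp1 (abs_Wn_le hg) (fun E hE => abs_Wn_sub_le hg hE)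
      (i := i) (by omega)
    rw [rho_pow hq2] at h
    have h1 := cosh_coupling_le hq hq2 (β := β) (by linarith) hn
    have h2 : 1 / ((2 * m : ℕ) : ℝ) ≤ 1 / m := by
      push_cast
      gcongr
      linarith
    have h3 : (Real.cosh (coupling q β (2 * m)) - 1) * ((2 * m : ℕ) : ℝ) ^ (q - 1) - area q β ≤ 1 / m := by
      linarith
    have h4 : (i : ℝ) * ((Real.cosh (coupling q β (2 * m)) - 1) * ((2 * m : ℕ) : ℝ) ^ (q - 1) - area q β) +
        1 / ((2 * m : ℕ) : ℝ) ≤ (i + 1) * (1 / (m : ℝ)) := by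
      have := mul_le_mul_of_nonneg_left h3 (Nat.cast_nonneg (α := ℝ) i)
      linarith
    have h5 : muN q β m (i + 1) - muLim q β (i + 1) = ((i + 1).factorial : ℝ)⁻¹ *
        (((2 * m : ℕ) : ℝ) ^ i * cpart q (Wn q (2 * m) (coupling q β (2 * m))) (i + 1) -
          rho q β ^ i * ∑ E ∈ trees q (i + 1), bT E) := by
      rw [muN, muLim, if_neg (by omega), if_pos (by omega), if_neg (by omega), mu, Nat.add_sub_cancel]
      ring
    rw [h5, abs_mul, abs_of_nonneg (by positivity)]
    gcongr
    exact h.trans (by gcongr)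
  rw [tendsto_iff_norm_sub_tendsto_zero]
  have hlim : Tendsto (fun m : ℕ => ((i + 1).factorial : ℝ)⁻¹ *
      (2 ^ 2 ^ (i + 1) * (((i : ℝ) + 1) * (1 / (m : ℝ))))) atTop (nhds 0) := by
    have := ((tendsto_one_div_atTop_nhds_zero_nat (𝕜 := ℝ)).const_mul ((i : ℝ) + 1)).const_mul
      ((2 : ℝ) ^ 2 ^ (i + 1)) |>.const_mul ((i + 1).factorial : ℝ)⁻¹
    simpa using this
  refine squeeze_zero' (Eventually.of_forall fun _ => norm_nonneg _) ?_ hlim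
  filter_upwards [eventually_ge_atTop (i + 1)] with m hm
  exact hdom m hm

lemma goodSeq_muLim {q : ℕ} (hq : Even q) (hq2 : 2 ≤ q) {β : ℝ} (hβ : area q β ≤ threshold q) :
    GoodSeq (muLim q β) := by
  have hG := goodSeq_muN hq hq2 hβ
  refine ⟨by simp [muLim], ?_, fun v hv => ?_⟩
  · refine tendsto_nhds_unique (tendsto_muN hq hq2 hβ 1) ?_
    simp only [(hG _).one]
    exact tendsto_const_nhds
  · exact le_of_tendsto ((((tendsto_muN hq hq2 hβ v).abs).mul_const _).mul_const _)
      (Eventually.of_forall fun m => (hG m).small v hv)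

lemma PhiS_muLim (q : ℕ) (β : ℝ) : PhiS (muLim q β) = PhiR q β := by
  funext t
  have h0 : muLim q β 0 * t ^ 0 = 0 := by simp [muLim]
  have hs : ∀ v, muLim q β (v + 1) * t ^ (v + 1) = mu q β (v + 1) * t ^ (v + 1) := fun v => by
    rw [muLim, if_neg (by omega)]
  rw [PhiS, PhiR]
  by_cases h : Summable fun v => muLim q β v * t ^ v
  · rw [h.tsum_eq_zero_add, h0, zero_add]
    exact tsum_congr hs
  · rw [tsum_eq_zero_of_not_summable h, tsum_eq_zero_of_not_summable]
    intro h'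
    exact h ((summable_nat_add_iff 1).1 (h'.congr fun v => (hs v).symm))

lemma tendsto_log_EZ {q : ℕ} (hq : Even q) (hq2 : 2 ≤ q) {β : ℝ} (hβ : area q β ≤ threshold q) {t : ℝ}
    (ht : t ∈ Set.Ioo (1 / 2 : ℝ) (3 / 2)) (hg : t * deriv (PhiR q β) t = 1) :
    Tendsto (fun m : ℕ => Real.log (EZ m q β).re / ((2 * m : ℕ) : ℝ)) atTop
      (nhds (PhiR q β t - 1 - Real.log t)) := by
  have hν := goodSeq_muLim hq hq2 hβ
  have hg' : gS (muLim q β) t = 1 := by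
    rw [← hν.mul_deriv ⟨by linarith [ht.1], by linarith [ht.2]⟩, PhiS_muLim, hg]
  have hW : ∀ m, 0 ≤ coupling q β (2 * m) := fun m => coupling_nonneg _ _ _
  have h := tendsto_log_coeff (fun m => 2 * m) (tendsto_id.const_mul_atTop' two_pos)
    (fun m => cpart q (Wn q (2 * m) (coupling q β (2 * m))))
    (fun m => apart q (Wn q (2 * m) (coupling q β (2 * m))))
    (fun m => apart_zero (by omega) (Wn_empty (hW m)))
    (fun m k hk => apart_succ (by omega) (fun D E => Wn_union hq _) (fun π E => Wn_map hq _ π E) hk)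
    (muN q β) (muLim q β) (goodSeq_muN hq hq2 hβ) hν ?_ ?_ (tendsto_muN hq hq2 hβ) ht hg'
  · rw [PhiS_muLim] at h
    simpa only [apart_self, ← EZ_re hq] using h
  · intro m v hv
    by_cases hm : 2 * m = 0
    · exact Or.inr hm
    · left
      rw [muN, if_neg (by omega), if_neg (by omega), if_neg (by omega)]
  · intro m i hi
    rw [muN, if_neg (by omega), if_pos (by omega), Nat.add_sub_cancel]

end FreeEnergyLimit

/-- For every even `q ≥ 2` there is `β* > 0` such that for `0 < |β| ≤ β*`,
with `t* ∈ (1/2, 3/2)` the unique solution of `t* Φ'(t*) = 1` and `H` the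
Chord-Cavity-Generator, the limit of `f_{n,q}(β)/n` along even `n = 2m → ∞` exists and
equals `(ℱ(t*) − 1 − log t*)/β`. -/
theorem free_energy_limit (q : ℕ) (hq : Even q) (hq2 : 2 ≤ q) :
    ∃ βs : ℝ, 0 < βs ∧ ∀ β : ℝ, 0 < |β| → |β| ≤ βs →
      (∃! t : ℝ, t ∈ Set.Ioo (1 / 2 : ℝ) (3 / 2) ∧ t * deriv (PhiR q β) t = 1) ∧
      ∀ t : ℝ, t ∈ Set.Ioo (1 / 2 : ℝ) (3 / 2) → t * deriv (PhiR q β) t = 1 →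
        ∀ H : ℂ → ℝ × ℝ → ℂ, IsCCG q H →
          Tendsto (fun m : ℕ => fEnergy m q β / (2 * (m : ℝ))) atTop
            (nhds (((Fcal q β H (t : ℂ)).re - 1 - Real.log t) / β)) := by
  have hf : (0 : ℝ) < (q - 1).factorial := by exact_mod_cast (q - 1).factorial_pos
  have hth := threshold_pos q
  refine ⟨Real.sqrt (threshold q * 2 ^ (q + 1) / (q - 1).factorial), by positivity,
    fun β hβ0 hβ => ?_⟩
  have hA : area q β ≤ threshold q := by
    have h1 : β ^ 2 ≤ threshold q * 2 ^ (q + 1) / (q - 1).factorial := by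
      rw [← sq_abs]; exact (Real.le_sqrt (abs_nonneg _) (by positivity)).1 hβ
    rw [le_div_iff₀ hf] at h1
    rw [area, div_le_iff₀ (by positivity)]
    linarith
  have hν := goodSeq_muLim hq hq2 hA
  have hiff : ∀ t ∈ Set.Ioo (1 / 2 : ℝ) (3 / 2), t * deriv (PhiR q β) t = gS (muLim q β) t := by
    intro t ht
    rw [← PhiS_muLim, hν.mul_deriv ⟨by linarith [ht.1], by linarith [ht.2]⟩]
  refine ⟨?_, fun t ht hg H hH => ?_⟩
  · obtain ⟨t, ⟨ht, hgt⟩, huniq⟩ := hν.exists_unique_saddle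
    exact ⟨t, ⟨ht, (hiff t ht).trans hgt⟩, fun s hs => huniq s ⟨hs.1, (hiff s hs.1).symm.trans hs.2⟩⟩
  · have hsmall : |rho q β * t| ≤ Real.exp (-2) := by
      rw [abs_mul, abs_of_nonneg (rho_nonneg q β), abs_of_pos (by linarith [ht.1])]
      have h1 := rho_le hq2 hA
      have h2 : rho q β * t ≤ 1 / 1000000 * 2 :=
        mul_le_mul h1 (by linarith [ht.2]) (by linarith [ht.1]) (by norm_num)
      have h3 : (1 / 16 : ℝ) ≤ Real.exp (-2) := by
        have h4 : Real.exp 2 ≤ 16 := by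
          rw [show (2 : ℝ) = 1 + 1 by norm_num, Real.exp_add]
          nlinarith [Real.exp_one_lt_d9, Real.exp_pos 1]
        rw [Real.exp_neg, one_div]
        exact inv_anti₀ (Real.exp_pos 2) h4
      linarith
    rw [Fcal_eq_PhiR hq2 hH (rho_ne_zero q (abs_pos.1 hβ0)) hsmall, Complex.ofReal_re]
    have h := (tendsto_log_EZ hq hq2 hA ht hg).const_mul β⁻¹
    rw [mul_comm, ← div_eq_mul_inv] at h
    refine h.congr fun m => ?_
    rw [fEnergy]
    push_cast
    ring

end SYK
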